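/- arXiv:1304.1606 — 2 statements merged into one kernel-verified Lean document; each statement's English description precedes it below -/
import Mathlib

section
/- ∫_0^1 [K(√(1-k²))]³ / (√k (1-k²)^{3/4}) dk = 3 Γ(1/4)⁸ / (32 √2 π²), where K is the complete elliptic integral of the first kind. -/
open Real MeasureTheory intervalIntegral Complex

/-- Complete elliptic integral of the first kind. -/
noncomputable def ellipticK (k : ℝ) : ℝ :=
  ∫ θ in (0:ℝ)..(π/2), (1 - k ^ 2 * Real.sin θ ^ 2) ^ (-(1/2 : ℝ))

/-- Complete elliptic integral of the second kind. -/
noncomputable def ellipticE (k : ℝ) : ℝ :=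
  ∫ θ in (0:ℝ)..(π/2), (1 - k ^ 2 * Real.sin θ ^ 2) ^ ((1/2 : ℝ))

/-- Legendre function of the first kind of degree ν : P_ν(1-2z) = ₂F₁(-ν, ν+1; 1; z). -/
noncomputable def legendreP (ν : ℂ) (x : ℂ) : ℂ :=
  ordinaryHypergeometric (-ν) (ν + 1) 1 ((1 - x) / 2)

section aux
open Filter Topology Set

noncomputable def tht (j : ℕ) (a y : ℝ) : ℝ :=
  ∑' n : ℤ, ((n : ℝ) + a) ^ (2 * j) * Real.exp (-π * ((n : ℝ) + a) ^ 2 * y)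

lemma tht_summable (j : ℕ) (a : ℝ) {y : ℝ} (hy : 0 < y) :
    Summable (fun n : ℤ => ((n : ℝ) + a) ^ (2 * j) * Real.exp (-π * ((n : ℝ) + a) ^ 2 * y)) := by
  have := HurwitzKernelBounds.summable_f_int (2 * j) a hy
  refine this.congr fun n => ?_
  simp only [HurwitzKernelBounds.f_int]
  rw [Even.pow_abs ⟨j, by ring⟩]

lemma tht_hasDerivAt (j : ℕ) (a : ℝ) {y : ℝ} (hy : 0 < y) :
    HasDerivAt (tht j a) (-π * tht (j + 1) a y) y := by
  have h2 : y / 2 < y := by linarith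
  have key := hasDerivAt_tsum_of_isPreconnected
    (u := fun n : ℤ => π * (((n : ℝ) + a) ^ (2 * (j + 1)) * Real.exp (-π * ((n : ℝ) + a) ^ 2 * (y / 2))))
    (t := Ioi (y / 2))
    (g := fun (n : ℤ) (y : ℝ) => ((n : ℝ) + a) ^ (2 * j) * Real.exp (-π * ((n : ℝ) + a) ^ 2 * y))
    (g' := fun (n : ℤ) (y : ℝ) =>
      -π * (((n : ℝ) + a) ^ (2 * (j + 1)) * Real.exp (-π * ((n : ℝ) + a) ^ 2 * y)))
    (y₀ := y) (y := y)
    ((tht_summable (j + 1) a (by linarith : 0 < y / 2)).mul_left π) isOpen_Ioi isPreconnected_Ioi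
    ?_ ?_ h2 (tht_summable j a hy) h2
  · rw [tsum_mul_left] at key
    exact key
  · intro n z _
    have h1 : HasDerivAt (fun z : ℝ => -π * ((n : ℝ) + a) ^ 2 * z) (-π * ((n : ℝ) + a) ^ 2) z := by
      have := (hasDerivAt_id' z).const_mul (-π * ((n : ℝ) + a) ^ 2)
      rwa [mul_one] at this
    convert! h1.exp.const_mul (((n : ℝ) + a) ^ (2 * j)) using 1
    ring
  · intro n z hz
    have hz' : y / 2 < z := hz
    rw [norm_mul, Real.norm_eq_abs, abs_neg, abs_of_pos pi_pos]
    have hp : 0 ≤ ((n : ℝ) + a) ^ (2 * (j + 1)) := by rw [pow_mul]; positivity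
    rw [Real.norm_of_nonneg (by positivity)]
    gcongr ?_ * (?_ * Real.exp ?_)
    have : 0 ≤ π * ((n : ℝ) + a) ^ 2 := by positivity
    nlinarith

/-- master decay bound -/
lemma tht_decay (a c : ℝ) (w : ℤ → ℝ) (hw : ∀ n, w n = 0 ∨ c ≤ ((n : ℝ) + a) ^ 2)
    (hw0 : ∀ n, 0 ≤ w n)
    (hs : Summable (fun n : ℤ => w n * Real.exp (-π * ((n : ℝ) + a) ^ 2 * 1))) :
    ∃ K : ℝ, ∀ y : ℝ, 1 ≤ y →
      0 ≤ ∑' n : ℤ, w n * Real.exp (-π * ((n : ℝ) + a) ^ 2 * y) ∧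
      ∑' n : ℤ, w n * Real.exp (-π * ((n : ℝ) + a) ^ 2 * y) ≤ K * Real.exp (-π * c * y) := by
  refine ⟨Real.exp (π * c) * ∑' n : ℤ, w n * Real.exp (-π * ((n : ℝ) + a) ^ 2 * 1), fun y hy => ?_⟩
  have hle : ∀ n : ℤ, w n * Real.exp (-π * ((n : ℝ) + a) ^ 2 * y) ≤
      (Real.exp (π * c) * Real.exp (-π * c * y)) * (w n * Real.exp (-π * ((n : ℝ) + a) ^ 2 * 1)) := by
    intro n
    rcases hw n with h | h
    · simp [h]
    · rw [mul_left_comm, ← Real.exp_add, ← Real.exp_add]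
      refine mul_le_mul_of_nonneg_left (Real.exp_le_exp.2 ?_) (hw0 n)
      have : 0 ≤ π * ((((n : ℝ) + a) ^ 2 - c) * (y - 1)) :=
        mul_nonneg pi_pos.le (mul_nonneg (by linarith) (by linarith))
      nlinarith
  have hpos : ∀ n : ℤ, 0 ≤ w n * Real.exp (-π * ((n : ℝ) + a) ^ 2 * y) := fun n =>
    mul_nonneg (hw0 n) (Real.exp_pos _).le
  refine ⟨tsum_nonneg hpos, ?_⟩
  have hs2 := hs.mul_left (Real.exp (π * c) * Real.exp (-π * c * y))
  have := (Summable.of_nonneg_of_le hpos hle hs2).tsum_le_tsum hle hs2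
  rw [tsum_mul_left] at this
  linarith

lemma tsum_parity (g : ℤ × ℤ → ℝ) (hg : Summable g) :
    ∑' p, g p = ∑' p : ℤ × ℤ, g (p.1 + p.2, p.1 - p.2) +
      ∑' p : ℤ × ℤ, g (p.1 + p.2 + 1, p.1 - p.2) := by
  let i : ℤ × ℤ → ℤ × ℤ := fun p => (p.1 + p.2, p.1 - p.2)
  let k : ℤ × ℤ → ℤ × ℤ := fun p => (p.1 + p.2 + 1, p.1 - p.2)
  have hi : Function.Injective i := by
    rintro ⟨a, b⟩ ⟨c, d⟩ h
    simp only [i, Prod.mk.injEq] at h ⊢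
    omega
  have hk : Function.Injective k := by
    rintro ⟨a, b⟩ ⟨c, d⟩ h
    simp only [k, Prod.mk.injEq] at h ⊢
    omega
  have hc : IsCompl (range i) (range k) := by
    rw [isCompl_iff, Set.disjoint_iff, codisjoint_iff]
    constructor
    · rintro p ⟨⟨⟨a, b⟩, rfl⟩, ⟨⟨c, d⟩, h⟩⟩
      simp only [i, k, Prod.mk.injEq] at h
      omega
    · refine eq_univ_of_forall ?_
      rintro ⟨m, n⟩
      rcases Int.even_or_odd' (m + n) with ⟨l, hl | hl⟩
      · left; exact ⟨(l, m - l), by simp only [i, Prod.mk.injEq]; omega⟩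
      · right; exact ⟨(l, m - l - 1), by simp only [k, Prod.mk.injEq]; omega⟩
  have h1 := (hi.hasSum_range_iff (f := g)).2 ((hg.comp_injective hi).hasSum)
  have h2 := (hk.hasSum_range_iff (f := g)).2 ((hg.comp_injective hk).hasSum)
  exact (h1.add_isCompl hc h2).tsum_eq

noncomputable abbrev tA (y : ℝ) : ℝ := tht 0 (1 / 2) y
noncomputable abbrev tC (y : ℝ) : ℝ := tht 0 0 y

lemma tC_def (y : ℝ) : tC y = ∑' n : ℤ, Real.exp (-π * (n : ℝ) ^ 2 * y) := by
  simp [tC, tht]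
lemma tA_def (y : ℝ) : tA y = ∑' n : ℤ, Real.exp (-π * ((n : ℝ) + 1 / 2) ^ 2 * y) := by
  simp [tA, tht]
lemma tC_sum {y : ℝ} (hy : 0 < y) : Summable fun n : ℤ => Real.exp (-π * (n : ℝ) ^ 2 * y) := by
  simpa using tht_summable 0 0 hy
lemma tA_sum {y : ℝ} (hy : 0 < y) :
    Summable fun n : ℤ => Real.exp (-π * ((n : ℝ) + 1 / 2) ^ 2 * y) := by
  simpa using tht_summable 0 (1 / 2) hy

lemma tsum_prod_mul {f g : ℤ → ℝ} (hf : Summable f) (hg : Summable g) (hf0 : ∀ n, 0 ≤ f n)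
    (hg0 : ∀ n, 0 ≤ g n) :
    (∑' n, f n) * (∑' n, g n) = ∑' p : ℤ × ℤ, f p.1 * g p.2 :=
  hf.tsum_mul_tsum hg (hf.mul_of_nonneg hg hf0 hg0)

lemma tC_sq {y : ℝ} (hy : 0 < y) : tC y ^ 2 = tC (2 * y) ^ 2 + tA (2 * y) ^ 2 := by
  have hy2 : 0 < 2 * y := by linarith
  simp only [tC_def, tA_def, sq (tsum _)]
  have e0 : ∀ x : ℝ, 0 ≤ Real.exp x := fun x => (Real.exp_pos x).le
  rw [tsum_prod_mul (tC_sum hy) (tC_sum hy) (fun _ => e0 _) (fun _ => e0 _),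
    tsum_prod_mul (tC_sum hy2) (tC_sum hy2) (fun _ => e0 _) (fun _ => e0 _),
    tsum_prod_mul (tA_sum hy2) (tA_sum hy2) (fun _ => e0 _) (fun _ => e0 _),
    tsum_parity _ ((tC_sum hy).mul_of_nonneg (tC_sum hy) (fun _ => e0 _) (fun _ => e0 _))]
  congr 1 <;>
  · refine tsum_congr fun p => ?_
    rw [← Real.exp_add, ← Real.exp_add]
    congr 1
    push_cast
    ring

lemma tA_sq {y : ℝ} (hy : 0 < y) : tA y ^ 2 = 2 * tA (2 * y) * tC (2 * y) := by
  have hy2 : 0 < 2 * y := by linarith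
  have e0 : ∀ x : ℝ, 0 ≤ Real.exp x := fun x => (Real.exp_pos x).le
  rw [mul_assoc, two_mul]
  conv_rhs => arg 2; rw [mul_comm]
  simp only [tC_def, tA_def, sq (tsum _)]
  rw [tsum_prod_mul (tA_sum hy) (tA_sum hy) (fun _ => e0 _) (fun _ => e0 _),
    tsum_prod_mul (tA_sum hy2) (tC_sum hy2) (fun _ => e0 _) (fun _ => e0 _),
    tsum_prod_mul (tC_sum hy2) (tA_sum hy2) (fun _ => e0 _) (fun _ => e0 _),
    tsum_parity _ ((tA_sum hy).mul_of_nonneg (tA_sum hy) (fun _ => e0 _) (fun _ => e0 _))]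
  congr 1
  · refine tsum_congr fun p => ?_
    rw [← Real.exp_add, ← Real.exp_add]
    congr 1
    push_cast
    ring
  · rw [← (Equiv.prodCongr (Equiv.addRight (1 : ℤ)) (Equiv.refl ℤ)).tsum_eq
      (fun p : ℤ × ℤ => Real.exp (-π * (p.1 : ℝ) ^ 2 * (2 * y)) * Real.exp (-π * ((p.2 : ℝ) + 1 / 2) ^ 2 * (2 * y)))]
    refine tsum_congr fun p => ?_
    simp only [Equiv.prodCongr_apply, Prod.map, Equiv.coe_addRight, Equiv.refl_apply]
    rw [← Real.exp_add, ← Real.exp_add]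
    congr 1
    push_cast
    ring

lemma tsum_int_even_odd {f : ℤ → ℝ} (hf : Summable f) :
    ∑' n, f n = ∑' n : ℤ, f (2 * n) + ∑' n : ℤ, f (2 * n + 1) := by
  have hi : Function.Injective (fun n : ℤ => 2 * n) := fun a b h => by simpa using h
  have hk : Function.Injective (fun n : ℤ => 2 * n + 1) := fun a b h => by simpa using h
  have h1 := (hi.hasSum_range_iff (f := f)).2 ((hf.comp_injective hi).hasSum)
  have h2 := (hk.hasSum_range_iff (f := f)).2 ((hf.comp_injective hk).hasSum)
  refine (h1.add_isCompl ?_ h2).tsum_eq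
  rw [isCompl_iff, Set.disjoint_iff, codisjoint_iff]
  constructor
  · rintro p ⟨⟨a, rfl⟩, ⟨c, h⟩⟩
    simp only at h
    omega
  · refine eq_univ_of_forall fun m => ?_
    rcases Int.even_or_odd' m with ⟨l, hl | hl⟩
    · left; exact ⟨l, hl.symm⟩
    · right; exact ⟨l, hl.symm⟩

lemma tC_split {y : ℝ} (hy : 0 < y) : tC y = tC (4 * y) + tA (4 * y) := by
  simp only [tC_def, tA_def]
  rw [tsum_int_even_odd (tC_sum hy)]
  congr 1 <;>
  · refine tsum_congr fun p => ?_
    congr 1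
    push_cast
    ring

noncomputable def tB (y : ℝ) : ℝ := 2 * tC (4 * y) - tC y

lemma tB_split {y : ℝ} (hy : 0 < y) : tB y = tC (4 * y) - tA (4 * y) := by
  rw [tB, tC_split hy]; ring

lemma tC_inv {y : ℝ} (hy : 0 < y) : tC (1 / y) = √y * tC y := by
  have := Real.tsum_exp_neg_mul_int_sq hy
  simp only [tC_def]
  have h1 : ∀ n : ℤ, Real.exp (-π * (n : ℝ) ^ 2 * y) = Real.exp (-π * y * (n : ℝ) ^ 2) := fun n => by
    congr 1; ring
  have h2 : ∀ n : ℤ, Real.exp (-π * (n : ℝ) ^ 2 * (1 / y)) = Real.exp (-π / y * (n : ℝ) ^ 2) :=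
    fun n => by congr 1; ring
  simp only [h1, h2]
  rw [this, ← Real.sqrt_eq_rpow]
  have : √y ≠ 0 := (Real.sqrt_pos.2 hy).ne'
  field_simp

lemma tA_inv {y : ℝ} (hy : 0 < y) : tA (1 / y) = √y * tB y := by
  have h4 : (0 : ℝ) < 1 / (4 * y) := by positivity
  have h := tC_split h4
  have e : 4 * (1 / (4 * y)) = 1 / y := by field_simp
  rw [e, tC_inv (by positivity), tC_inv hy] at h
  have e4 : √(4 * y) = 2 * √y := by
    rw [Real.sqrt_mul (by norm_num), show (4 : ℝ) = 2 ^ 2 by norm_num, Real.sqrt_sq (by norm_num)]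
  rw [e4] at h
  rw [tB]; linarith

lemma tA_pos {y : ℝ} (hy : 0 < y) : 0 < tA y := by
  rw [tA_def]
  exact (tA_sum hy).tsum_pos (fun n => (Real.exp_pos _).le) 0 (Real.exp_pos _)
lemma tC_pos {y : ℝ} (hy : 0 < y) : 0 < tC y := by
  rw [tC_def]
  exact (tC_sum hy).tsum_pos (fun n => (Real.exp_pos _).le) 0 (Real.exp_pos _)
lemma tB_eq {y : ℝ} (hy : 0 < y) : tB y = tA (1 / y) / √y := by
  rw [tA_inv hy, mul_div_cancel_left₀ _ (Real.sqrt_pos.2 hy).ne']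
lemma tB_pos {y : ℝ} (hy : 0 < y) : 0 < tB y := by
  rw [tB_eq hy]
  exact div_pos (tA_pos (by positivity)) (Real.sqrt_pos.2 hy)
lemma tB_inv {y : ℝ} (hy : 0 < y) : tB (1 / y) = √y * tA y := by
  rw [tB_eq (by positivity), one_div_one_div, Real.sqrt_div zero_le_one, Real.sqrt_one]
  field_simp

lemma tB_sq {y : ℝ} (hy : 0 < y) : tB y ^ 2 = tC (2 * y) ^ 2 - tA (2 * y) ^ 2 := by
  have h1 := tC_sq (by linarith : 0 < 2 * y)
  have h2 := tA_sq (by linarith : 0 < 2 * y)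
  rw [show 2 * (2 * y) = 4 * y by ring] at h1 h2
  rw [tB_split hy, h1, h2]; ring

lemma tB_dbl {y : ℝ} (hy : 0 < y) : tB (2 * y) ^ 2 = tB y * tC y := by
  rw [tB_sq (by linarith), show 2 * (2 * y) = 4 * y by ring, tB_split hy, tC_split hy]; ring

lemma tC_dbl {y : ℝ} (hy : 0 < y) : 2 * tC (2 * y) ^ 2 = tC y ^ 2 + tB y ^ 2 := by
  rw [tB_sq hy, tC_sq hy]; ring
lemma tA_dbl {y : ℝ} (hy : 0 < y) : 2 * tA (2 * y) ^ 2 = tC y ^ 2 - tB y ^ 2 := by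
  rw [tB_sq hy, tC_sq hy]; ring

lemma jacobi_quartic {y : ℝ} (hy : 0 < y) : tA y ^ 4 + tB y ^ 4 = tC y ^ 4 := by
  have h1 := tC_sq hy
  have h2 := tB_sq hy
  have h3 := tA_sq hy
  have e : ∀ x : ℝ, x ^ 4 = (x ^ 2) ^ 2 := fun x => by ring
  rw [e, e (tB y), e (tC y), h1, h2, h3]; ring


noncomputable def tA1 (y : ℝ) : ℝ := -π * tht 1 (1 / 2) y
noncomputable def tA2 (y : ℝ) : ℝ := -π * (-π * tht 2 (1 / 2) y)
noncomputable def tC1 (y : ℝ) : ℝ := -π * tht 1 0 y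
noncomputable def tC2 (y : ℝ) : ℝ := -π * (-π * tht 2 0 y)
noncomputable def tB1 (y : ℝ) : ℝ := 8 * tC1 (4 * y) - tC1 y
noncomputable def tB2 (y : ℝ) : ℝ := 32 * tC2 (4 * y) - tC2 y

lemma hA {y : ℝ} (hy : 0 < y) : HasDerivAt tA (tA1 y) y := tht_hasDerivAt 0 _ hy
lemma hA1 {y : ℝ} (hy : 0 < y) : HasDerivAt tA1 (tA2 y) y :=
  (tht_hasDerivAt 1 _ hy).const_mul _
lemma hC {y : ℝ} (hy : 0 < y) : HasDerivAt tC (tC1 y) y := tht_hasDerivAt 0 _ hy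
lemma hC1 {y : ℝ} (hy : 0 < y) : HasDerivAt tC1 (tC2 y) y :=
  (tht_hasDerivAt 1 _ hy).const_mul _

lemma comp_scale {f : ℝ → ℝ} {f' c y : ℝ} (h : HasDerivAt f f' (c * y)) :
    HasDerivAt (fun z => f (c * z)) (c * f') y := by
  have h2 : HasDerivAt (fun z : ℝ => c * z) c y := by
    simpa using (hasDerivAt_id' y).const_mul c
  have := HasDerivAt.comp y h h2
  rw [mul_comm c f']
  exact this

lemma hB {y : ℝ} (hy : 0 < y) : HasDerivAt tB (tB1 y) y := by
  have h := ((comp_scale (hC (by linarith : 0 < 4 * y))).const_mul 2).sub (hC hy)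
  convert! h using 1
  rw [tB1]; ring
lemma hB1 {y : ℝ} (hy : 0 < y) : HasDerivAt tB1 (tB2 y) y := by
  have h := ((comp_scale (hC1 (by linarith : 0 < 4 * y))).const_mul 8).sub (hC1 hy)
  convert! h using 1
  rw [tB2]; ring

def Dec (f : ℝ → ℝ) : Prop := ∀ m : ℕ, Tendsto (fun y => y ^ m * f y) atTop (𝓝 0)

lemma Dec.of_bound {f : ℝ → ℝ} {K c : ℝ} (hc : 0 < c)
    (h : ∀ y, 1 ≤ y → |f y| ≤ K * Real.exp (-c * y)) : Dec f := by
  intro m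
  have h1 := (tendsto_rpow_mul_exp_neg_mul_atTop_nhds_zero (m : ℝ) c hc).const_mul K
  rw [mul_zero] at h1
  refine squeeze_zero_norm' ?_ h1
  filter_upwards [eventually_ge_atTop 1] with y hy
  rw [norm_mul, Real.norm_eq_abs, Real.norm_eq_abs, abs_of_nonneg (by positivity), Real.rpow_natCast]
  calc y ^ m * |f y| ≤ y ^ m * (K * Real.exp (-c * y)) := by gcongr; exact h y hy
    _ = _ := by ring

lemma Dec.tendsto {f : ℝ → ℝ} (h : Dec f) : Tendsto f atTop (𝓝 0) := by
  simpa using h 0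
lemma Dec.add {f g : ℝ → ℝ} (hf : Dec f) (hg : Dec g) : Dec (fun y => f y + g y) := fun m => by
  simpa [mul_add] using (hf m).add (hg m)
lemma Dec.mul_tendsto {f g : ℝ → ℝ} {L : ℝ} (hf : Dec f) (hg : Tendsto g atTop (𝓝 L)) :
    Dec (fun y => f y * g y) := fun m => by
  simpa [mul_assoc] using (hf m).mul hg
lemma Dec.const_mul {f : ℝ → ℝ} (hf : Dec f) (c : ℝ) : Dec (fun y => c * f y) := by
  simpa [mul_comm] using hf.mul_tendsto (tendsto_const_nhds (x := c))
lemma Dec.scale {f : ℝ → ℝ} (hf : Dec f) : Dec (fun y => f (4 * y)) := fun m => by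
  have h4 : Tendsto (fun y : ℝ => 4 * y) atTop atTop := tendsto_id.const_mul_atTop (by norm_num)
  have := ((hf m).comp h4).const_mul ((4 : ℝ) ^ m)⁻¹
  rw [mul_zero] at this
  refine this.congr fun y => ?_
  simp only [Function.comp]
  rw [mul_pow, mul_assoc, inv_mul_cancel_left₀ (by positivity)]
lemma Dec.pow_mul {f : ℝ → ℝ} (hf : Dec f) (k : ℕ) : Dec (fun y => y ^ k * f y) := fun m => by
  refine (hf (m + k)).congr fun y => ?_
  rw [pow_add, mul_assoc]

lemma int_sq_ge_one {n : ℤ} (h : n ≠ 0) : (1 : ℝ) ≤ ((n : ℝ) + 0) ^ 2 := by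
  have : (1 : ℤ) ≤ n ^ 2 := by
    have := Int.one_le_abs h
    rw [← sq_abs]; nlinarith
  rw [add_zero]; exact_mod_cast this

lemma dec_thtC (j : ℕ) (hj : j ≠ 0) : Dec (tht j 0) := by
  obtain ⟨K, hK⟩ := tht_decay 0 1 (fun n => ((n : ℝ) + 0) ^ (2 * j)) (fun n => by
    by_cases h : n = 0
    · left; simp [h, hj]
    · right; exact int_sq_ge_one h) (fun n => by rw [pow_mul]; positivity)
    (tht_summable j 0 one_pos)
  refine Dec.of_bound (K := K) pi_pos fun y hy => ?_
  have := hK y hy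
  rw [mul_one] at this
  rw [tht, abs_of_nonneg this.1]
  exact this.2

lemma dec_thtA (j : ℕ) : Dec (tht j (1 / 2)) := by
  obtain ⟨K, hK⟩ := tht_decay (1 / 2) (1 / 4) (fun n => ((n : ℝ) + 1 / 2) ^ (2 * j)) (fun n => by
    right
    have h : (0 : ℤ) ≤ n * (n + 1) := by
      rcases le_or_gt 0 n with h | h
      · positivity
      · nlinarith
    have : (0 : ℝ) ≤ n * (n + 1) := by exact_mod_cast h
    nlinarith) (fun n => by rw [pow_mul]; positivity)
    (tht_summable j _ one_pos)
  refine Dec.of_bound (K := K) (c := π * (1 / 4)) (by positivity) fun y hy => ?_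
  have := hK y hy
  rw [tht, abs_of_nonneg this.1]
  convert this.2 using 3
  ring

lemma dec_A : Dec tA := dec_thtA 0
lemma dec_A1 : Dec tA1 := (dec_thtA 1).const_mul _
lemma dec_C1 : Dec tC1 := (dec_thtC 1 one_ne_zero).const_mul _
lemma dec_C2 : Dec tC2 := ((dec_thtC 2 two_ne_zero).const_mul _).const_mul _
lemma dec_B1 : Dec tB1 := by
  have := (dec_C1.scale.const_mul 8).add (dec_C1.const_mul (-1))
  convert! this using 2
  rw [tB1]; ring
lemma dec_B2 : Dec tB2 := by
  have := (dec_C2.scale.const_mul 32).add (dec_C2.const_mul (-1))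
  convert! this using 2
  rw [tB2]; ring

lemma tC_tendsto : Tendsto tC atTop (𝓝 1) := by
  obtain ⟨K, hK⟩ := tht_decay 0 1 (fun n => if n = 0 then 0 else 1) (fun n => by
    by_cases h : n = 0
    · left; simp [h]
    · right; exact int_sq_ge_one h) (fun n => by split_ifs <;> norm_num)
    (by
      refine Summable.of_nonneg_of_le (fun n => ?_) (fun n => ?_) (tht_summable 0 0 one_pos)
      · split_ifs
        · simp
        · positivity
      · split_ifs
        · simp; positivity
        · simp)
  have : Dec (fun y => tC y - 1) := by
    refine Dec.of_bound (K := K) pi_pos fun y hy => ?_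
    have h := hK y hy
    have e : tC y - 1 = ∑' n : ℤ, (if n = 0 then (0 : ℝ) else 1) * Real.exp (-π * ((n : ℝ) + 0) ^ 2 * y) := by
      rw [tC_def, (tC_sum (by linarith)).tsum_eq_add_tsum_ite 0]
      simp only [Int.cast_zero, ne_eq, OfNat.ofNat_ne_zero, not_false_eq_true, zero_pow, mul_zero,
        zero_mul, Real.exp_zero, add_sub_cancel_left]
      refine tsum_congr fun n => ?_
      split_ifs <;> simp
    rw [e, abs_of_nonneg h.1]
    convert h.2 using 3
    ring
  simpa using this.tendsto.add_const 1

lemma tB_tendsto : Tendsto tB atTop (𝓝 1) := by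
  have h4 : Tendsto (fun y : ℝ => 4 * y) atTop atTop := tendsto_id.const_mul_atTop (by norm_num)
  have := ((tC_tendsto.comp h4).const_mul 2).sub tC_tendsto
  norm_num at this
  exact this

lemma dbl_const {f : ℝ → ℝ} {L : ℝ} (h : ∀ y, 0 < y → f (2 * y) = f y)
    (hL : Tendsto f atTop (𝓝 L)) {y : ℝ} (hy : 0 < y) : f y = L := by
  have h1 : ∀ n : ℕ, f (2 ^ n * y) = f y := by
    intro n
    induction n with
    | zero => simp
    | succ n ih => rw [pow_succ', mul_assoc, h _ (by positivity), ih]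
  have h2 : Tendsto (fun n : ℕ => (2 : ℝ) ^ n * y) atTop atTop :=
    (tendsto_pow_atTop_atTop_of_one_lt (by norm_num)).atTop_mul_const hy
  have h3 := hL.comp h2
  have : (f ∘ fun n : ℕ => (2 : ℝ) ^ n * y) = fun _ => f y := funext h1
  rw [this] at h3
  exact tendsto_nhds_unique tendsto_const_nhds h3

noncomputable def al (y : ℝ) : ℝ := tA1 y / tA y
noncomputable def be (y : ℝ) : ℝ := tB1 y / tB y
noncomputable def ga (y : ℝ) : ℝ := tC1 y / tC y

lemma al_tendsto : Tendsto al atTop (𝓝 (-(π / 4))) := by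
  obtain ⟨K, hK⟩ := tht_decay (1 / 2) (9 / 4) (fun n => ((n : ℝ) + 1 / 2) ^ 2 - 1 / 4) (fun n => by
    by_cases h0 : n = 0
    · left; subst h0; norm_num
    by_cases h1 : n = -1
    · left; subst h1; norm_num
    right
    have h : (2 : ℤ) ≤ n * (n + 1) := by
      rcases le_or_gt 0 n with h | h
      · have : 1 ≤ n := by omega
        nlinarith
      · have : n ≤ -2 := by omega
        nlinarith
    have : (2 : ℝ) ≤ n * (n + 1) := by exact_mod_cast h
    nlinarith) (fun n => by
      have h : (0 : ℤ) ≤ n * (n + 1) := by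
        rcases le_or_gt 0 n with h | h
        · positivity
        · nlinarith
      have : (0 : ℝ) ≤ n * (n + 1) := by exact_mod_cast h
      nlinarith)
    (by
      have := (tht_summable 1 (1 / 2) one_pos).sub ((tht_summable 0 (1 / 2) one_pos).mul_left (1 / 4))
      refine this.congr fun n => ?_
      simp only [mul_one, mul_zero, pow_zero]
      ring)
  have : Dec (fun y => al y + π / 4) := by
    refine Dec.of_bound (K := π * K) (c := 2 * π) (by positivity) fun y hy => ?_
    have hy0 : 0 < y := by linarith
    have h := hK y hy
    have e : tA1 y + π / 4 * tA y = -π * ∑' n : ℤ, (((n : ℝ) + 1 / 2) ^ 2 - 1 / 4) *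
        Real.exp (-π * ((n : ℝ) + 1 / 2) ^ 2 * y) := by
      have := ((tht_summable 1 (1 / 2) hy0).hasSum.sub
        ((tht_summable 0 (1 / 2) hy0).hasSum.mul_left (1 / 4))).tsum_eq
      rw [show tA1 y + π / 4 * tA y = -π * (tht 1 (1/2) y - 1 / 4 * tht 0 (1/2) y) by
        rw [tA1]; ring]
      congr 1
      rw [tht, tht, ← this]
      refine tsum_congr fun n => ?_
      simp only [mul_one, mul_zero, pow_zero]
      ring
    have hAl : Real.exp (-π * (1 / 4) * y) ≤ tA y := by
      rw [tA_def]
      have := (tA_sum hy0).le_tsum 0 (fun _ _ => (Real.exp_pos _).le)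
      refine le_trans (le_of_eq ?_) this
      congr 1; push_cast; ring
    have hAp := tA_pos hy0
    rw [show al y + π / 4 = (tA1 y + π / 4 * tA y) / tA y by rw [al]; field_simp, e, abs_div, abs_mul,
      abs_neg, abs_of_pos pi_pos, abs_of_nonneg h.1, abs_of_pos hAp, div_le_iff₀ hAp]
    have hKe : 0 ≤ K * Real.exp (-π * (9 / 4) * y) := h.1.trans h.2
    have hK0 : 0 ≤ K := nonneg_of_mul_nonneg_left hKe (Real.exp_pos _)
    calc π * _ ≤ π * (K * Real.exp (-π * (9 / 4) * y)) := by gcongr; exact h.2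
      _ = π * K * Real.exp (-(2 * π) * y) * Real.exp (-π * (1 / 4) * y) := by
        rw [mul_assoc (π * K), ← Real.exp_add, mul_assoc]; ring_nf
      _ ≤ _ := by gcongr
  have := this.tendsto.add_const (-(π / 4))
  simpa using this

lemma deriv_match {f g : ℝ → ℝ} {a b y : ℝ} (hy : 0 < y) (hf : HasDerivAt f a y)
    (hg : HasDerivAt g b y) (h : ∀ z, 0 < z → f z = g z) : a = b := by
  refine hf.unique (hg.congr_of_eventuallyEq ?_)
  filter_upwards [lt_mem_nhds hy] with z hz using h z hz

lemma A1_eq {y : ℝ} (hy : 0 < y) : tA1 y = al y * tA y := by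
  rw [al, div_mul_cancel₀ _ (tA_pos hy).ne']
lemma B1_eq {y : ℝ} (hy : 0 < y) : tB1 y = be y * tB y := by
  rw [be, div_mul_cancel₀ _ (tB_pos hy).ne']
lemma C1_eq {y : ℝ} (hy : 0 < y) : tC1 y = ga y * tC y := by
  rw [ga, div_mul_cancel₀ _ (tC_pos hy).ne']

lemma dblA {y : ℝ} (hy : 0 < y) : al (2 * y) + ga (2 * y) = al y := by
  have hy2 : 0 < 2 * y := by linarith
  have h := deriv_match hy ((hA hy).pow 2)
    (((comp_scale (hA hy2)).const_mul 2).mul (comp_scale (hC hy2))) (fun z hz => tA_sq hz)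
  have e := tA_sq hy
  have p1 := tA_pos hy
  rw [A1_eq hy, A1_eq hy2, C1_eq hy2] at h
  apply mul_left_cancel₀ (pow_ne_zero 2 p1.ne')
  norm_num at h
  linear_combination (al (2 * y) + ga (2 * y)) * e - h / 2

lemma dblB {y : ℝ} (hy : 0 < y) : 4 * be (2 * y) = be y + ga y := by
  have hy2 : 0 < 2 * y := by linarith
  have h := deriv_match hy ((comp_scale (hB hy2)).pow 2) ((hB hy).mul (hC hy))
    (fun z hz => tB_dbl hz)
  have e := tB_dbl hy
  have p1 := tB_pos hy2
  rw [B1_eq hy, B1_eq hy2, C1_eq hy] at h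
  apply mul_left_cancel₀ (pow_ne_zero 2 p1.ne')
  norm_num at h
  linear_combination h - (be y + ga y) * e

lemma dblC {y : ℝ} (hy : 0 < y) :
    2 * ga (2 * y) * (tC y ^ 2 + tB y ^ 2) = ga y * tC y ^ 2 + be y * tB y ^ 2 := by
  have hy2 : 0 < 2 * y := by linarith
  have h := deriv_match hy (((comp_scale (hC hy2)).pow 2).const_mul 2)
    (((hC hy).pow 2).add ((hB hy).pow 2)) (fun z hz => tC_dbl hz)
  have e := tC_dbl hy
  rw [B1_eq hy, C1_eq hy2, C1_eq hy] at h
  norm_num at h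
  linear_combination h / 2 - 2 * ga (2 * y) * e

lemma dblA' {y : ℝ} (hy : 0 < y) :
    2 * al (2 * y) * (tC y ^ 2 - tB y ^ 2) = ga y * tC y ^ 2 - be y * tB y ^ 2 := by
  have hy2 : 0 < 2 * y := by linarith
  have h := deriv_match hy (((comp_scale (hA hy2)).pow 2).const_mul 2)
    (((hC hy).pow 2).sub ((hB hy).pow 2)) (fun z hz => tA_dbl hz)
  have e := tA_dbl hy
  rw [B1_eq hy, A1_eq hy2, C1_eq hy] at h
  norm_num at h
  linear_combination h / 2 - 2 * al (2 * y) * e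

lemma R_dbl {y : ℝ} (hy : 0 < y) :
    (be (2 * y) - ga (2 * y)) / tA (2 * y) ^ 4 = (be y - ga y) / tA y ^ 4 := by
  have hy2 : 0 < 2 * y := by linarith
  have p1 := tA_pos hy; have p2 := tA_pos hy2; have p3 := tC_pos hy; have p4 := tB_pos hy
  have h1 := dblB hy
  have h2 := dblC hy
  have h3 := tA_dbl hy
  have h4 := jacobi_quartic hy
  rw [div_eq_div_iff (by positivity) (by positivity)]
  have hs : 0 < tC y ^ 2 + tB y ^ 2 := by positivity
  have e1 : 4 * tA (2 * y) ^ 4 = (tC y ^ 2 - tB y ^ 2) ^ 2 := by rw [← h3]; ring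
  have e2 : tA y ^ 4 = (tC y ^ 2 - tB y ^ 2) * (tC y ^ 2 + tB y ^ 2) := by linear_combination h4
  have e3 : 4 * (be (2 * y) - ga (2 * y)) * (tC y ^ 2 + tB y ^ 2) =
      (be y - ga y) * (tC y ^ 2 - tB y ^ 2) := by
    linear_combination (tC y ^ 2 + tB y ^ 2) * h1 - 2 * h2
  rw [e2]
  linear_combination (tC y ^ 2 - tB y ^ 2) * e3 / 4 - (be y - ga y) * e1 / 4

lemma R2_dbl {y : ℝ} (hy : 0 < y) :
    (ga (2 * y) - al (2 * y)) / tB (2 * y) ^ 4 = (be y - ga y) / tA y ^ 4 := by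
  have hy2 : 0 < 2 * y := by linarith
  have p1 := tA_pos hy; have p2 := tB_pos hy2; have p3 := tC_pos hy; have p4 := tB_pos hy
  have h1 := dblA' hy
  have h2 := dblC hy
  have h3 := tB_dbl hy
  have h4 := jacobi_quartic hy
  rw [div_eq_div_iff (by positivity) (by positivity)]
  have e1 : tB (2 * y) ^ 4 = tB y ^ 2 * tC y ^ 2 := by
    rw [show tB (2 * y) ^ 4 = (tB (2 * y) ^ 2) ^ 2 by ring, h3]; ring
  have e2 : tA y ^ 4 = (tC y ^ 2 - tB y ^ 2) * (tC y ^ 2 + tB y ^ 2) := by linear_combination h4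
  rw [e1, e2]
  linear_combination (tC y ^ 2 - tB y ^ 2) * h2 / 2 - (tC y ^ 2 + tB y ^ 2) * h1 / 2

lemma inv_tendsto_one {f : ℝ → ℝ} (h : Tendsto f atTop (𝓝 1)) :
    Tendsto (fun y => (f y)⁻¹) atTop (𝓝 1) := by
  simpa using h.inv₀ one_ne_zero

lemma dec_be : Dec be := by
  have := dec_B1.mul_tendsto (inv_tendsto_one tB_tendsto)
  simpa only [← div_eq_mul_inv] using! this
lemma dec_ga : Dec ga := by
  have := dec_C1.mul_tendsto (inv_tendsto_one tC_tendsto)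
  simpa only [← div_eq_mul_inv] using! this

lemma ga_sub_al {y : ℝ} (hy : 0 < y) : ga y - al y = π / 4 * tB y ^ 4 := by
  have h := dbl_const (f := fun y => (ga y - al y) / tB y ^ 4) (L := π / 4) (fun z hz => by
    have h1 := R2_dbl hz
    have hz2 : 0 < z / 2 := by linarith
    have h2 := R2_dbl hz2
    have h3 := R_dbl hz2
    rw [show 2 * (z / 2) = z by ring] at h2 h3
    rw [h1, h2, h3]) (by
      have := (dec_ga.tendsto.sub al_tendsto).div (tB_tendsto.pow 4) (by norm_num)
      convert! this using 2; norm_num) hy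
  have p := tB_pos hy
  rw [← h]; field_simp

lemma be_sub_ga {y : ℝ} (hy : 0 < y) : be y - ga y = π / 4 * tA y ^ 4 := by
  have h := R2_dbl hy
  have p := tA_pos hy
  have p2 := tB_pos (by linarith : 0 < 2 * y)
  rw [ga_sub_al (by linarith), mul_div_assoc, div_self (by positivity), mul_one] at h
  rw [h]; field_simp

noncomputable def al' (y : ℝ) : ℝ := tA2 y / tA y - al y ^ 2
noncomputable def be' (y : ℝ) : ℝ := tB2 y / tB y - be y ^ 2
noncomputable def ga' (y : ℝ) : ℝ := tC2 y / tC y - ga y ^ 2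

lemma hal {y : ℝ} (hy : 0 < y) : HasDerivAt al (al' y) y := by
  have p := (tA_pos hy).ne'
  convert! (hA1 hy).div (hA hy) p using 1
  rw [al', al]; field_simp
lemma hbe {y : ℝ} (hy : 0 < y) : HasDerivAt be (be' y) y := by
  have p := (tB_pos hy).ne'
  convert! (hB1 hy).div (hB hy) p using 1
  rw [be', be]; field_simp
lemma hga {y : ℝ} (hy : 0 < y) : HasDerivAt ga (ga' y) y := by
  have p := (tC_pos hy).ne'
  convert! (hC1 hy).div (hC hy) p using 1
  rw [ga', ga]; field_simp

lemma ga_al' {y : ℝ} (hy : 0 < y) : ga' y - al' y = 4 * be y * (ga y - al y) := by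
  have h := deriv_match hy ((hga hy).sub (hal hy)) (((hB hy).pow 4).const_mul (π / 4))
    (fun z hz => ga_sub_al hz)
  rw [h, ga_sub_al hy, B1_eq hy]; norm_num; ring
lemma be_ga' {y : ℝ} (hy : 0 < y) : be' y - ga' y = 4 * al y * (be y - ga y) := by
  have h := deriv_match hy ((hbe hy).sub (hga hy)) (((hA hy).pow 4).const_mul (π / 4))
    (fun z hz => be_sub_ga hz)
  rw [h, be_sub_ga hy, A1_eq hy]; norm_num; ring
lemma al_dbl' {y : ℝ} (hy : 0 < y) : 2 * (al' (2 * y) + ga' (2 * y)) = al' y := by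
  have hy2 : 0 < 2 * y := by linarith
  have h := deriv_match hy ((comp_scale (hal hy2)).add (comp_scale (hga hy2))) (hal hy)
    (fun z hz => dblA hz)
  linarith

lemma be_sub_al {y : ℝ} (hy : 0 < y) : be y - al y = π / 4 * tC y ^ 4 := by
  linear_combination ga_sub_al hy + be_sub_ga hy + π / 4 * jacobi_quartic hy

noncomputable def Hf (y : ℝ) : ℝ := be' y + ga' y - 4 * be y * ga y

lemma Hf_eq1 {y : ℝ} (hy : 0 < y) : Hf y = al' y + ga' y - 4 * al y * ga y := by
  rw [Hf]; linear_combination ga_al' hy + be_ga' hy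
lemma Hf_eq2 {y : ℝ} (hy : 0 < y) : Hf y = al' y + be' y - 4 * al y * be y := by
  rw [Hf]; linear_combination ga_al' hy

lemma Hf_dbl {y : ℝ} (hy : 0 < y) : 4 * Hf (2 * y) = Hf y := by
  have hy2 : 0 < 2 * y := by linarith
  have e : (ga (2 * y) - al (2 * y)) ^ 2 = (ga y - al y) * (be y - al y) := by
    rw [ga_sub_al hy2, ga_sub_al hy, be_sub_al hy,
      show (π / 4 * tB (2 * y) ^ 4) ^ 2 = (π / 4) ^ 2 * (tB (2 * y) ^ 2) ^ 4 by ring, tB_dbl hy]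
    ring
  have h1 := Hf_eq1 hy2
  have h2 := al_dbl' hy
  have h3 := dblA hy
  have h4 := Hf_eq1 hy
  have h5 := Hf_eq2 hy
  have h6 : Hf y = be' y + ga' y - 4 * be y * ga y := rfl
  have e2 : (ga (2 * y) + al (2 * y)) ^ 2 = al y ^ 2 := by rw [← h3]; ring
  linear_combination 4 * h1 + 2 * h2 - 4 * e2 + 4 * e - h4 - h5 + h6

lemma Hf_zero {y : ℝ} (hy : 0 < y) : Hf y = 0 := by
  have d : Dec Hf := by
    have h1 := (dec_B2.mul_tendsto (inv_tendsto_one tB_tendsto)).add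
      (dec_C2.mul_tendsto (inv_tendsto_one tC_tendsto))
    have h2 := ((dec_be.mul_tendsto dec_be.tendsto).const_mul (-1)).add
      ((dec_ga.mul_tendsto dec_ga.tendsto).const_mul (-1))
    have h3 := (dec_be.mul_tendsto dec_ga.tendsto).const_mul (-4)
    convert! (h1.add h2).add h3 using 2
    rw [Hf, be', ga']; ring
  have h := dbl_const (f := fun y => y ^ 2 * Hf y) (L := 0) (fun z hz => by
    rw [← Hf_dbl hz]; ring) (d 2) hy
  simpa [hy.ne'] using h

lemma rankin_cohen {y : ℝ} (hy : 0 < y) :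
    tA2 y * tB y - 6 * tA1 y * tB1 y + tA y * tB2 y = π ^ 2 / 16 * (tA y * tB y * tC y ^ 8) := by
  have h := Hf_zero hy
  rw [Hf_eq2 hy, al', be'] at h
  have p1 := tA_pos hy; have p2 := tB_pos hy
  have e := be_sub_al hy
  have e2 : tA2 y / tA y - 6 * al y * be y + tB2 y / tB y = π ^ 2 / 16 * tC y ^ 8 := by
    have : (be y - al y) ^ 2 = π ^ 2 / 16 * tC y ^ 8 := by rw [e]; ring
    linear_combination h + this
  rw [A1_eq hy, B1_eq hy]
  field_simp at e2
  linear_combination e2 / 16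


noncomputable def eJ (a b : ℝ) : ℝ :=
  ∫ θ in (0:ℝ)..(π/2), (a ^ 2 * Real.cos θ ^ 2 + b ^ 2 * Real.sin θ ^ 2) ^ (-(1/2 : ℝ))

lemma rpow_neg_half (x : ℝ) (hx : 0 ≤ x) : x ^ (-(1/2 : ℝ)) = (√x)⁻¹ := by
  rw [Real.rpow_neg hx, ← Real.sqrt_eq_rpow]

lemma tan_image {b : ℝ} (hb : 0 < b) :
    (fun θ => b * Real.tan θ) '' Ioo 0 (π / 2) = Ioi 0 := by
  ext t
  simp only [mem_image, mem_Ioo, mem_Ioi]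
  constructor
  · rintro ⟨θ, ⟨h1, h2⟩, rfl⟩
    exact mul_pos hb (Real.tan_pos_of_pos_of_lt_pi_div_two h1 h2)
  · intro ht
    refine ⟨Real.arctan (t / b), ⟨Real.arctan_pos.2 (by positivity), Real.arctan_lt_pi_div_two _⟩, ?_⟩
    rw [Real.tan_arctan]; field_simp

lemma eJ_eq {a b : ℝ} (ha : 0 < a) (hb : 0 < b) :
    eJ a b = ∫ t in Ioi (0:ℝ), (√((a ^ 2 + t ^ 2) * (b ^ 2 + t ^ 2)))⁻¹ := by
  have hpi : (0:ℝ) ≤ π / 2 := by positivity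
  rw [eJ, intervalIntegral.integral_of_le hpi, integral_Ioc_eq_integral_Ioo, ← tan_image hb,
    integral_image_eq_integral_abs_deriv_smul (f' := fun θ => b * (1 / Real.cos θ ^ 2))
      measurableSet_Ioo]
  · refine setIntegral_congr_fun measurableSet_Ioo (fun θ hθ => ?_)
    have hc : 0 < Real.cos θ := Real.cos_pos_of_mem_Ioo ⟨by linarith [hθ.1], hθ.2⟩
    have hs : 0 < Real.sin θ := Real.sin_pos_of_pos_of_lt_pi hθ.1 (by linarith [hθ.2])
    have e : (a ^ 2 + (b * Real.tan θ) ^ 2) * (b ^ 2 + (b * Real.tan θ) ^ 2)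
        = (b / Real.cos θ ^ 2) ^ 2 * (a ^ 2 * Real.cos θ ^ 2 + b ^ 2 * Real.sin θ ^ 2) := by
      rw [Real.tan_eq_sin_div_cos]
      have := Real.sin_sq_add_cos_sq θ
      field_simp
      rw [show Real.cos θ ^ 2 + Real.sin θ ^ 2 = 1 by linarith]
    simp only [smul_eq_mul]
    rw [e, Real.sqrt_mul (by positivity), Real.sqrt_sq (by positivity), rpow_neg_half _ (by positivity),
      abs_of_pos (by positivity)]
    field_simp
  · intro θ hθ
    have hc : Real.cos θ ≠ 0 := (Real.cos_pos_of_mem_Ioo ⟨by linarith [hθ.1], hθ.2⟩).ne'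
    exact ((Real.hasDerivAt_tan hc).const_mul b).hasDerivWithinAt
  · intro x hx y hy h
    have h' : Real.tan x = Real.tan y := by simpa [hb.ne'] using h
    exact Real.injOn_tan ⟨by linarith [hx.1], hx.2⟩ ⟨by linarith [hy.1], hy.2⟩ h'

lemma gauss_image {c : ℝ} (hc : 0 < c) :
    (fun t => (t - c / t) / 2) '' Ioi (0:ℝ) = univ := by
  ext u
  simp only [mem_image, mem_Ioi, mem_univ, iff_true]
  have h : |u| < √(u ^ 2 + c) := by
    rw [← Real.sqrt_sq_eq_abs]; exact Real.sqrt_lt_sqrt (by positivity) (by linarith)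
  have h1 : 0 < u + √(u ^ 2 + c) := by linarith [neg_abs_le u]
  refine ⟨u + √(u ^ 2 + c), h1, ?_⟩
  have h2 := Real.sq_sqrt (by positivity : 0 ≤ u ^ 2 + c)
  field_simp
  linear_combination h2

lemma eJ_gauss {a b : ℝ} (ha : 0 < a) (hb : 0 < b) :
    eJ ((a + b) / 2) (√(a * b)) = eJ a b := by
  rw [eJ_eq ha hb, eJ_eq (by positivity) (by positivity)]
  set f : ℝ → ℝ := fun u => (√((((a + b) / 2) ^ 2 + u ^ 2) * (√(a * b) ^ 2 + u ^ 2)))⁻¹ with hf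
  have h1 : ∫ u, f u = 2 * ∫ u in Ioi (0:ℝ), f u := by
    rw [← integral_comp_abs]
    simp [hf]
  have h2 : ∫ u, f u = 2 * ∫ t in Ioi (0:ℝ), (√((a ^ 2 + t ^ 2) * (b ^ 2 + t ^ 2)))⁻¹ := by
    rw [← setIntegral_univ, ← gauss_image (by positivity : 0 < a * b),
      integral_image_eq_integral_abs_deriv_smul (f' := fun t => (1 - (-(a * b) / t ^ 2)) / 2)
      measurableSet_Ioi, ← MeasureTheory.integral_const_mul]
    · refine setIntegral_congr_fun measurableSet_Ioi (fun t (ht : 0 < t) => ?_)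
      simp only [hf, smul_eq_mul]
      have e : (((a + b) / 2) ^ 2 + ((t - a * b / t) / 2) ^ 2) *
          (√(a * b) ^ 2 + ((t - a * b / t) / 2) ^ 2) =
          ((t + a * b / t) / (4 * t)) ^ 2 * ((a ^ 2 + t ^ 2) * (b ^ 2 + t ^ 2)) := by
        rw [Real.sq_sqrt (by positivity)]
        field_simp
        ring
      rw [e, Real.sqrt_mul (by positivity), Real.sqrt_sq (by positivity),
        show (1 - (-(a * b) / t ^ 2)) / 2 = (1 + a * b / t ^ 2) / 2 by ring,
        abs_of_pos (by positivity)]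
      field_simp
      ring
    · intro t (ht : 0 < t)
      have : HasDerivAt (fun t => (t - a * b / t) / 2) ((1 - (-(a * b) / t ^ 2)) / 2) t := by
        have h := (hasDerivAt_id t).sub ((hasDerivAt_inv ht.ne').const_mul (a * b))
        convert! h.div_const 2 using 1
        ring
      exact this.hasDerivWithinAt
    · intro x (hx : 0 < x) y (hy : 0 < y) h
      simp only at h
      field_simp at h
      have : (x - y) * (x * y + a * b) = 0 := by linear_combination h
      rcases mul_eq_zero.1 this with h | h
      · linarith
      · have : 0 < x * y + a * b := by positivity
        linarith
  linarith

lemma eJ_scale_bounds {a b : ℝ} (hb : 0 < b) (hab : b ≤ a) :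
    π / 2 / a ≤ eJ a b ∧ eJ a b ≤ π / 2 / b := by
  have ha : 0 < a := by linarith
  have hpi : (0:ℝ) ≤ π / 2 := by positivity
  have key : ∀ θ, b ^ 2 ≤ a ^ 2 * Real.cos θ ^ 2 + b ^ 2 * Real.sin θ ^ 2 ∧
      a ^ 2 * Real.cos θ ^ 2 + b ^ 2 * Real.sin θ ^ 2 ≤ a ^ 2 := by
    intro θ
    have h := Real.sin_sq_add_cos_sq θ
    have h2 : b ^ 2 ≤ a ^ 2 := by gcongr
    constructor
    · nlinarith [sq_nonneg (Real.cos θ)]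
    · nlinarith [sq_nonneg (Real.sin θ)]
  have hc : Continuous fun θ => (a ^ 2 * Real.cos θ ^ 2 + b ^ 2 * Real.sin θ ^ 2) ^ (-(1/2 : ℝ)) := by
    refine Continuous.rpow_const (by fun_prop) (fun θ => Or.inl ?_)
    have := (key θ).1; have : 0 < b ^ 2 := by positivity
    linarith
  have hi : ∀ c : ℝ, ∫ θ in (0:ℝ)..(π/2), c⁻¹ = π / 2 / c := by intro c; simp; ring
  constructor
  · rw [← hi, eJ]
    refine intervalIntegral.integral_mono_on hpi (by simp) (hc.intervalIntegrable _ _) (fun θ _ => ?_)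
    have h := key θ
    have h0 : 0 < b ^ 2 := by positivity
    rw [rpow_neg_half _ (by linarith)]
    refine inv_anti₀ (Real.sqrt_pos.2 (by linarith)) ?_
    rw [Real.sqrt_le_left ha.le]; exact h.2
  · rw [← hi, eJ]
    refine intervalIntegral.integral_mono_on hpi (hc.intervalIntegrable _ _) (by simp) (fun θ _ => ?_)
    have h := key θ
    have h0 : 0 < b ^ 2 := by positivity
    rw [rpow_neg_half _ (by linarith)]
    refine inv_anti₀ hb ?_
    exact Real.le_sqrt_of_sq_le h.1

lemma tB_le_tC {y : ℝ} (hy : 0 < y) : tB y < tC y := by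
  rw [tB_split hy, tC_split hy]; linarith [tA_pos (by linarith : 0 < 4 * y)]

lemma eJ_theta {y : ℝ} (hy : 0 < y) : eJ (tC y ^ 2) (tB y ^ 2) = π / 2 := by
  refine dbl_const (f := fun y => eJ (tC y ^ 2) (tB y ^ 2)) (L := π / 2) (fun z hz => ?_) ?_ hy
  · have h1 := tC_pos hz; have h2 := tB_pos hz
    have h := eJ_gauss (pow_pos h1 2) (pow_pos h2 2)
    rw [show (tC z ^ 2 + tB z ^ 2) / 2 = tC (2 * z) ^ 2 by rw [← tC_dbl hz]; ring,
      show √(tC z ^ 2 * tB z ^ 2) = tB (2 * z) ^ 2 by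
        rw [tB_dbl hz, ← mul_pow, Real.sqrt_sq (by positivity)]; ring] at h
    simpa using h
  · have l1 : Tendsto (fun y => π / 2 / tC y ^ 2) atTop (𝓝 (π / 2)) := by
      have := (tendsto_const_nhds (x := π / 2)).div (tC_tendsto.pow 2) (by norm_num)
      convert! this using 2; norm_num
    have l2 : Tendsto (fun y => π / 2 / tB y ^ 2) atTop (𝓝 (π / 2)) := by
      have := (tendsto_const_nhds (x := π / 2)).div (tB_tendsto.pow 2) (by norm_num)
      convert! this using 2; norm_num
    refine tendsto_of_tendsto_of_tendsto_of_le_of_le' l1 l2 ?_ ?_ <;>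
    · filter_upwards [eventually_gt_atTop 0] with z hz
      have := eJ_scale_bounds (a := tC z ^ 2) (b := tB z ^ 2) (pow_pos (tB_pos hz) 2)
        (by have := tB_le_tC hz; have := tB_pos hz; gcongr)
      first | exact this.1 | exact this.2

lemma ellipticK_theta {y : ℝ} (hy : 0 < y) :
    ellipticK (√(1 - (tB y ^ 2 / tC y ^ 2) ^ 2)) = π / 2 * tC y ^ 2 := by
  have hB := tB_pos hy; have hC := tC_pos hy; have hl := tB_le_tC hy
  have hk : (tB y ^ 2 / tC y ^ 2) ^ 2 ≤ 1 := by
    have : tB y ^ 2 / tC y ^ 2 ≤ 1 := by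
      rw [div_le_one (by positivity)]; gcongr
    exact pow_le_one₀ (by positivity) this
  rw [← eJ_theta hy, ellipticK, eJ, mul_comm, ← intervalIntegral.integral_const_mul]
  refine intervalIntegral.integral_congr (fun θ _ => ?_)
  have e : 1 - √(1 - (tB y ^ 2 / tC y ^ 2) ^ 2) ^ 2 * Real.sin θ ^ 2 =
      ((tC y ^ 2) ^ 2 * Real.cos θ ^ 2 + (tB y ^ 2) ^ 2 * Real.sin θ ^ 2) / (tC y ^ 2) ^ 2 := by
    rw [Real.sq_sqrt (by linarith), Real.cos_sq']
    field_simp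
    ring
  rw [e, rpow_neg_half _ (by positivity), rpow_neg_half _ (by positivity), Real.sqrt_div (by positivity),
    Real.sqrt_sq (by positivity), inv_div]
  ring


lemma ftc_Ioi {F F' : ℝ → ℝ} {L0 L : ℝ} (hd : ∀ x ∈ Ioi (0:ℝ), HasDerivAt F (F' x) x)
    (hp : ∀ x ∈ Ioi (0:ℝ), 0 ≤ F' x) (h0 : Tendsto F (𝓝[>] 0) (𝓝 L0))
    (hL : Tendsto F atTop (𝓝 L)) :
    IntegrableOn F' (Ioi 0) ∧ ∫ x in Ioi (0:ℝ), F' x = L - L0 := by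
  set g : ℝ → ℝ := Function.update F 0 L0 with hg
  have hcont : ContinuousWithinAt g (Ici 0) 0 := by
    rw [hg, continuousWithinAt_update_same]
    rwa [show Ici (0:ℝ) \ {0} = Ioi 0 by simp]
  have hd' : ∀ x ∈ Ioi (0:ℝ), HasDerivAt g (F' x) x := by
    intro x hx
    refine (hd x hx).congr_of_eventuallyEq ?_
    filter_upwards [isOpen_Ioi.mem_nhds hx] with z hz
    exact Function.update_of_ne (ne_of_gt hz) _ _
  have hL' : Tendsto g atTop (𝓝 L) := by
    refine hL.congr' ?_
    filter_upwards [eventually_gt_atTop 0] with z hz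
    exact (Function.update_of_ne (ne_of_gt hz) _ _).symm
  refine ⟨integrableOn_Ioi_deriv_of_nonneg hcont hd' hp hL', ?_⟩
  rw [integral_Ioi_of_hasDerivAt_of_nonneg hcont hd' hp hL']
  simp [hg]

lemma inv_lim {f : ℝ → ℝ} {L : ℝ} (h : Tendsto (fun u => f (1 / u)) atTop (𝓝 L)) :
    Tendsto f (𝓝[>] 0) (𝓝 L) := by
  have := h.comp tendsto_inv_nhdsGT_zero
  refine this.congr fun x => ?_
  simp

noncomputable def kf (y : ℝ) : ℝ := tB y ^ 2 / tC y ^ 2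

lemma kf_deriv {y : ℝ} (hy : 0 < y) :
    HasDerivAt kf (π / 2 * tA y ^ 4 * tB y ^ 2 / tC y ^ 2) y := by
  have pB := tB_pos hy; have pC := tC_pos hy
  have h := ((hB hy).pow 2).div ((hC hy).pow 2) (pow_pos pC 2).ne'
  convert! h using 1
  have e := be_sub_ga hy
  rw [B1_eq hy, C1_eq hy]
  simp only [Pi.pow_apply]
  field_simp
  push_cast
  linear_combination (-4 * tB y * tC y) * e

lemma kf_pos {y : ℝ} (hy : 0 < y) : 0 < kf y := by
  have pB := tB_pos hy; have pC := tC_pos hy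
  unfold kf; positivity
lemma kf_lt {y : ℝ} (hy : 0 < y) : kf y < 1 := by
  have pB := tB_pos hy; have pC := tC_pos hy; have := tB_le_tC hy
  unfold kf; rw [div_lt_one (by positivity)]; gcongr

lemma kf_mono : StrictMonoOn kf (Ioi 0) := by
  refine strictMonoOn_of_deriv_pos (convex_Ioi 0)
    (fun x hx => (kf_deriv hx).continuousAt.continuousWithinAt) (fun x hx => ?_)
  rw [interior_Ioi] at hx
  rw [(kf_deriv hx).deriv]
  have pA := tA_pos hx; have pB := tB_pos hx; have pC := tC_pos hx
  positivity

lemma kf_tendsto : Tendsto kf atTop (𝓝 1) := by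
  have := (tB_tendsto.pow 2).div (tC_tendsto.pow 2) (by norm_num)
  convert! this using 2; norm_num
lemma kf_tendsto0 : Tendsto kf (𝓝[>] 0) (𝓝 0) := by
  refine inv_lim ?_
  have := (dec_A.tendsto.pow 2).div (tC_tendsto.pow 2) (by norm_num)
  rw [show (0:ℝ) ^ 2 / 1 ^ 2 = 0 by norm_num] at this
  refine this.congr' ?_
  filter_upwards [eventually_gt_atTop 0] with u hu
  rw [kf, tB_inv hu, tC_inv hu, mul_pow, mul_pow]
  have := tC_pos hu
  have := Real.sqrt_pos.2 hu
  simp only [Pi.div_apply, Pi.pow_apply]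
  field_simp

lemma kf_image : kf '' Ioi 0 = Ioo 0 1 := by
  apply subset_antisymm
  · rintro _ ⟨y, hy, rfl⟩; exact ⟨kf_pos hy, kf_lt hy⟩
  · rintro k ⟨h0, h1⟩
    obtain ⟨y1, hy1, hk1⟩ : ∃ y, 0 < y ∧ k < kf y :=
      ((eventually_gt_atTop 0).and (kf_tendsto.eventually (lt_mem_nhds h1))).exists
    obtain ⟨y2, hk2, hy2⟩ : ∃ y, kf y < k ∧ 0 < y :=
      ((kf_tendsto0.eventually (gt_mem_nhds h0)).and self_mem_nhdsWithin).exists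
    have := isPreconnected_Ioi.intermediate_value (show y2 ∈ Ioi 0 from hy2)
      (show y1 ∈ Ioi 0 from hy1) (f := kf)
      (fun x hx => (kf_deriv hx).continuousAt.continuousWithinAt)
    exact this ⟨hk2.le, hk1.le⟩

lemma main_cov :
    (∫ k in (0:ℝ)..1, (ellipticK (Real.sqrt (1 - k ^ 2))) ^ 3 /
        (Real.sqrt k * (1 - k ^ 2) ^ ((3:ℝ)/4))) =
      (π / 2) ^ 4 * ∫ y in Ioi (0:ℝ), tA y * tB y * tC y ^ 8 := by
  rw [intervalIntegral.integral_of_le zero_le_one, integral_Ioc_eq_integral_Ioo, ← kf_image,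
    integral_image_eq_integral_abs_deriv_smul
      (f' := fun y => π / 2 * tA y ^ 4 * tB y ^ 2 / tC y ^ 2) measurableSet_Ioi
      (fun y hy => (kf_deriv hy).hasDerivWithinAt) kf_mono.injOn,
    ← MeasureTheory.integral_const_mul]
  refine setIntegral_congr_fun measurableSet_Ioi (fun y (hy : 0 < y) => ?_)
  have pA := tA_pos hy; have pB := tB_pos hy; have pC := tC_pos hy
  have e1 : ellipticK (√(1 - kf y ^ 2)) = π / 2 * tC y ^ 2 := ellipticK_theta hy
  have e2 : √(kf y) = tB y / tC y := by
    rw [kf, ← div_pow, Real.sqrt_sq (by positivity)]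
  have e3 : 1 - kf y ^ 2 = (tA y / tC y) ^ (4 : ℝ) := by
    have := jacobi_quartic hy
    rw [show (4:ℝ) = ((4:ℕ):ℝ) by norm_num, Real.rpow_natCast, kf]
    field_simp
    linear_combination -this
  have e4 : (1 - kf y ^ 2) ^ ((3:ℝ)/4) = (tA y / tC y) ^ 3 := by
    rw [e3, ← Real.rpow_mul (by positivity), show (4:ℝ) * (3 / 4) = ((3:ℕ):ℝ) by norm_num,
      Real.rpow_natCast]
  simp only [smul_eq_mul]
  rw [e1, e2, e4, abs_of_pos (by positivity)]
  field_simp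

noncomputable def tG (y : ℝ) : ℝ := tA y * tB1 y - 7 * (tA1 y * tB y)

lemma tG_deriv {y : ℝ} (hy : 0 < y) : HasDerivAt tG
    (π ^ 2 / 16 * (tA y * tB y * tC y ^ 8) - 8 * (tA2 y * tB y)) y := by
  have h := ((hA hy).mul (hB1 hy)).sub (((hA1 hy).mul (hB hy)).const_mul 7)
  convert! h using 1
  have := rankin_cohen hy
  linear_combination -this

lemma tG_top : Tendsto tG atTop (𝓝 0) := by
  have h1 := (dec_A.mul_tendsto dec_B1.tendsto).add
    ((dec_A1.mul_tendsto tB_tendsto).const_mul (-7))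
  refine h1.tendsto.congr fun y => ?_
  rw [tG]; ring

lemma inv_deriv_aux {f g : ℝ → ℝ} {f' g' u : ℝ} (hu : 0 < u) (hf : HasDerivAt f f' (1 / u))
    (hg : HasDerivAt g g' u) (h : ∀ z, 0 < z → f (1 / z) = √z * g z) :
    f' = - u ^ 2 * (1 / (2 * √u) * g u + √u * g') := by
  have h1 : HasDerivAt (fun z => f (1 / z)) (f' * (-(u ^ 2)⁻¹)) u := by
    have h2 : HasDerivAt (fun z : ℝ => 1 / z) (-(u ^ 2)⁻¹) u := by
      simpa using hasDerivAt_inv hu.ne'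
    exact hf.comp u h2
  have h2 := (Real.hasDerivAt_sqrt hu.ne').mul hg
  have := deriv_match hu h1 h2 h
  have e : f' = - u ^ 2 * (f' * (-(u ^ 2)⁻¹)) := by field_simp
  rw [e, this]

lemma tG_zero : Tendsto tG (𝓝[>] 0) (𝓝 0) := by
  refine inv_lim ?_
  have h1 := (((dec_A.mul_tendsto tB_tendsto).pow_mul 2).const_mul 3).add
    ((((dec_A1.mul_tendsto tB_tendsto).pow_mul 3).const_mul (-1)).add
     (((dec_A.mul_tendsto dec_B1.tendsto).pow_mul 3).const_mul 7))
  refine h1.tendsto.congr' ?_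
  filter_upwards [eventually_gt_atTop 0] with u hu
  have hi : 0 < 1 / u := by positivity
  rw [tG, inv_deriv_aux hu (hA hi) (hB hu) (fun z hz => tA_inv hz),
    inv_deriv_aux hu (hB hi) (hA hu) (fun z hz => tB_inv hz), tA_inv hu, tB_inv hu]
  have hs := Real.sqrt_pos.2 hu
  have hq := Real.sq_sqrt hu.le
  generalize √u = s at *
  subst hq
  field_simp
  ring

lemma int_ABC8 (hi : IntegrableOn (fun y => tA2 y * tB y) (Ioi 0)) :
    ∫ y in Ioi (0:ℝ), tA y * tB y * tC y ^ 8 =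
      128 / π ^ 2 * ∫ y in Ioi (0:ℝ), tA2 y * tB y := by
  have hcont : ContinuousOn (fun y => tA2 y * tB y) (Ioi 0) := by
    intro y hy
    have h2 : HasDerivAt tA2 (-π * (-π * (-π * tht 3 (1/2) y))) y :=
      ((tht_hasDerivAt 2 _ hy).const_mul _).const_mul _
    exact (h2.continuousAt.mul (hB hy).continuousAt).continuousWithinAt
  have h := ftc_Ioi (F := fun y => tG y + 8 * ∫ x in (0:ℝ)..y, tA2 x * tB x)
    (F' := fun y => π ^ 2 / 16 * (tA y * tB y * tC y ^ 8)) (L0 := 0)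
    (L := 0 + 8 * ∫ y in Ioi (0:ℝ), tA2 y * tB y) ?_ ?_ ?_ ?_
  · have h2 := h.2
    rw [MeasureTheory.integral_const_mul] at h2
    have : 0 < π := Real.pi_pos
    field_simp
    field_simp at h2
    linarith
  · intro y (hy : 0 < y)
    have hd : HasDerivAt (fun y => ∫ x in (0:ℝ)..y, tA2 x * tB x) (tA2 y * tB y) y := by
      refine intervalIntegral.integral_hasDerivAt_right ?_ ?_ ?_
      · rw [intervalIntegrable_iff_integrableOn_Ioc_of_le hy.le]
        exact hi.mono_set Ioc_subset_Ioi_self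
      · exact hcont.stronglyMeasurableAtFilter isOpen_Ioi y hy
      · exact hcont.continuousAt (isOpen_Ioi.mem_nhds hy)
    convert! (tG_deriv hy).add (hd.const_mul 8) using 1
    ring
  · intro y (hy : 0 < y)
    have pA := tA_pos hy; have pB := tB_pos hy; have pC := tC_pos hy
    positivity
  · have hc : Tendsto (fun y => ∫ x in (0:ℝ)..y, tA2 x * tB x) (𝓝[>] 0) (𝓝 0) := by
      have h1 : IntegrableOn (fun y => tA2 y * tB y) (uIcc 0 1) := by
        rw [uIcc_of_le zero_le_one, integrableOn_Icc_iff_integrableOn_Ioc]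
        exact hi.mono_set Ioc_subset_Ioi_self
      have h2 := intervalIntegral.continuousOn_primitive_interval h1
      have h3 := h2 0 (by simp)
      rw [uIcc_of_le zero_le_one] at h3
      unfold ContinuousWithinAt at h3
      simp only [intervalIntegral.integral_same] at h3
      refine h3.mono_left ?_
      rw [← nhdsWithin_Ioc_eq_nhdsGT zero_lt_one]
      exact nhdsWithin_mono _ Ioc_subset_Icc_self
    simpa using tG_zero.add (hc.const_mul 8)
  · exact tG_top.add ((intervalIntegral_tendsto_integral_Ioi 0 hi tendsto_id).const_mul 8)


noncomputable def Phi (x : ℝ) : ℝ := ∫ t in (0:ℝ)..x, Real.exp (-π * t ^ 2)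

lemma Phi_deriv (x : ℝ) : HasDerivAt Phi (Real.exp (-π * x ^ 2)) x := by
  have hc : Continuous fun t : ℝ => Real.exp (-π * t ^ 2) := by fun_prop
  exact intervalIntegral.integral_hasDerivAt_right (hc.intervalIntegrable _ _)
    (hc.stronglyMeasurableAtFilter _ _) hc.continuousAt

lemma Phi_top : Tendsto Phi atTop (𝓝 (1 / 2)) := by
  have hi : IntegrableOn (fun t : ℝ => Real.exp (-π * t ^ 2)) (Ioi 0) :=
    (integrable_exp_neg_mul_sq Real.pi_pos).integrableOn
  have := intervalIntegral_tendsto_integral_Ioi 0 hi tendsto_id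
  rw [integral_gaussian_Ioi, div_self Real.pi_ne_zero, Real.sqrt_one] at this
  exact this

lemma Phi_neg (x : ℝ) : Phi (-x) = - Phi x := by
  unfold Phi
  have := intervalIntegral.integral_comp_neg (a := 0) (b := x) (fun t : ℝ => Real.exp (-π * t ^ 2))
  simp only [neg_sq, neg_zero] at this
  rw [this, intervalIntegral.integral_symm]

lemma Phi_bot : Tendsto Phi atBot (𝓝 (-(1 / 2))) := by
  have := (Phi_top.comp tendsto_neg_atBot_atTop).neg
  refine this.congr fun x => ?_
  simp [Phi_neg]

lemma kernel_int {r s : ℝ} (hr : 0 < r) (hs : 0 < s) :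
    IntegrableOn (fun y => r / √y * Real.exp (-π * r ^ 2 * y - π * s ^ 2 * (1 / y))) (Ioi 0) ∧
    ∫ y in Ioi (0:ℝ), r / √y * Real.exp (-π * r ^ 2 * y - π * s ^ 2 * (1 / y)) =
      Real.exp (-2 * π * r * s) := by
  have hsq0 : Tendsto (fun y : ℝ => √y) (𝓝[>] 0) (𝓝[>] 0) := by
    refine tendsto_nhdsWithin_iff.2 ⟨?_, ?_⟩
    · have := (Real.continuous_sqrt.tendsto 0).mono_left (nhdsWithin_le_nhds (s := Ioi 0))
      simpa using this
    · filter_upwards [self_mem_nhdsWithin] with y hy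
      exact Real.sqrt_pos.2 hy
  have hinv0 : Tendsto (fun y : ℝ => s / √y) (𝓝[>] 0) atTop := by
    simpa [div_eq_mul_inv] using (tendsto_inv_nhdsGT_zero.comp hsq0).const_mul_atTop hs
  have hinvT : Tendsto (fun y : ℝ => s / √y) atTop (𝓝 0) :=
    tendsto_const_nhds.div_atTop Real.tendsto_sqrt_atTop
  have hT : Tendsto (fun y : ℝ => r * √y) atTop atTop :=
    Real.tendsto_sqrt_atTop.const_mul_atTop hr
  have h0 : Tendsto (fun y : ℝ => r * √y) (𝓝[>] 0) (𝓝 0) := by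
    simpa using (hsq0.mono_right nhdsWithin_le_nhds).const_mul r
  have := ftc_Ioi
    (F := fun y => Real.exp (-2 * π * r * s) * Phi (r * √y - s / √y) +
      Real.exp (2 * π * r * s) * Phi (r * √y + s / √y))
    (F' := fun y => r / √y * Real.exp (-π * r ^ 2 * y - π * s ^ 2 * (1 / y)))
    (L0 := Real.exp (-2 * π * r * s) * (-(1 / 2)) + Real.exp (2 * π * r * s) * (1 / 2))
    (L := Real.exp (-2 * π * r * s) * (1 / 2) + Real.exp (2 * π * r * s) * (1 / 2)) ?_ ?_ ?_ ?_
  · refine ⟨this.1, this.2.trans (by ring)⟩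
  · intro y (hy : 0 < y)
    have hp := Real.sqrt_pos.2 hy
    have hq := Real.sq_sqrt hy.le
    have d1 := (Real.hasDerivAt_sqrt hy.ne').const_mul r
    have d2 : HasDerivAt (fun y => s / √y) (s * (-(1 / (2 * √y)) / √y ^ 2)) y := by
      have := ((Real.hasDerivAt_sqrt hy.ne').inv hp.ne').const_mul s
      simpa [div_eq_mul_inv] using! this
    have d3 := ((Phi_deriv _).comp y (d1.sub d2)).const_mul (Real.exp (-2 * π * r * s))
    have d4 := ((Phi_deriv _).comp y (d1.add d2)).const_mul (Real.exp (2 * π * r * s))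
    have d5 := d3.add d4
    convert! d5 using 1
    have e1 : Real.exp (-2 * π * r * s) * Real.exp (-π * (r * √y - s / √y) ^ 2) =
        Real.exp (-π * r ^ 2 * y - π * s ^ 2 * (1 / y)) := by
      rw [← Real.exp_add]; congr 1; rw [← hq]
      simp only [Real.sqrt_sq hp.le]
      field_simp; ring
    have e2 : Real.exp (2 * π * r * s) * Real.exp (-π * (r * √y + s / √y) ^ 2) =
        Real.exp (-π * r ^ 2 * y - π * s ^ 2 * (1 / y)) := by
      rw [← Real.exp_add]; congr 1; rw [← hq]
      simp only [Real.sqrt_sq hp.le]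
      field_simp; ring
    simp only [Pi.add_apply, Pi.sub_apply, ← mul_assoc] at *
    rw [e1, e2]
    ring
  · intro y _
    positivity
  · have l1 : Tendsto (fun y => r * √y - s / √y) (𝓝[>] 0) atBot := by
      simpa [sub_eq_add_neg] using h0.add_atBot (tendsto_neg_atTop_atBot.comp hinv0)
    have l2 : Tendsto (fun y => r * √y + s / √y) (𝓝[>] 0) atTop := h0.add_atTop hinv0
    exact ((Phi_bot.comp l1).const_mul _).add ((Phi_top.comp l2).const_mul _)
  · have l1 : Tendsto (fun y => r * √y - s / √y) atTop atTop := by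
      simpa [sub_eq_add_neg] using hT.atTop_add hinvT.neg
    have l2 : Tendsto (fun y => r * √y + s / √y) atTop atTop := hT.atTop_add hinvT
    exact ((Phi_top.comp l1).const_mul _).add ((Phi_top.comp l2).const_mul _)

lemma tht_half_nat (j : ℕ) {y : ℝ} (hy : 0 < y) :
    HasSum (fun n : ℕ => 2 * (((n : ℝ) + 1 / 2) ^ (2 * j) * Real.exp (-π * ((n : ℝ) + 1 / 2) ^ 2 * y)))
    (tht j (1 / 2) y) := by
  have h := (tht_summable j (1 / 2) hy).hasSum.nat_add_neg_add_one
  convert! h using 1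
  funext n
  push_cast
  rw [show (-((n:ℝ) + 1) + 1 / 2) = -((n:ℝ) + 1 / 2) by ring, neg_sq, pow_mul, pow_mul, neg_sq]
  ring

noncomputable def Fk (p : ℕ × ℕ) (y : ℝ) : ℝ :=
  ((p.1 : ℝ) + 1 / 2) ^ 3 * (((p.1 : ℝ) + 1 / 2) / √y *
    Real.exp (-π * ((p.1 : ℝ) + 1 / 2) ^ 2 * y - π * ((p.2 : ℝ) + 1 / 2) ^ 2 * (1 / y)))

lemma Fk_tsum {y : ℝ} (hy : 0 < y) : tA2 y * tB y = 4 * π ^ 2 * ∑' p, Fk p y := by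
  have h1 := tht_half_nat 2 hy
  have h2 := tht_half_nat 0 (by positivity : 0 < 1 / y)
  have hs := h1.summable.mul_of_nonneg h2.summable (fun n => by positivity) (fun n => by positivity)
  have h3 := h1.mul h2 hs
  have e : (fun p : ℕ × ℕ => 2 * (((p.1 : ℝ) + 1 / 2) ^ (2 * 2) *
      Real.exp (-π * ((p.1 : ℝ) + 1 / 2) ^ 2 * y)) * (2 * (((p.2 : ℝ) + 1 / 2) ^ (2 * 0) *
      Real.exp (-π * ((p.2 : ℝ) + 1 / 2) ^ 2 * (1 / y))))) = fun p => 4 * √y * Fk p y := by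
    funext p
    have := Real.sqrt_pos.2 hy
    rw [Fk, sub_eq_add_neg, Real.exp_add, neg_mul_comm, ← neg_mul_eq_neg_mul, neg_mul_eq_neg_mul π]
    field_simp
    ring_nf
  have h4 := h3.tsum_eq
  rw [e, tsum_mul_left] at h4
  have hp := Real.sqrt_pos.2 hy
  rw [tB_eq hy, tA2, tA]
  field_simp
  linear_combination -h4

noncomputable def Sk (p : ℕ × ℕ) : ℝ :=
  ((p.1 : ℝ) + 1 / 2) ^ 3 * Real.exp (-2 * π * ((p.1 : ℝ) + 1 / 2) * ((p.2 : ℝ) + 1 / 2))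

lemma Fk_int (p : ℕ × ℕ) : IntegrableOn (Fk p) (Ioi 0) ∧ ∫ y in Ioi (0:ℝ), Fk p y = Sk p := by
  have h := kernel_int (r := (p.1 : ℝ) + 1 / 2) (s := (p.2 : ℝ) + 1 / 2) (by positivity) (by positivity)
  refine ⟨h.1.const_mul _, ?_⟩
  simp only [Fk, Sk]
  rw [MeasureTheory.integral_const_mul, h.2]

lemma Sk_summable : Summable Sk := by
  have h1 := tht_half_nat 2 (y := 1 / 2) (by norm_num)
  have g1 : Summable (fun n : ℕ => ((n : ℝ) + 1 / 2) ^ 3 * Real.exp (-π * ((n : ℝ) + 1 / 2))) := by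
    have := (Real.summable_pow_mul_exp_neg_nat_mul 3 Real.pi_pos)
    have h2 := (summable_nat_add_iff 1).2 this
    refine Summable.of_nonneg_of_le (fun n => by positivity) (fun n => ?_)
      (h2.mul_left (Real.exp (π / 2)))
    push_cast
    rw [mul_left_comm, ← Real.exp_add]
    have : (n : ℝ) + 1 / 2 ≤ n + 1 := by linarith
    gcongr
    nlinarith [Real.pi_pos]
  have g2 : Summable (fun n : ℕ => Real.exp (-π * ((n : ℝ) + 1 / 2))) := by
    have := (Real.summable_pow_mul_exp_neg_nat_mul 0 Real.pi_pos)
    simp only [pow_zero, one_mul] at this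
    refine Summable.of_nonneg_of_le (fun n => by positivity) (fun n => ?_) this
    refine Real.exp_le_exp.2 ?_
    nlinarith [Real.pi_pos]
  have hs := g1.mul_of_nonneg g2 (fun n => by positivity) (fun n => by positivity)
  refine Summable.of_nonneg_of_le (fun p => by unfold Sk; positivity) (fun p => ?_)
    (hs.mul_left (Real.exp (π / 2)))
  unfold Sk
  rw [mul_left_comm, ← Real.exp_add, mul_assoc (_ ^ 3), ← Real.exp_add]
  gcongr
  have a1 : (0:ℝ) ≤ p.1 := by positivity
  have a2 : (0:ℝ) ≤ p.2 := by positivity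
  have := mul_nonneg a1 a2
  nlinarith [Real.pi_pos, mul_nonneg Real.pi_pos.le this]

lemma int_A2B : IntegrableOn (fun y => tA2 y * tB y) (Ioi 0) ∧
    ∫ y in Ioi (0:ℝ), tA2 y * tB y = 4 * π ^ 2 * ∑' p, Sk p := by
  have hnn : ∀ p, ∫ y in Ioi (0:ℝ), ‖Fk p y‖ = Sk p := by
    intro p
    rw [← (Fk_int p).2]
    refine setIntegral_congr_fun measurableSet_Ioi (fun y _ => ?_)
    rw [Real.norm_of_nonneg]
    unfold Fk; positivity
  have h := hasSum_integral_of_summable_integral_norm (F := Fk) (μ := volume.restrict (Ioi 0))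
    (fun p => (Fk_int p).1) (by simp only [hnn]; exact Sk_summable)
  simp only [fun p => (Fk_int p).2] at h
  have e : ∫ y in Ioi (0:ℝ), tA2 y * tB y = 4 * π ^ 2 * ∑' p, Sk p := by
    rw [h.tsum_eq, ← MeasureTheory.integral_const_mul]
    exact setIntegral_congr_fun measurableSet_Ioi (fun y hy => Fk_tsum hy)
  refine ⟨?_, e⟩
  by_contra hc
  have h0 := MeasureTheory.integral_undef hc
  rw [e] at h0
  have : 0 < ∑' p, Sk p := Sk_summable.tsum_pos (fun p => by unfold Sk; positivity) (0, 0)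
    (by unfold Sk; positivity)
  have := Real.pi_pos
  have : 0 < 4 * π ^ 2 * ∑' p, Sk p := by positivity
  linarith

lemma main_S :
    (∫ k in (0:ℝ)..1, (ellipticK (Real.sqrt (1 - k ^ 2))) ^ 3 /
        (Real.sqrt k * (1 - k ^ 2) ^ ((3:ℝ)/4))) = 32 * π ^ 4 * ∑' p, Sk p := by
  rw [main_cov, int_ABC8 int_A2B.1, int_A2B.2]
  field_simp
  ring


section modular
open UpperHalfPlane hiding I
open scoped MatrixGroups ModularForm Manifold

noncomputable def oTh (τ : ℂ) : ℂ := ∑' n : ℤ, cexp (π * I * (2 * (n : ℂ) + 1) ^ 2 * τ)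

lemma jT_sum {τ : ℂ} (hτ : 0 < τ.im) : Summable fun n : ℤ => cexp (π * I * (n : ℂ) ^ 2 * τ) := by
  have := (hasSum_jacobiTheta₂_term 0 hτ).summable
  simpa [jacobiTheta₂_term] using this

lemma tsum_int_even_oddC {f : ℤ → ℂ} (hf : Summable f) :
    ∑' n, f n = ∑' n : ℤ, f (2 * n) + ∑' n : ℤ, f (2 * n + 1) := by
  have hi : Function.Injective (fun n : ℤ => 2 * n) := fun a b h => by simpa using h
  have hk : Function.Injective (fun n : ℤ => 2 * n + 1) := fun a b h => by simpa using h
  have h1 := (hi.hasSum_range_iff (f := f)).2 ((hf.comp_injective hi).hasSum)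
  have h2 := (hk.hasSum_range_iff (f := f)).2 ((hf.comp_injective hk).hasSum)
  refine (h1.add_isCompl ?_ h2).tsum_eq
  rw [isCompl_iff, Set.disjoint_iff, codisjoint_iff]
  constructor
  · rintro p ⟨⟨a, rfl⟩, ⟨c, h⟩⟩
    simp only at h
    omega
  · refine eq_univ_of_forall fun m => ?_
    rcases Int.even_or_odd' m with ⟨l, hl | hl⟩
    · left; exact ⟨l, hl.symm⟩
    · right; exact ⟨l, hl.symm⟩

lemma jT_split {τ : ℂ} (hτ : 0 < τ.im) : jacobiTheta τ = jacobiTheta (4 * τ) + oTh τ := by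
  simp only [jacobiTheta, oTh]
  rw [tsum_int_even_oddC (jT_sum hτ)]
  congr 1
  · refine tsum_congr fun n => ?_
    congr 1; push_cast; ring
  · refine tsum_congr fun n => ?_
    congr 1; push_cast; ring

lemma oTh_quarter (τ : ℂ) : oTh (τ + 1 / 4) = cexp (π * I / 4) * oTh τ := by
  unfold oTh
  rw [← tsum_mul_left]
  refine tsum_congr fun n => ?_
  rw [← Complex.exp_add]
  obtain ⟨k, hk⟩ : ∃ k : ℤ, n * (n + 1) = 2 * k := (Int.even_mul_succ_self n).two_dvd
  rw [Complex.exp_eq_exp_iff_exists_int]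
  refine ⟨k, ?_⟩
  have : (n : ℂ) * (n + 1) = 2 * k := by exact_mod_cast hk
  linear_combination (π * I) * this

lemma oTh_one (τ : ℂ) : oTh (τ + 1) = - oTh τ := by
  have e : τ + 1 = τ + 1 / 4 + 1 / 4 + 1 / 4 + 1 / 4 := by ring
  rw [e]
  simp only [oTh_quarter]
  simp only [← mul_assoc, ← Complex.exp_add]
  rw [show (π * I / 4 + (π * I / 4 + (π * I / 4 + π * I / 4)) : ℂ) = π * I by ring, Complex.exp_pi_mul_I]
  ring

lemma oTh_8 (τ : ℂ) : oTh (τ + 1 / 4) ^ 8 = oTh τ ^ 8 := by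
  rw [oTh_quarter, mul_pow, ← Complex.exp_nat_mul]
  rw [show ((8:ℕ) : ℂ) * (π * I / 4) = 2 * π * I by push_cast; ring, Complex.exp_two_pi_mul_I, one_mul]

lemma jT_four (τ : ℂ) : jacobiTheta (τ + 4) = jacobiTheta τ := by
  rw [show τ + 4 = 2 + (2 + τ) by ring, jacobiTheta_two_add, jacobiTheta_two_add]

noncomputable def cB (τ : ℂ) : ℂ := 2 * jacobiTheta (4 * τ) - jacobiTheta τ
noncomputable def cA (τ : ℂ) : ℂ := jacobiTheta (τ / 4) - jacobiTheta τ
noncomputable def cF (τ : ℂ) : ℂ := cA τ ^ 8 + cB τ ^ 8 + jacobiTheta τ ^ 8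

lemma jT_one {τ : ℂ} (hτ : 0 < τ.im) : jacobiTheta (τ + 1) = cB τ := by
  rw [jT_split (by simpa using hτ), oTh_one, cB, mul_add, mul_one, jT_four, jT_split hτ]
  ring
lemma cB_one {τ : ℂ} (hτ : 0 < τ.im) : cB (τ + 1) = jacobiTheta τ := by
  rw [cB, jT_one hτ, mul_add, mul_one, jT_four, cB]; ring
lemma cA_eq {τ : ℂ} (hτ : 0 < τ.im) : cA τ = oTh (τ / 4) := by
  rw [cA, jT_split (by simp [hτ] : 0 < (τ / 4).im), show 4 * (τ / 4) = τ by ring]; ring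

lemma cF_T {τ : ℂ} (hτ : 0 < τ.im) : cF (τ + 1) = cF τ := by
  rw [cF, jT_one hτ, cB_one hτ, cA_eq (by simpa using hτ), add_div, oTh_8, ← cA_eq hτ, cF]; ring

lemma jT_S {τ : ℂ} (hτ : 0 < τ.im) :
    jacobiTheta (-1 / τ) = (-I * τ) ^ (1 / 2 : ℂ) * jacobiTheta τ := by
  have := jacobiTheta_S_smul ⟨τ, hτ⟩
  rw [UpperHalfPlane.modular_S_smul] at this
  simpa [neg_div] using! this

lemma half_scale {r : ℝ} (hr : 0 < r) {z : ℂ} (hz : z ≠ 0) :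
    ((r ^ 2 : ℝ) * z : ℂ) ^ (1 / 2 : ℂ) = r * z ^ (1 / 2 : ℂ) := by
  have h1 : ((r ^ 2 : ℝ) * z : ℂ) ≠ 0 := mul_ne_zero (by exact_mod_cast (pow_pos hr 2).ne') hz
  rw [Complex.cpow_def_of_ne_zero h1, Complex.cpow_def_of_ne_zero hz,
    Complex.log_ofReal_mul (pow_pos hr 2) hz, add_mul, Complex.exp_add, Real.log_pow]
  congr 1
  push_cast
  rw [show (2 * (Real.log r : ℂ) * (1 / 2)) = (Real.log r : ℂ) by ring, ← Complex.ofReal_exp,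
    Real.exp_log hr]

lemma cF_S {τ : ℂ} (hτ : 0 < τ.im) : cF (-1 / τ) = τ ^ 4 * cF τ := by
  have h0 : τ ≠ 0 := by rintro rfl; simp at hτ
  have hz : -I * τ ≠ 0 := by simp [h0]
  have e1 : jacobiTheta (4 * (-1 / τ)) = 1 / 2 * (-I * τ) ^ (1 / 2 : ℂ) * jacobiTheta (τ / 4) := by
    have := jT_S (τ := τ / 4) (by simp [hτ])
    rw [show -I * (τ / 4) = (((1 / 2 : ℝ) ^ 2 : ℝ) : ℂ) * (-I * τ) by push_cast; ring,
      half_scale (by norm_num) hz] at this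
    rw [show 4 * (-1 / τ) = -1 / (τ / 4) by field_simp, this]; push_cast; ring
  have e2 : jacobiTheta ((-1 / τ) / 4) = 2 * (-I * τ) ^ (1 / 2 : ℂ) * jacobiTheta (4 * τ) := by
    have := jT_S (τ := 4 * τ) (by simp [hτ])
    rw [show -I * (4 * τ) = (((2 : ℝ) ^ 2 : ℝ) : ℂ) * (-I * τ) by push_cast; ring,
      half_scale (by norm_num) hz] at this
    rw [show (-1 / τ) / 4 = -1 / (4 * τ) by field_simp, this]; push_cast; ring
  have e3 : ((-I * τ) ^ (1 / 2 : ℂ)) ^ 8 = τ ^ 4 := by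
    rw [← Complex.cpow_nat_mul, show ((8:ℕ):ℂ) * (1 / 2) = ((4:ℕ):ℂ) by norm_num,
      Complex.cpow_natCast, mul_pow, neg_pow, Complex.I_pow_four]
    ring
  rw [← e3, cF, cA, cB, cF, cA, cB, e1, e2, jT_S hτ]
  ring

lemma jT_bdd {τ : ℂ} (hτ : 1 ≤ τ.im) : ‖jacobiTheta τ‖ ≤ 2 / (1 - rexp (-π)) + 1 := by
  have h := norm_jacobiTheta_sub_one_le (by linarith : 0 < τ.im)
  have h1 : rexp (-π * τ.im) ≤ rexp (-π) := by
    apply Real.exp_le_exp.2; nlinarith [Real.pi_pos]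
  have h2 : rexp (-π) < 1 := by rw [Real.exp_lt_one_iff]; linarith [Real.pi_pos]
  have h3 : 2 / (1 - rexp (-π * τ.im)) * rexp (-π * τ.im) ≤ 2 / (1 - rexp (-π)) * 1 := by
    gcongr <;> linarith
  have h4 := norm_sub_norm_le (jacobiTheta τ) 1
  rw [norm_one] at h4
  linarith

lemma cF_slash_S : (fun z : ℍ => cF z) ∣[(4:ℤ)] ModularGroup.S = fun z : ℍ => cF z := by
  ext z
  rw [ModularForm.SL_slash_apply, UpperHalfPlane.modular_S_smul, ModularGroup.denom_S]
  have h := cF_S z.2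
  have h0 : (z:ℂ) ≠ 0 := z.ne_zero
  have h1 : cF (-(z:ℂ))⁻¹ = (z:ℂ) ^ 4 * cF z := by
    rw [show (-(z:ℂ))⁻¹ = -1 / z by rw [inv_neg]; ring]
    exact h
  show cF (-(z:ℂ))⁻¹ * (z:ℂ) ^ (-4 : ℤ) = cF z
  rw [h1, zpow_neg]
  field_simp

lemma cF_slash_T : (fun z : ℍ => cF z) ∣[(4:ℤ)] ModularGroup.T = fun z : ℍ => cF z := by
  ext z
  have hd : denom ModularGroup.T z = 1 := by
    rw [ModularGroup.denom_apply]; simp [ModularGroup.T]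
  rw [ModularForm.SL_slash_apply, hd, modular_T_smul]
  have h := cF_T z.2
  simp [add_comm (1:ℂ)]
  exact h

noncomputable def mF : ModularForm 𝒮ℒ 4 where
  toFun := fun z => cF z
  slash_action_eq' A hA := by
    obtain ⟨A, rfl⟩ := hA
    exact SlashInvariantForm.slash_action_generators_SL2Z cF_slash_S cF_slash_T A
  holo' := by
    rw [UpperHalfPlane.mdifferentiable_iff]
    have hd : ∀ z : ℂ, 0 < z.im → DifferentiableAt ℂ cF z := by
      intro z hz
      have d1 := differentiableAt_jacobiTheta hz
      have d2 : DifferentiableAt ℂ (fun z => jacobiTheta (4 * z)) z :=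
        DifferentiableAt.comp (g := jacobiTheta) (f := fun z => 4 * z) z
          (differentiableAt_jacobiTheta (by simp [hz] : 0 < (4 * z).im)) (by fun_prop)
      have d3 : DifferentiableAt ℂ (fun z => jacobiTheta (z / 4)) z :=
        DifferentiableAt.comp (g := jacobiTheta) (f := fun z => z / 4) z
          (differentiableAt_jacobiTheta (by simp [hz] : 0 < (z / 4).im)) (by fun_prop)
      exact (((d3.sub d1).pow 8).add (((d2.const_mul 2).sub d1).pow 8)).add (d1.pow 8)
    refine .congr (fun z hz => (hd z hz).differentiableWithinAt) fun z hz => ?_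
    simp [ofComplex_apply_of_im_pos hz]
  bdd_at_cusps' hc := by
    rw [Subgroup.IsArithmetic.isCusp_iff_isCusp_SL2Z] at hc
    rw [OnePoint.isBoundedAt_iff_forall_SL2Z hc]
    intro γ _
    rw [SlashInvariantForm.slash_action_generators_SL2Z cF_slash_S cF_slash_T]
    rw [UpperHalfPlane.isBoundedAtImInfty_iff]
    set M := 2 / (1 - rexp (-π)) + 1
    refine ⟨(M + M) ^ 8 + (2 * M + M) ^ 8 + M ^ 8, 4, fun z hz => ?_⟩
    have hz' : 4 ≤ (z:ℂ).im := hz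
    have b1 := jT_bdd (τ := z) (by linarith)
    have b2 := jT_bdd (τ := 4 * z) (by simp; linarith)
    have b3 := jT_bdd (τ := z / 4) (by simp; linarith)
    have c1 : ‖cA z‖ ≤ M + M := (norm_sub_le _ _).trans (by gcongr)
    have c2 : ‖cB z‖ ≤ 2 * M + M := (norm_sub_le _ _).trans (by
      rw [norm_mul, Complex.norm_ofNat]; gcongr)
    refine (norm_add₃_le).trans ?_
    rw [norm_pow, norm_pow, norm_pow]
    gcongr

lemma mF_eq : ∃ c : ℂ, ∀ z : ℍ, cF z = c * ModularForm.E₄ z := by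
  obtain ⟨c, hc⟩ : ∃ c : ℂ, c • ModularForm.E₄ = mF :=
    (finrank_eq_one_iff_of_nonzero' _ (EisensteinSeries.E_ne_zero _ ⟨2, rfl⟩)).mp
      (Module.rank_eq_one_iff_finrank_eq_one.mp ModularForm.levelOne_weight_four_rank_one) _
  refine ⟨c, fun z => ?_⟩
  have : mF z = cF z := rfl
  rw [← this, ← hc]
  rfl
end modular


noncomputable def Lam (r : ℝ) : ℝ := ∑' n : ℕ, (n : ℝ) ^ 3 * r ^ n / (1 - r ^ n)

lemma Lam_summable {r : ℝ} (h0 : 0 ≤ r) (h1 : r < 1) :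
    Summable fun n : ℕ => (n : ℝ) ^ 3 * r ^ n / (1 - r ^ n) :=
  summable_norm_pow_mul_geometric_div_one_sub 3 (by rwa [Real.norm_of_nonneg h0])

lemma Lam_nonneg {r : ℝ} (h0 : 0 ≤ r) (h1 : r < 1) : 0 ≤ Lam r := by
  refine tsum_nonneg fun n => ?_
  have : r ^ n ≤ 1 := pow_le_one₀ h0 h1.le
  exact div_nonneg (by positivity) (by linarith)

lemma Lam_le {r s : ℝ} (h0 : 0 < r) (hrs : r ≤ s) (h1 : s < 1) : Lam r ≤ (r / s) * Lam s := by
  unfold Lam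
  rw [← tsum_mul_left]
  have hs : 0 < s := by linarith
  refine (Lam_summable h0.le (by linarith)).tsum_le_tsum (fun n => ?_) ((Lam_summable hs.le h1).mul_left _)
  rcases Nat.eq_zero_or_pos n with rfl | hn
  · simp
  have a1 : r ^ n ≤ s ^ n := by gcongr
  have a2 : s ^ n < 1 := pow_lt_one₀ hs.le h1 hn.ne'
  have a3 : r ^ n ≤ (r / s) * s ^ n := by
    have : r ^ n = (r / s) ^ n * s ^ n := by rw [div_pow]; field_simp
    rw [this]
    gcongr
    exact pow_le_of_le_one (by positivity) ((div_le_one hs).2 hrs) hn.ne'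
  rw [← mul_div_assoc, mul_left_comm]
  apply div_le_div₀
  · positivity
  · gcongr
  · linarith
  · linarith

lemma jT_real (y : ℝ) : jacobiTheta (I * y) = (tC y : ℂ) := by
  rw [jacobiTheta, tC_def, Complex.ofReal_tsum]
  refine tsum_congr fun n => ?_
  push_cast
  congr 1
  linear_combination (π * (n:ℂ) ^ 2 * y) * Complex.I_sq

lemma cF_real {y : ℝ} (hy : 0 < y) :
    cF (I * y) = ((tA y ^ 8 + tB y ^ 8 + tC y ^ 8 : ℝ) : ℂ) := by
  have h := tC_split (y := y / 4) (by positivity)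
  rw [show 4 * (y / 4) = y by ring] at h
  have e1 : jacobiTheta (4 * (I * y)) = (tC (4 * y) : ℂ) := by
    rw [← jT_real]; congr 1; push_cast; ring
  have e2 : jacobiTheta (I * y / 4) = (tC (y / 4) : ℂ) := by
    rw [← jT_real]; congr 1; push_cast; ring
  have hA : cA (I * y) = (tA y : ℂ) := by
    rw [cA, e2, jT_real, h]; push_cast; ring
  have hB : cB (I * y) = (tB y : ℂ) := by
    rw [cB, e1, jT_real, tB]; push_cast; ring
  rw [cF, hA, hB, jT_real]; push_cast; ring

lemma E4_real {y : ℝ} (hy : 0 < y) :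
    ModularForm.E₄ (⟨I * y, by simpa using hy⟩ : UpperHalfPlane) =
      ((1 + 240 * Lam (rexp (-2 * π * y)) : ℝ) : ℂ) := by
  set r := rexp (-2 * π * y) with hr
  have r0 : 0 < r := Real.exp_pos _
  have r1 : r < 1 := by rw [hr, Real.exp_lt_one_iff]; nlinarith [Real.pi_pos]
  have hq : cexp (2 * π * I * (I * y)) = (r : ℂ) := by
    rw [hr]; push_cast; congr 1; linear_combination (2 * π * (y:ℂ)) * Complex.I_sq
  have hn : ‖(r:ℂ)‖ < 1 := by rwa [Complex.norm_real, Real.norm_of_nonneg r0.le]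
  have hL : (Lam r : ℂ) = ∑' n : ℕ+, (n:ℂ) ^ 3 * (r:ℂ) ^ (n:ℕ) / (1 - (r:ℂ) ^ (n:ℕ)) := by
    have := tsum_zero_pnat_eq_tsum_nat (Lam_summable r0.le r1)
    rw [Lam, ← this]
    push_cast
    simp
  have hb : bernoulli 4 = -1 / 30 := by decide +kernel
  have h := EisensteinSeries.q_expansion_bernoulli (k := 4) (by norm_num) ⟨2, rfl⟩
    (⟨I * y, by simpa using hy⟩ : UpperHalfPlane)
  rw [ModularForm.E₄]
  refine h.trans ?_
  simp only [zpow_natCast, hb]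
  show 1 - _ * ∑' n : ℕ+, _ * cexp (2 * π * I * (I * y)) ^ (n:ℕ) = _
  rw [hq]
  have h2 := tsum_pow_div_one_sub_eq_tsum_sigma hn 3
  rw [show 4 - 1 = 3 from rfl, ← h2, ← hL]
  push_cast
  ring

lemma F_Lam {y : ℝ} (hy : 0 < y) :
    tA y ^ 8 + tB y ^ 8 + tC y ^ 8 = 2 * (1 + 240 * Lam (rexp (-2 * π * y))) := by
  obtain ⟨c, hc⟩ := mF_eq
  have key : ∀ y : ℝ, 0 < y → ((tA y ^ 8 + tB y ^ 8 + tC y ^ 8 : ℝ) : ℂ) =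
      c * ((1 + 240 * Lam (rexp (-2 * π * y)) : ℝ) : ℂ) := fun y hy => by
    rw [← E4_real hy, ← hc, ← cF_real hy]
  have lim1 : Tendsto (fun y => ((tA y ^ 8 + tB y ^ 8 + tC y ^ 8 : ℝ) : ℂ)) atTop (𝓝 ((2:ℝ):ℂ)) := by
    refine (Complex.continuous_ofReal.tendsto _).comp ?_
    have := ((dec_A.tendsto.pow 8).add (tB_tendsto.pow 8)).add (tC_tendsto.pow 8)
    norm_num at this
    exact this
  have hq : Tendsto (fun y : ℝ => rexp (-2 * π * y)) atTop (𝓝 0) := by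
    refine Real.tendsto_exp_atBot.comp ?_
    exact tendsto_id.const_mul_atTop_of_neg (by nlinarith [Real.pi_pos])
  have limL : Tendsto (fun y : ℝ => Lam (rexp (-2 * π * y))) atTop (𝓝 0) := by
    have u := (hq.div_const (1/2)).mul_const (Lam (1/2))
    rw [zero_div, zero_mul] at u
    have ev : ∀ᶠ y : ℝ in atTop, rexp (-2 * π * y) < 1 / 2 :=
      hq.eventually (gt_mem_nhds (by norm_num))
    refine tendsto_of_tendsto_of_tendsto_of_le_of_le' tendsto_const_nhds u ?_ ?_
    · filter_upwards [ev] with y h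
      exact Lam_nonneg (Real.exp_pos _).le (by linarith)
    · filter_upwards [ev] with y h
      exact Lam_le (Real.exp_pos _) h.le (by norm_num)
  have lim2 : Tendsto (fun y => ((tA y ^ 8 + tB y ^ 8 + tC y ^ 8 : ℝ) : ℂ)) atTop (𝓝 c) := by
    have l3 : Tendsto (fun y : ℝ => ((1 + 240 * Lam (rexp (-2 * π * y)) : ℝ) : ℂ)) atTop
        (𝓝 (((1 + 240 * 0 : ℝ)) : ℂ)) :=
      (Complex.continuous_ofReal.tendsto _).comp ((limL.const_mul 240).const_add 1)
    have l4 := l3.const_mul c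
    simp only [mul_zero, add_zero, Complex.ofReal_one, mul_one] at l4
    refine l4.congr' ?_
    filter_upwards [eventually_gt_atTop 0] with y hy
    exact (key y hy).symm
  have hc2 : c = ((2:ℝ):ℂ) := tendsto_nhds_unique lim2 lim1
  have := key y hy
  rw [hc2] at this
  exact_mod_cast this

lemma Sk_Lam : 8 * ∑' p, Sk p = Lam (rexp (-2 * π * (1/4))) - 9 * Lam (rexp (-2 * π * (1/2)))
    + 8 * Lam (rexp (-2 * π * 1)) := by
  set r := rexp (-2 * π * (1/4)) with hr
  have r0 : 0 < r := Real.exp_pos _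
  have r1 : r < 1 := by rw [hr, Real.exp_lt_one_iff]; nlinarith [Real.pi_pos]
  have hr2 : rexp (-2 * π * (1/2)) = r ^ 2 := by
    rw [hr, ← Real.exp_nat_mul]; congr 1; push_cast; ring
  have hr4 : rexp (-2 * π * 1) = r ^ 4 := by
    rw [hr, ← Real.exp_nat_mul]; congr 1; push_cast; ring
  rw [hr2, hr4]
  have s1 := Lam_summable r0.le r1
  have s2 := Lam_summable (r := r ^ 2) (by positivity) (pow_lt_one₀ r0.le r1 (by norm_num))
  have s4 := Lam_summable (r := r ^ 4) (by positivity) (pow_lt_one₀ r0.le r1 (by norm_num))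
  set v : ℕ → ℝ := fun n => (n : ℝ) ^ 3 * r ^ n / (1 - r ^ n) - (n : ℝ) ^ 3 * (r ^ 2) ^ n / (1 - (r ^ 2) ^ n)
  have sv : Summable v := s1.sub s2
  have tv : ∑' n, v n = Lam r - Lam (r ^ 2) := s1.tsum_sub s2
  have he : ∀ n, v (2 * n) = 8 * ((n : ℝ) ^ 3 * (r ^ 2) ^ n / (1 - (r ^ 2) ^ n)
      - (n : ℝ) ^ 3 * (r ^ 4) ^ n / (1 - (r ^ 4) ^ n)) := fun n => by
    simp only [v]
    rw [← pow_mul, ← pow_mul, ← pow_mul, show 2 * (2 * n) = 4 * n by ring]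
    push_cast; ring
  have te : ∑' n, v (2 * n) = 8 * (Lam (r ^ 2) - Lam (r ^ 4)) := by
    simp only [he]
    rw [tsum_mul_left, s2.tsum_sub s4]; rfl
  have ho : ∀ n, v (2 * n + 1) = 8 * ∑' c, Sk (n, c) := fun n => by
    set x := r ^ (2 * n + 1) with hx
    have x0 : 0 < x := by positivity
    have x1 : x < 1 := pow_lt_one₀ r0.le r1 (by omega)
    have hS : ∀ c, Sk (n, c) = (2 * n + 1 : ℝ) ^ 3 / 8 * x * (x ^ 2) ^ c := fun c => by
      have : x * (x ^ 2) ^ c = rexp (-2 * π * ((n : ℝ) + 1 / 2) * ((c : ℝ) + 1 / 2)) := by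
        rw [hx, hr, ← pow_mul, ← pow_succ', ← pow_mul, ← Real.exp_nat_mul]
        congr 1; push_cast; ring
      simp only [Sk]
      rw [← this]; ring
    simp only [hS]
    rw [tsum_mul_left, tsum_geometric_of_lt_one (by positivity) (pow_lt_one₀ x0.le x1 (by norm_num))]
    simp only [v]
    rw [show (r ^ 2) ^ (2 * n + 1) = x ^ 2 by rw [hx, ← pow_mul, ← pow_mul, mul_comm], ← hx]
    have d1 : 1 - x ≠ 0 := by linarith
    have d2 : 1 - x ^ 2 ≠ 0 := by nlinarith
    push_cast
    field_simp
    ring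
  have todd : ∑' n, v (2 * n + 1) = 8 * ∑' p, Sk p := by
    simp only [ho]
    rw [tsum_mul_left, Sk_summable.tsum_prod]
  have i1 : Function.Injective (fun n : ℕ => 2 * n) := fun a b h => by simpa using h
  have i2 : Function.Injective (fun n : ℕ => 2 * n + 1) := fun a b h => by simpa using h
  have := tsum_even_add_odd (sv.comp_injective i1) (sv.comp_injective i2)
  have e : ∑' n, v (2 * n) + ∑' n, v (2 * n + 1) = ∑' n, v n := this
  rw [te, todd, tv] at e
  linarith

lemma Sk_val : ∑' p, Sk p = 3 * √2 / 32 * (tA 1 ^ 2) ^ 4 := by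
  have h := Sk_Lam
  have f1 := F_Lam (y := 1) one_pos
  have f2 := F_Lam (y := 1/2) (by norm_num)
  have f4 := F_Lam (y := 1/4) (by norm_num)
  have a2 := tA_sq (y := 1/2) (by norm_num)
  have b2 := tB_sq (y := 1/2) (by norm_num)
  have c2 := tC_sq (y := 1/2) (by norm_num)
  have a4 := tA_sq (y := 1/4) (by norm_num)
  have b4 := tB_sq (y := 1/4) (by norm_num)
  have c4 := tC_sq (y := 1/4) (by norm_num)
  rw [show (2:ℝ) * (1/2) = 1 by norm_num] at a2 b2 c2
  rw [show (2:ℝ) * (1/4) = 1/2 by norm_num] at a4 b4 c4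
  have hAB := tA_inv (y := 1) one_pos
  rw [div_one, Real.sqrt_one, one_mul] at hAB
  have hq := jacobi_quartic (y := 1) one_pos
  have pA := tA_pos (y := 1) one_pos
  have pC := tC_pos (y := 1) one_pos
  rw [← hAB] at hq f1
  set t := tA 1 ^ 2
  set s := √2
  have hs : s ^ 2 = 2 := Real.sq_sqrt (by norm_num)
  have s0 : 0 < s := by positivity
  have t0 : 0 < t := by positivity
  have hC : tC 1 ^ 2 = s * t := by
    have : (tC 1 ^ 2) ^ 2 = (s * t) ^ 2 := by
      rw [mul_pow, hs]; simp only [t]; nlinarith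
    exact (sq_eq_sq₀ (by positivity) (by positivity)).1 this
  have k1 : tA 1 ^ 8 + tA 1 ^ 8 + tC 1 ^ 8 = 6 * t ^ 4 := by
    have : tC 1 ^ 8 = (tC 1 ^ 2) ^ 4 := by ring
    rw [this, hC, mul_pow, show s ^ 4 = (s ^ 2) ^ 2 by ring, hs]; simp only [t]; ring
  have a2' : tA (1/2) ^ 4 = 4 * s * t ^ 2 := by
    rw [show tA (1/2) ^ 4 = (tA (1/2) ^ 2) ^ 2 by ring, a2, mul_pow, mul_pow, hC]; simp only [t]; ring
  rw [hC] at b2 c2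
  have k2 : tA (1/2) ^ 8 + tB (1/2) ^ 8 + tC (1/2) ^ 8 = 66 * t ^ 4 := by
    rw [show tA (1/2) ^ 8 = (tA (1/2) ^ 4) ^ 2 by ring, show tB (1/2) ^ 8 = (tB (1/2) ^ 2) ^ 4 by ring,
      show tC (1/2) ^ 8 = (tC (1/2) ^ 2) ^ 4 by ring, a2', b2, c2]
    have : s ^ 4 = 4 := by rw [show s ^ 4 = (s ^ 2) ^ 2 by ring, hs]; norm_num
    linear_combination (2 * t ^ 4) * this + (28 * t ^ 4) * hs
  have c2' : tC (1/2) ^ 2 = (s + 1) * t := by rw [c2]; simp only [t]; ring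
  have a2sq : (tA (1/2) ^ 2) ^ 2 = 4 * s * t ^ 2 := by rw [← a2']; ring
  have k4 : tA (1/4) ^ 8 + tB (1/4) ^ 8 + tC (1/4) ^ 8 = (546 + 360 * s) * t ^ 4 := by
    have e1 : tA (1/4) ^ 8 = 16 * ((tA (1/2) ^ 2) ^ 2) * (tC (1/2) ^ 2) ^ 2 := by
      rw [show tA (1/4) ^ 8 = (tA (1/4) ^ 2) ^ 4 by ring, a4]; ring
    have e2 : tB (1/4) ^ 8 + tC (1/4) ^ 8 = 2 * (tC (1/2) ^ 2) ^ 4 + 12 * (tC (1/2) ^ 2) ^ 2 * (tA (1/2) ^ 2) ^ 2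
        + 2 * ((tA (1/2) ^ 2) ^ 2) ^ 2 := by
      rw [show tB (1/4) ^ 8 = (tB (1/4) ^ 2) ^ 4 by ring, show tC (1/4) ^ 8 = (tC (1/4) ^ 2) ^ 4 by ring, b4, c4]; ring
    rw [add_assoc, e1, e2, a2sq, c2']
    have h3 : s ^ 3 = 2 * s := by rw [pow_succ, hs]
    have h4 : s ^ 4 = 4 := by rw [show s ^ 4 = (s ^ 2) ^ 2 by ring, hs]; norm_num
    have h5 : s ^ 5 = 4 * s := by rw [pow_succ, h4]
    have h6 : s ^ 6 = 8 := by rw [show s ^ 6 = (s ^ 2) ^ 3 by ring, hs]; norm_num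
    ring_nf
    simp only [hs, h3, h4, h5, h6]
    ring
  rw [k1] at f1
  rw [k2] at f2
  rw [k4] at f4
  linear_combination (1/8) * h - (1/8) * (1/480) * f4 + (9/8) * (1/480) * f2 - (1/480) * f1


lemma beta_val : ∫ x in Ioo (0:ℝ) 1, x ^ (1/4 - 1 : ℝ) * (1 - x) ^ (1/2 - 1 : ℝ)
    = Real.Gamma (1/4) * Real.Gamma (1/2) / Real.Gamma (3/4) := by
  have h := ProbabilityTheory.beta_eq_betaIntegralReal (1/4) (1/2) (by norm_num) (by norm_num)
  rw [ProbabilityTheory.beta, show (1/4 + 1/2 : ℝ) = 3/4 by norm_num] at h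
  rw [h, Complex.betaIntegral, intervalIntegral.integral_of_le zero_le_one,
    integral_Ioc_eq_integral_Ioo]
  rw [show (∫ x in Ioo (0:ℝ) 1, (x:ℂ) ^ (((1/4 : ℝ) : ℂ) - 1) * (1 - (x:ℂ)) ^ (((1/2 : ℝ) : ℂ) - 1))
    = ∫ x in Ioo (0:ℝ) 1, ((x ^ (1/4 - 1 : ℝ) * (1 - x) ^ (1/2 - 1 : ℝ) : ℝ) : ℂ) from ?_]
  · rw [integral_complex_ofReal, Complex.ofReal_re]
  · refine setIntegral_congr_fun measurableSet_Ioo fun x hx => ?_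
    rw [Complex.ofReal_mul, Complex.ofReal_cpow hx.1.le, Complex.ofReal_cpow (by linarith [hx.2])]
    push_cast
    rfl

lemma cos4_image : (fun θ => Real.cos θ ^ 4) '' Ioo 0 (π / 2) = Ioo 0 1 := by
  ext t
  simp only [mem_image, mem_Ioo]
  constructor
  · rintro ⟨θ, ⟨h0, h1⟩, rfl⟩
    have hc : 0 < Real.cos θ := Real.cos_pos_of_mem_Ioo ⟨by linarith, h1⟩
    have hs : 0 < Real.sin θ := Real.sin_pos_of_pos_of_lt_pi h0 (by linarith)
    have : Real.cos θ < 1 := by nlinarith [Real.sin_sq_add_cos_sq θ, sq_nonneg (Real.cos θ - 1)]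
    exact ⟨by positivity, pow_lt_one₀ hc.le this (by norm_num)⟩
  · rintro ⟨h0, h1⟩
    have s0 : 0 < √(√t) := by positivity
    have s1 : √(√t) < 1 := by
      rw [Real.sqrt_lt' one_pos, Real.sqrt_lt' (by norm_num)]; simpa using h1
    refine ⟨Real.arccos (√(√t)), ⟨Real.arccos_pos.2 s1, Real.arccos_lt_pi_div_two.2 s0⟩, ?_⟩
    rw [Real.cos_arccos (by linarith) s1.le, show √(√t) ^ 4 = (√(√t) ^ 2) ^ 2 by ring,
      Real.sq_sqrt (by positivity), Real.sq_sqrt h0.le]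

lemma eJ_val {t : ℝ} (ht : 0 < t) : eJ (√2 * t) t =
    1 / (4 * t) * (Real.Gamma (1/4) * Real.Gamma (1/2) / Real.Gamma (3/4)) := by
  have hpi : (0:ℝ) ≤ π / 2 := by positivity
  have inj : InjOn (fun θ => Real.cos θ ^ 4) (Ioo 0 (π / 2)) := by
    intro x hx y hy h
    have cx : 0 < Real.cos x := Real.cos_pos_of_mem_Ioo ⟨by linarith [hx.1], hx.2⟩
    have cy : 0 < Real.cos y := Real.cos_pos_of_mem_Ioo ⟨by linarith [hy.1], hy.2⟩
    have : Real.cos x = Real.cos y := (pow_left_inj₀ cx.le cy.le (by norm_num)).1 h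
    exact Real.injOn_cos ⟨hx.1.le, by linarith [hx.2]⟩ ⟨hy.1.le, by linarith [hy.2]⟩ this
  rw [← beta_val, ← cos4_image,
    integral_image_eq_integral_abs_deriv_smul (f' := fun θ => 4 * Real.cos θ ^ 3 * (-Real.sin θ))
      measurableSet_Ioo _ inj, eJ, intervalIntegral.integral_of_le hpi, integral_Ioc_eq_integral_Ioo,
      ← MeasureTheory.integral_const_mul]
  · refine setIntegral_congr_fun measurableSet_Ioo (fun θ hθ => ?_)
    have hc : 0 < Real.cos θ := Real.cos_pos_of_mem_Ioo ⟨by linarith [hθ.1], hθ.2⟩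
    have hs : 0 < Real.sin θ := Real.sin_pos_of_pos_of_lt_pi hθ.1 (by linarith [hθ.2])
    have hsc := Real.sin_sq_add_cos_sq θ
    simp only [smul_eq_mul]
    have e1 : (Real.cos θ ^ 4) ^ (1/4 - 1 : ℝ) = (Real.cos θ ^ 3)⁻¹ := by
      rw [← Real.rpow_natCast, ← Real.rpow_mul hc.le, ← Real.rpow_natCast, ← Real.rpow_neg hc.le]
      norm_num
    have e2 : 1 - Real.cos θ ^ 4 = Real.sin θ ^ 2 * (1 + Real.cos θ ^ 2) := by
      rw [Real.sin_sq]; ring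
    have e3 : (√2 * t) ^ 2 * Real.cos θ ^ 2 + t ^ 2 * Real.sin θ ^ 2 = t ^ 2 * (1 + Real.cos θ ^ 2) := by
      rw [mul_pow, Real.sq_sqrt (by norm_num), Real.sin_sq]; ring
    have e4 : |4 * Real.cos θ ^ 3 * (-Real.sin θ)| = 4 * Real.cos θ ^ 3 * Real.sin θ := by
      rw [mul_neg, abs_neg, abs_of_pos (by positivity)]
    rw [e1, e2, e3, e4, show (1/2 - 1 : ℝ) = -(1/2 : ℝ) by norm_num, rpow_neg_half _ (by positivity),
      rpow_neg_half _ (by positivity), Real.sqrt_mul (by positivity), Real.sqrt_mul (by positivity),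
      Real.sqrt_sq ht.le, Real.sqrt_sq hs.le]
    field_simp
  · intro θ hθ
    have := (Real.hasDerivAt_cos θ).fun_pow 4
    refine HasDerivAt.hasDerivWithinAt ?_
    convert! this using 1
    

lemma t_val : (tA 1 ^ 2) ^ 4 = Real.Gamma (1/4) ^ 8 / (64 * π ^ 6) := by
  have hAB := tA_inv (y := 1) one_pos
  rw [div_one, Real.sqrt_one, one_mul] at hAB
  have hq := jacobi_quartic (y := 1) one_pos
  have pA := tA_pos (y := 1) one_pos
  have pC := tC_pos (y := 1) one_pos
  have hJ := eJ_theta (y := 1) one_pos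
  rw [← hAB] at hq hJ
  have hC : tC 1 ^ 2 = √2 * tA 1 ^ 2 := by
    have : (tC 1 ^ 2) ^ 2 = (√2 * tA 1 ^ 2) ^ 2 := by
      rw [mul_pow, Real.sq_sqrt (by norm_num)]; nlinarith
    exact (sq_eq_sq₀ (by positivity) (by positivity)).1 this
  rw [hC] at hJ
  set t := tA 1 ^ 2
  have t0 : 0 < t := by positivity
  rw [eJ_val t0, Real.Gamma_one_half_eq] at hJ
  have hG := Real.Gamma_mul_Gamma_one_sub (1/4)
  rw [show (1 - 1/4 : ℝ) = 3/4 by norm_num, show π * (1/4) = π / 4 by ring, Real.sin_pi_div_four] at hG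
  set G := Real.Gamma (1/4)
  have G0 : 0 < G := Real.Gamma_pos_of_pos (by norm_num)
  have H0 : 0 < Real.Gamma (3/4) := Real.Gamma_pos_of_pos (by norm_num)
  set H := Real.Gamma (3/4)
  have p0 := Real.pi_pos
  have s2 : √2 ^ 2 = 2 := Real.sq_sqrt (by norm_num)
  have sp : √π ^ 2 = π := Real.sq_sqrt p0.le
  have h1 : G * √π = 2 * π * t * H := by
    field_simp at hJ; linarith
  have h2 : G * H * √2 = 2 * π := by
    field_simp at hG; linarith
  have h3 : G ^ 2 * √π * √2 = 4 * π ^ 2 * t := by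
    calc G ^ 2 * √π * √2 = G * (G * √π) * √2 := by ring
      _ = 2 * π * t * (G * H * √2) := by rw [h1]; ring
      _ = _ := by rw [h2]; ring
  have h4 : (G ^ 2 * √π * √2) ^ 4 = G ^ 8 * 4 * π ^ 2 := by
    calc (G ^ 2 * √π * √2) ^ 4 = G ^ 8 * (√π ^ 2) ^ 2 * (√2 ^ 2) ^ 2 := by ring
      _ = _ := by rw [sp, s2]; ring
  rw [h3] at h4
  rw [eq_div_iff (by positivity)]
  have : 4 * π ^ 2 * (t ^ 4 * (64 * π ^ 6)) = 4 * π ^ 2 * G ^ 8 := by linear_combination h4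
  exact mul_left_cancel₀ (by positivity) this


end aux

theorem stmt1 :
    (∫ k in (0:ℝ)..1, (ellipticK (Real.sqrt (1 - k ^ 2))) ^ 3 /
        (Real.sqrt k * (1 - k ^ 2) ^ ((3:ℝ)/4)))
      = 3 * Real.Gamma (1/4) ^ 8 / (32 * Real.sqrt 2 * π ^ 2) := by
  have p0 := Real.pi_pos
  have s2 : √2 ^ 2 = 2 := Real.sq_sqrt (by norm_num)
  have s0 : (0:ℝ) < √2 := by positivity
  rw [main_S, Sk_val, t_val, eq_div_iff (by positivity)]
  field_simp
  rw [s2]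
  ring
end

section
/- ∫_0^1 [K(√(1-k²))]² K(k) / (√k (1-k²)^{3/4}) dk = Γ(1/4)⁸ / (32 √2 π²), where K is the complete elliptic integral of the first kind. -/
open Real MeasureTheory intervalIntegral Complex

set_option linter.unusedSimpArgs false

namespace S2

open ENNReal Set

lemma cov {s t : Set ℝ} {φ φ' ψ : ℝ → ℝ} (hs : MeasurableSet s)
    (h1 : ∀ x ∈ s, φ x ∈ t) (h2 : ∀ y ∈ t, ψ y ∈ s)
    (h3 : ∀ x ∈ s, ψ (φ x) = x) (h4 : ∀ y ∈ t, φ (ψ y) = y)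
    (hd : ∀ x ∈ s, HasDerivAt φ (φ' x) x) (G : ℝ → ℝ≥0∞) :
    ∫⁻ y in t, G y = ∫⁻ x in s, ENNReal.ofReal |φ' x| * G (φ x) := by
  have him : φ '' s = t := by
    ext y; constructor
    · rintro ⟨x, hx, rfl⟩; exact h1 x hx
    · intro hy; exact ⟨ψ y, h2 y hy, h4 y hy⟩
  rw [← him]
  refine lintegral_image_eq_lintegral_abs_deriv_mul hs (fun x hx => (hd x hx).hasDerivWithinAt) ?_ G
  intro a ha b hb hab
  rw [← h3 a ha, hab, h3 b hb]

lemma covr {s t : Set ℝ} {φ φ' ψ : ℝ → ℝ} (hs : MeasurableSet s)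
    (h1 : ∀ x ∈ s, φ x ∈ t) (h2 : ∀ y ∈ t, ψ y ∈ s)
    (h3 : ∀ x ∈ s, ψ (φ x) = x) (h4 : ∀ y ∈ t, φ (ψ y) = y)
    (hd : ∀ x ∈ s, HasDerivAt φ (φ' x) x) {g h : ℝ → ℝ}
    (hgh : ∀ x ∈ s, |φ' x| * g (φ x) = h x) :
    ∫⁻ y in t, ENNReal.ofReal (g y) = ∫⁻ x in s, ENNReal.ofReal (h x) := by
  rw [cov hs h1 h2 h3 h4 hd]
  refine setLIntegral_congr_fun hs fun x hx => ?_
  rw [← ENNReal.ofReal_mul (abs_nonneg _), hgh x hx]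

/-- the beta weight -/
noncomputable def W (a b x : ℝ) : ℝ≥0∞ := ENNReal.ofReal (x ^ (a - 1) * (1 - x) ^ (b - 1))

@[fun_prop]
lemma W_meas (a b : ℝ) : Measurable (W a b) := by unfold W; fun_prop

lemma beta_int {a b : ℝ} (ha : 0 < a) (hb : 0 < b) :
    ∫⁻ x in Ioo (0:ℝ) 1, W a b x = ENNReal.ofReal (ProbabilityTheory.beta a b) := by
  have h := ProbabilityTheory.lintegral_betaPDF_eq_one ha hb
  have hp := ProbabilityTheory.beta_pos ha hb
  rw [ProbabilityTheory.lintegral_betaPDF] at h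
  have : ∀ x : ℝ, ENNReal.ofReal (1 / ProbabilityTheory.beta a b * x ^ (a - 1) * (1 - x) ^ (b - 1))
      = ENNReal.ofReal (1 / ProbabilityTheory.beta a b) * W a b x := by
    intro x
    rw [W, ← ENNReal.ofReal_mul (by positivity), mul_assoc]
  simp_rw [this] at h
  rw [lintegral_const_mul _ (W_meas a b)] at h
  calc _ = ENNReal.ofReal (ProbabilityTheory.beta a b) *
        (ENNReal.ofReal (1 / ProbabilityTheory.beta a b) * ∫⁻ x in Ioo (0:ℝ) 1, W a b x) := by
        rw [← mul_assoc, ← ENNReal.ofReal_mul hp.le, mul_one_div_cancel hp.ne']; simp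
    _ = _ := by rw [h, mul_one]

lemma mconv {f g φ : ℝ → ℝ≥0∞} (hf : Measurable f) (hg : Measurable g) (hφ : Measurable φ) :
    ∫⁻ t in Ioo (0:ℝ) 1, ∫⁻ s in Ioo (0:ℝ) 1, f s * g t * φ (s * t) =
    ∫⁻ w in Ioo (0:ℝ) 1, ∫⁻ τ in Ioo (0:ℝ) 1,
      ENNReal.ofReal ((1 - w) / (1 - (1 - w) * τ)) * f (w / (1 - (1 - w) * τ))
        * g (1 - (1 - w) * τ) * φ w := by
  set H : ℝ → ℝ → ℝ≥0∞ := fun t w => (Iio t).indicator (fun w => 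
      ENNReal.ofReal (1 / t) * (f (w / t) * g t * φ w)) w with hH
  have e1 : ∀ t ∈ Ioo (0:ℝ) 1, ∫⁻ s in Ioo (0:ℝ) 1, f s * g t * φ (s * t)
      = ∫⁻ w in Ioo (0:ℝ) 1, H t w := by
    rintro t ⟨ht0, ht1⟩
    rw [hH]
    simp only
    rw [setLIntegral_indicator measurableSet_Iio]
    have : Iio t ∩ Ioo (0:ℝ) 1 = Ioo 0 t := by
      ext w; simp only [mem_inter_iff, mem_Iio, mem_Ioo]
      constructor
      · rintro ⟨a, b, c⟩; exact ⟨b, a⟩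
      · rintro ⟨a, b⟩; exact ⟨b, a, by linarith⟩
    rw [this]
    rw [cov (s := Ioo 0 t) (t := Ioo (0:ℝ) 1) (φ := fun w => w / t) (φ' := fun _ => 1 / t)
      (ψ := fun s => s * t) measurableSet_Ioo]
    · refine setLIntegral_congr_fun measurableSet_Ioo fun w _ => ?_
      rw [abs_of_pos (by positivity), div_mul_cancel₀ _ ht0.ne']
    · rintro x ⟨a, b⟩; exact ⟨by positivity, by rwa [div_lt_one ht0]⟩
    · rintro x ⟨a, b⟩; exact ⟨by positivity, by nlinarith⟩
    · intro x _; field_simp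
    · intro x _; field_simp
    · intro x _; exact (hasDerivAt_id x).div_const t
  rw [setLIntegral_congr_fun measurableSet_Ioo e1]
  have hHm : Measurable (Function.uncurry H) := by
    have : Function.uncurry H = {p : ℝ × ℝ | p.2 < p.1}.indicator (fun p =>
      ENNReal.ofReal (1 / p.1) * (f (p.2 / p.1) * g p.1 * φ p.2)) := by
      ext ⟨t, w⟩
      simp [H, Set.indicator]
    rw [this]
    refine Measurable.indicator ?_ (measurableSet_lt measurable_snd measurable_fst)
    fun_prop
  rw [lintegral_lintegral_swap hHm.aemeasurable]
  refine setLIntegral_congr_fun measurableSet_Ioo fun w hw => ?_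
  obtain ⟨hw0, hw1⟩ := hw
  have : ∀ t, H t w = (Ioi w).indicator (fun t => 
      ENNReal.ofReal (1 / t) * (f (w / t) * g t * φ w)) t := by
    intro t; simp [H, Set.indicator]
  simp_rw [this]
  rw [setLIntegral_indicator measurableSet_Ioi]
  have : Ioi w ∩ Ioo (0:ℝ) 1 = Ioo w 1 := by
      ext t; simp only [mem_inter_iff, mem_Ioi, mem_Ioo]
      constructor
      · rintro ⟨a, b, c⟩; exact ⟨a, c⟩
      · rintro ⟨a, b⟩; exact ⟨a, by linarith, b⟩
  rw [this]
  have hw' : 0 < 1 - w := by linarith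
  rw [cov (s := Ioo 0 1) (t := Ioo w 1) (φ := fun τ => 1 - (1 - w) * τ) (φ' := fun _ => -(1 - w))
      (ψ := fun t => (1 - t) / (1 - w)) measurableSet_Ioo]
  · refine setLIntegral_congr_fun measurableSet_Ioo fun τ hτ => ?_
    obtain ⟨h0, h1⟩ := hτ
    have : 0 < 1 - (1 - w) * τ := by nlinarith
    rw [abs_neg, abs_of_pos hw', ← mul_assoc, ← ENNReal.ofReal_mul hw'.le, mul_one_div]
    ring
  · rintro x ⟨a, b⟩; constructor <;> nlinarith
  · rintro x ⟨a, b⟩; exact ⟨div_pos (by linarith) hw', by rw [div_lt_one hw']; linarith⟩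
  · intro x _; field_simp; ring
  · intro x _; field_simp; ring
  · intro x _; simpa using ((hasDerivAt_id x).const_mul (1 - w)).const_sub 1


lemma eq_of_log {a b : ℝ} (ha : 0 < a) (hb : 0 < b) (h : Real.log a = Real.log b) : a = b :=
  Real.log_injOn_pos ha hb h

lemma bconv {a b c : ℝ} (hb : 0 < b) (hc : 0 < c) {φ : ℝ → ℝ≥0∞} (hφ : Measurable φ) :
    ∫⁻ t in Ioo (0:ℝ) 1, ∫⁻ s in Ioo (0:ℝ) 1, W a b s * W (a + b) c t * φ (s * t) =
    ENNReal.ofReal (ProbabilityTheory.beta c b) * ∫⁻ w in Ioo (0:ℝ) 1, W a (b + c) w * φ w := by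
  rw [mconv (W_meas _ _) (W_meas _ _) hφ, ← lintegral_const_mul _ (by fun_prop)]
  refine setLIntegral_congr_fun measurableSet_Ioo fun w hw => ?_
  obtain ⟨hw0, hw1⟩ := hw
  have hw' : 0 < 1 - w := by linarith
  rw [← beta_int hc hb, ← lintegral_mul_const _ (W_meas _ _)]
  refine setLIntegral_congr_fun measurableSet_Ioo fun τ hτ => ?_
  obtain ⟨h0, h1⟩ := hτ
  have hτ' : 0 < 1 - τ := by linarith
  have hT : 0 < 1 - (1 - w) * τ := by nlinarith
  simp only [W]
  set T := 1 - (1 - w) * τ with hTd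
  have e1 : 1 - w / T = (1 - w) * (1 - τ) / T := by field_simp; rw [hTd]; ring
  have e2 : 1 - T = (1 - w) * τ := by rw [hTd]; ring
  rw [e1, e2, ← mul_assoc, ← ENNReal.ofReal_mul (by positivity), ← ENNReal.ofReal_mul (by positivity),
    ← ENNReal.ofReal_mul (by positivity)]
  congr 2
  apply eq_of_log (by positivity) (by positivity)
  simp (disch := positivity) only [Real.log_mul, Real.log_div, Real.log_rpow]
  ring

/-- the lemniscatic weight -/
noncomputable def A2 (x : ℝ) : ℝ≥0∞ :=
  ∫⁻ τ in Ioo (0:ℝ) 1, W (1/4) (1/4) τ * ENNReal.ofReal ((1 - x ^ 2 * τ) ^ (-(1/4) : ℝ))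

lemma aconv {φ : ℝ → ℝ≥0∞} (hφ : Measurable φ) :
    ∫⁻ t in Ioo (0:ℝ) 1, ∫⁻ s in Ioo (0:ℝ) 1, W (1/4) (1/4) s * W (1/4) (1/4) t * φ (s * t) =
    ∫⁻ w in Ioo (0:ℝ) 1, W (1/4) (1/2) w * A2 (√(1 - w)) * φ w := by
  rw [mconv (W_meas _ _) (W_meas _ _) hφ]
  refine setLIntegral_congr_fun measurableSet_Ioo fun w hw => ?_
  obtain ⟨hw0, hw1⟩ := hw
  have hw' : 0 < 1 - w := by linarith
  simp only [A2]
  rw [← lintegral_const_mul _ (by unfold W; fun_prop), ← lintegral_mul_const _ (by unfold W; fun_prop)]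
  refine setLIntegral_congr_fun measurableSet_Ioo fun τ hτ => ?_
  obtain ⟨h0, h1⟩ := hτ
  have hτ' : 0 < 1 - τ := by linarith
  have hT : 0 < 1 - (1 - w) * τ := by nlinarith
  simp only [W]
  rw [Real.sq_sqrt hw'.le]
  set T := 1 - (1 - w) * τ with hTd
  have e1 : 1 - w / T = (1 - w) * (1 - τ) / T := by field_simp; rw [hTd]; ring
  have e2 : 1 - T = (1 - w) * τ := by rw [hTd]; ring
  rw [e1, e2, ← ENNReal.ofReal_mul (by positivity), ← ENNReal.ofReal_mul (by positivity),
    ← ENNReal.ofReal_mul (by positivity), ← ENNReal.ofReal_mul (by positivity)]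
  congr 2
  apply eq_of_log (by positivity) (by positivity)
  simp (disch := positivity) only [Real.log_mul, Real.log_div, Real.log_rpow]
  ring

lemma moebius {P Q : ℝ} (hP : 0 < P) (hQ : 0 < Q) :
    ∫⁻ t in Ioo (0:ℝ) 1, W (1/4) (1/4) t * ENNReal.ofReal ((P + Q * t) ^ (-(1/2) : ℝ)) =
    ENNReal.ofReal (ProbabilityTheory.beta (1/4) (1/4)) *
      ENNReal.ofReal (P ^ (-(1/4) : ℝ) * (P + Q) ^ (-(1/4) : ℝ)) := by
  rw [← beta_int (by norm_num) (by norm_num), ← lintegral_mul_const _ (W_meas _ _)]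
  have hD : ∀ x ∈ Ioo (0:ℝ) 1, 0 < P + Q - Q * x := by
    rintro x ⟨h0, h1⟩; nlinarith
  rw [cov (s := Ioo (0:ℝ) 1) (t := Ioo (0:ℝ) 1) (φ := fun s => P * s / (P + Q - Q * s))
    (φ' := fun s => P * (P + Q) / (P + Q - Q * s) ^ 2) (ψ := fun t => (P + Q) * t / (P + Q * t))
    measurableSet_Ioo]
  · refine setLIntegral_congr_fun measurableSet_Ioo fun s hs => ?_
    have hDs := hD s hs
    obtain ⟨h0, h1⟩ := hs
    have hs' : 0 < 1 - s := by linarith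
    simp only [W]
    set D := P + Q - Q * s with hDd
    have e1 : 1 - P * s / D = (P + Q) * (1 - s) / D := by field_simp; rw [hDd]; ring
    have e2 : P + Q * (P * s / D) = P * (P + Q) / D := by field_simp; rw [hDd]; ring
    rw [e1, e2, abs_of_pos (by positivity), ← ENNReal.ofReal_mul (by positivity),
      ← ENNReal.ofReal_mul (by positivity), ← ENNReal.ofReal_mul (by positivity)]
    congr 1
    apply eq_of_log (by positivity) (by positivity)
    simp (disch := positivity) only [Real.log_mul, Real.log_div, Real.log_rpow, Real.log_pow]
    push_cast
    ring
  · intro x hx; have := hD x hx; obtain ⟨h0, h1⟩ := hx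
    exact ⟨by positivity, by rw [div_lt_one this]; nlinarith⟩
  · intro x hx; obtain ⟨h0, h1⟩ := hx
    exact ⟨by positivity, by rw [div_lt_one (by positivity)]; nlinarith⟩
  · intro x hx; have := hD x hx
    have h2 : P + Q * (P * x / (P + Q - Q * x)) = P * (P + Q) / (P + Q - Q * x) := by
      field_simp; ring
    rw [h2]; field_simp
  · intro x hx; obtain ⟨h0, h1⟩ := hx
    have h3 : 0 < P + Q * x := by positivity
    have h2 : P + Q - Q * ((P + Q) * x / (P + Q * x)) = P * (P + Q) / (P + Q * x) := by
      field_simp; ring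
    rw [h2]; field_simp
  · intro x hx; have := hD x hx
    have h := ((hasDerivAt_id x).const_mul P).div (((hasDerivAt_id x).const_mul Q).const_sub (P + Q)) this.ne'
    refine h.congr_deriv ?_
    simp only [id]; congr 1; ring


/-- the symmetric product kernel -/
noncomputable def Phi (z : ℝ) : ℝ≥0∞ :=
  ∫⁻ c in Ioo (0:ℝ) 1, ∫⁻ y in Ioo (0:ℝ) 1,
    W (1/2) (1/2) c * W (1/2) (1/2) y * ENNReal.ofReal ((1 - y + z * c * y) ^ (-(1/2) : ℝ))

lemma Phi_meas : Measurable Phi := by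
  unfold Phi
  refine Measurable.lintegral_prod_right' (f := fun p : ℝ × ℝ => ∫⁻ y in Ioo (0:ℝ) 1,
    W (1/2) (1/2) p.2 * W (1/2) (1/2) y * ENNReal.ofReal ((1 - y + p.1 * p.2 * y) ^ (-(1/2) : ℝ))) ?_
  refine Measurable.lintegral_prod_right' (f := fun p : (ℝ × ℝ) × ℝ => 
    W (1/2) (1/2) p.1.2 * W (1/2) (1/2) p.2 * ENNReal.ofReal ((1 - p.2 + p.1.1 * p.1.2 * p.2) ^ (-(1/2) : ℝ))) ?_
  unfold W
  fun_prop

/-- auxiliary kernel -/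
noncomputable def phi1 (w : ℝ) : ℝ≥0∞ :=
  ∫⁻ y in Ioo (0:ℝ) 1, ENNReal.ofReal (ProbabilityTheory.beta (1/4) (1/4)) *
    (W (1/2) (1/4) y * ENNReal.ofReal ((1 - y + w * y) ^ (-(1/4) : ℝ)))

lemma phi1_meas : Measurable phi1 := by
  unfold phi1
  refine Measurable.lintegral_prod_right' (f := fun p : ℝ × ℝ => 
    ENNReal.ofReal (ProbabilityTheory.beta (1/4) (1/4)) *
    (W (1/2) (1/4) p.2 * ENNReal.ofReal ((1 - p.2 + p.1 * p.2) ^ (-(1/4) : ℝ)))) ?_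
  unfold W
  fun_prop

lemma step_s (t : ℝ) (ht : t ∈ Ioo (0:ℝ) 1) :
    ∫⁻ s in Ioo (0:ℝ) 1, W (1/4) (1/4) s * W (1/4) (1/4) t * Phi (s * t) =
    ∫⁻ c in Ioo (0:ℝ) 1, W (1/4) (1/4) t * W (1/2) (1/2) c * phi1 (t * c) := by
  obtain ⟨ht0, ht1⟩ := ht
  have m1 : Measurable (fun p : (ℝ × ℝ) × ℝ => W (1/4) (1/4) p.1.1 * W (1/4) (1/4) t *
      (W (1/2) (1/2) p.1.2 * W (1/2) (1/2) p.2 * 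
      ENNReal.ofReal ((1 - p.2 + p.1.1 * t * p.1.2 * p.2) ^ (-(1/2) : ℝ)))) := by
    unfold W; fun_prop
  have e1 : ∀ s : ℝ, W (1/4) (1/4) s * W (1/4) (1/4) t * Phi (s * t) =
      ∫⁻ c in Ioo (0:ℝ) 1, ∫⁻ y in Ioo (0:ℝ) 1, W (1/4) (1/4) s * W (1/4) (1/4) t *
      (W (1/2) (1/2) c * W (1/2) (1/2) y * 
      ENNReal.ofReal ((1 - y + s * t * c * y) ^ (-(1/2) : ℝ))) := by
    intro s
    rw [Phi, ← lintegral_const_mul]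
    · congr 1; ext c
      rw [lintegral_const_mul]
      unfold W; fun_prop
    · refine Measurable.lintegral_prod_right' (f := fun p : ℝ × ℝ => 
        W (1/2) (1/2) p.1 * W (1/2) (1/2) p.2 * ENNReal.ofReal ((1 - p.2 + s * t * p.1 * p.2) ^ (-(1/2) : ℝ))) ?_
      unfold W; fun_prop
  simp_rw [e1]
  rw [lintegral_lintegral_swap (Measurable.aemeasurable (m1.lintegral_prod_right'))]
  refine setLIntegral_congr_fun measurableSet_Ioo fun c hc => ?_
  obtain ⟨hc0, hc1⟩ := hc
  have m2 : Measurable (fun p : ℝ × ℝ => W (1/4) (1/4) p.1 * W (1/4) (1/4) t *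
      (W (1/2) (1/2) c * W (1/2) (1/2) p.2 * 
      ENNReal.ofReal ((1 - p.2 + p.1 * t * c * p.2) ^ (-(1/2) : ℝ)))) := by
    unfold W; fun_prop
  rw [lintegral_lintegral_swap m2.aemeasurable, phi1, ← lintegral_const_mul _ (by fun_prop)]
  refine setLIntegral_congr_fun measurableSet_Ioo fun y hy => ?_
  obtain ⟨hy0, hy1⟩ := hy
  have hy' : 0 < 1 - y := by linarith
  have hm := moebius hy' (show 0 < t * c * y by positivity)
  calc _ = ∫⁻ s in Ioo (0:ℝ) 1, (W (1/4) (1/4) t * (W (1/2) (1/2) c * W (1/2) (1/2) y)) *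
        (W (1/4) (1/4) s * ENNReal.ofReal ((1 - y + t * c * y * s) ^ (-(1/2) : ℝ))) := by
        congr 1; ext s
        rw [show s * t * c * y = t * c * y * s by ring]
        ring
    _ = _ := by
        rw [lintegral_const_mul _ (by fun_prop), hm]
        have : W (1/2) (1/4) y * ENNReal.ofReal ((1 - y + t * c * y) ^ (-(1/4) : ℝ)) =
          W (1/2) (1/2) y * ENNReal.ofReal ((1 - y) ^ (-(1/4) : ℝ) * (1 - y + t * c * y) ^ (-(1/4) : ℝ)) := by
          unfold W
          have : 0 < 1 - y + t * c * y := by positivity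
          rw [← ENNReal.ofReal_mul (by positivity), ← ENNReal.ofReal_mul (by positivity)]
          congr 1
          apply eq_of_log (by positivity) (by positivity)
          simp (disch := positivity) only [Real.log_mul, Real.log_div, Real.log_rpow, Real.log_pow]
          ring
        rw [this]
        ring

lemma T_eval :
    ∫⁻ t in Ioo (0:ℝ) 1, ∫⁻ s in Ioo (0:ℝ) 1, W (1/4) (1/4) s * W (1/4) (1/4) t * Phi (s * t) =
    ENNReal.ofReal (ProbabilityTheory.beta (1/2) (1/4)) * 
    (ENNReal.ofReal (ProbabilityTheory.beta (1/4) (1/4)) *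
    (ENNReal.ofReal (ProbabilityTheory.beta (1/4) (1/4)) * 
      ENNReal.ofReal (ProbabilityTheory.beta (1/2) (1/4)))) := by
  rw [setLIntegral_congr_fun measurableSet_Ioo step_s]
  have m1 : Measurable (fun p : ℝ × ℝ => W (1/4) (1/4) p.1 * W (1/2) (1/2) p.2 * phi1 (p.1 * p.2)) := by
    have := phi1_meas
    unfold W; fun_prop
  rw [lintegral_lintegral_swap m1.aemeasurable]
  have h1 := bconv (a := 1/4) (b := 1/4) (c := 1/2) (by norm_num) (by norm_num) phi1_meas
  rw [show (1/4 + 1/4 : ℝ) = 1/2 by norm_num] at h1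
  rw [h1]
  congr 1
  rw [show (1/4 + 1/2 : ℝ) = 3/4 by norm_num]
  rw [cov (s := Ioo (0:ℝ) 1) (φ := fun x => 1 - x) (φ' := fun _ => -1) (ψ := fun x => 1 - x) measurableSet_Ioo]
  rotate_left
  · rintro x ⟨h0, h1⟩; constructor <;> linarith
  · rintro x ⟨h0, h1⟩; constructor <;> linarith
  · intro x _; ring
  · intro x _; ring
  · intro x _; simpa using (hasDerivAt_id x).const_sub 1
  have h2 := bconv (a := 1/2) (b := 1/4) (c := 1/4) (by norm_num) (by norm_num) 
    (φ := fun v => ENNReal.ofReal (ProbabilityTheory.beta (1/4) (1/4)) * ENNReal.ofReal ((1 - v) ^ (-(1/4) : ℝ)))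
    (by fun_prop)
  rw [show (1/2 + 1/4 : ℝ) = 3/4 by norm_num, show (1/4 + 1/4 : ℝ) = 1/2 by norm_num] at h2
  trans ∫⁻ t in Ioo (0:ℝ) 1, ∫⁻ s in Ioo (0:ℝ) 1, W (1/2) (1/4) s * W (3/4) (1/4) t * 
    (ENNReal.ofReal (ProbabilityTheory.beta (1/4) (1/4)) * ENNReal.ofReal ((1 - s * t) ^ (-(1/4) : ℝ)))
  · refine setLIntegral_congr_fun measurableSet_Ioo fun t _ => ?_
    simp only [phi1]
    rw [abs_neg, abs_one, ENNReal.ofReal_one, one_mul, ← lintegral_const_mul _ (by fun_prop)]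
    congr 1; ext s
    have : W (1/4) (3/4) (1 - t) = W (3/4) (1/4) t := by
      unfold W; rw [mul_comm]; ring_nf
    rw [this, show 1 - s + (1 - t) * s = 1 - s * t by ring]
    ring
  · rw [h2]
    congr 1
    rw [← beta_int (a := 1/2) (b := 1/4) (by norm_num) (by norm_num), ← lintegral_const_mul _ (by fun_prop)]
    refine setLIntegral_congr_fun measurableSet_Ioo fun y hy => ?_
    obtain ⟨hy0, hy1⟩ := hy
    have hy' : 0 < 1 - y := by linarith
    simp only [W]
    rw [← mul_assoc, mul_comm (ENNReal.ofReal (y ^ _ * _)), mul_assoc, ← ENNReal.ofReal_mul (by positivity)]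
    congr 2
    apply eq_of_log (by positivity) (by positivity)
    simp (disch := positivity) only [Real.log_mul, Real.log_div, Real.log_rpow, Real.log_pow]
    ring


lemma even_lint {f : ℝ → ℝ≥0∞} (hf : ∀ x, f (-x) = f x) :
    ∫⁻ x, f x = 2 * ∫⁻ x in Ioi (0:ℝ), f x := by
  rw [← lintegral_add_compl f (measurableSet_Ioi (a := (0:ℝ))), compl_Ioi, 
    setLIntegral_congr (Iio_ae_eq_Iic (a := (0:ℝ)) (μ := volume)).symm, two_mul]
  congr 1
  rw [cov (s := Ioi (0:ℝ)) (t := Iio 0) (φ := fun x => -x) (φ' := fun _ => -1) (ψ := fun x => -x)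
    measurableSet_Ioi]
  · refine setLIntegral_congr_fun measurableSet_Ioi fun t _ => ?_
    simp [hf]
  · intro x hx; simpa using hx
  · intro x hx; simpa using hx
  · intro x _; simp
  · intro x _; simp
  · intro x _; exact (hasDerivAt_id x).neg

lemma even_lint_Ioo {f : ℝ → ℝ≥0∞} (hf : ∀ x, f (-x) = f x) (r : ℝ) :
    ∫⁻ x in Ioo (-r) r, f x = 2 * ∫⁻ x in Ioo 0 r, f x := by
  rw [← lintegral_indicator measurableSet_Ioo, even_lint, setLIntegral_indicator measurableSet_Ioo]
  · congr 3
    ext x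
    simp only [mem_inter_iff, mem_Ioo, mem_Ioi]
    constructor
    · rintro ⟨⟨a, b⟩, c⟩; exact ⟨c, b⟩
    · rintro ⟨a, b⟩; exact ⟨⟨by linarith, b⟩, a⟩
  · intro x
    simp only [Set.indicator, mem_Ioo, hf]
    congr 1
    simp only [eq_iff_iff]
    constructor
    · rintro ⟨a, b⟩; constructor <;> linarith
    · rintro ⟨a, b⟩; constructor <;> linarith

/-- complete elliptic integral, as a function of the complementary parameter -/
noncomputable def kap (w : ℝ) : ℝ≥0∞ :=
  ∫⁻ b in Ioi (0:ℝ), ENNReal.ofReal ((√((1 + b ^ 2) * (w + b ^ 2)))⁻¹)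

lemma kap_meas : Measurable kap := by
  unfold kap
  refine Measurable.lintegral_prod_right' (f := fun p : ℝ × ℝ => 
    ENNReal.ofReal ((√((1 + p.2 ^ 2) * (p.1 + p.2 ^ 2)))⁻¹)) ?_
  fun_prop

lemma ellK {k : ℝ} (h0 : 0 < k) (h1 : k < 1) : ENNReal.ofReal (ellipticK k) = kap (1 - k ^ 2) := by
  have hpos : ∀ θ : ℝ, 0 < 1 - k ^ 2 * Real.sin θ ^ 2 := by
    intro θ
    have := Real.sin_sq_le_one θ
    have : k ^ 2 < 1 := by nlinarith
    nlinarith [sq_nonneg (Real.sin θ)]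
  have hc : Continuous fun θ : ℝ => (1 - k ^ 2 * Real.sin θ ^ 2) ^ (-(1/2 : ℝ)) := by
    refine Continuous.rpow_const (by fun_prop) fun θ => Or.inl (hpos θ).ne'
  have hpi : (0:ℝ) ≤ π / 2 := by positivity
  rw [ellipticK, intervalIntegral.integral_of_le hpi, ofReal_integral_eq_lintegral_ofReal]
  rotate_left
  · exact (hc.intervalIntegrable 0 (π/2)).1
  · filter_upwards with θ
    exact Real.rpow_nonneg (hpos θ).le _
  rw [setLIntegral_congr (Ioo_ae_eq_Ioc (a := (0:ℝ)) (b := π/2) (μ := volume)).symm, kap]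
  refine covr (φ := fun b => π / 2 - Real.arctan b) (φ' := fun b => -(1 / (1 + b ^ 2)))
    (ψ := fun θ => Real.tan (π / 2 - θ)) measurableSet_Ioi ?_ ?_ ?_ ?_ ?_ ?_
  · intro b hb
    have := Real.arctan_pos.2 hb
    have := Real.arctan_lt_pi_div_two b
    constructor <;> linarith
  · rintro θ ⟨a, b⟩
    exact Real.tan_pos_of_pos_of_lt_pi_div_two (by linarith) (by linarith)
  · intro b _
    simp [Real.tan_arctan]
  · rintro θ ⟨a, b⟩
    rw [Real.arctan_tan (by linarith) (by linarith)]; ring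
  · intro b _
    exact (Real.hasDerivAt_arctan b).const_sub _
  · intro b hb
    have hb : 0 < b := hb
    rw [Real.sin_pi_div_two_sub, Real.cos_sq_arctan, abs_neg, abs_of_pos (by positivity),
      Real.rpow_neg, ← Real.sqrt_eq_rpow]
    have hk : 0 < 1 - k ^ 2 := by nlinarith
    have : 1 - k ^ 2 * (1 / (1 + b ^ 2)) = (1 - k ^ 2 + b ^ 2) / (1 + b ^ 2) := by
      field_simp; ring
    rw [this, Real.sqrt_div (by positivity), Real.sqrt_mul (by positivity)]
    have h3 := Real.sq_sqrt (show 0 ≤ 1 + b ^ 2 by positivity)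
    have h4 : 0 < √(1 + b ^ 2) := by positivity
    have h5 : 0 < √(1 - k ^ 2 + b ^ 2) := by positivity
    field_simp
    nlinarith
    have := hpos (π / 2 - Real.arctan b)
    rw [Real.sin_pi_div_two_sub, Real.cos_sq_arctan] at this
    exact this.le

lemma kap_sinh (w : ℝ) (hw : 0 < w) :
    2 * kap w = ∫⁻ p : ℝ, ENNReal.ofReal ((√(w + Real.sinh p ^ 2))⁻¹) := by
  rw [even_lint (by intro x; simp), kap]
  congr 1
  refine covr (φ := Real.sinh) (φ' := Real.cosh) (ψ := Real.arsinh) measurableSet_Ioi ?_ ?_ ?_ ?_ ?_ ?_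
  · intro x hx; exact Real.sinh_pos_iff.2 hx
  · intro x hx; exact Real.arsinh_pos_iff.2 hx
  · intro x _; exact Real.arsinh_sinh x
  · intro x _; exact Real.sinh_arsinh x
  · intro x _; exact Real.hasDerivAt_sinh x
  · intro x _
    have := Real.cosh_pos x
    rw [Real.sqrt_mul (by positivity), ← Real.cosh_sq', Real.sqrt_sq this.le, abs_of_pos this]
    field_simp


lemma half_shift (h : ℝ → ℝ≥0∞) (β : ℝ) :
    ∫⁻ p, h p = ∫⁻ α, ENNReal.ofReal (1/2) * h ((α - β) / 2) := by
  have := cov (s := univ) (t := univ) (φ := fun α => (α - β) / 2) (φ' := fun _ => 1/2)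
    (ψ := fun p => 2 * p + β) MeasurableSet.univ (by simp) (by simp) (by intro x _; ring)
    (by intro x _; ring) (by intro x _; exact ((hasDerivAt_id x).sub_const β).div_const 2) h
  simpa using this

lemma prod1 {w : ℝ} (h0 : 0 < w) (h1 : w < 1) :
    (2 * kap w) * (2 * kap (1 - w)) = ∫⁻ α : ℝ, ∫⁻ β : ℝ,
      ENNReal.ofReal ((√((Real.cosh α * Real.cosh β) ^ 2 -
        (Real.sinh α * Real.sinh β + (1 - 2 * w)) ^ 2))⁻¹) := by
  have hw' : 0 < 1 - w := by linarith
  rw [kap_sinh w h0, kap_sinh _ hw']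
  set F : ℝ → ℝ≥0∞ := fun p => ENNReal.ofReal ((√(w + Real.sinh p ^ 2))⁻¹) with hF
  set G : ℝ → ℝ≥0∞ := fun p => ENNReal.ofReal ((√(1 - w + Real.sinh p ^ 2))⁻¹) with hG
  have hFm : Measurable F := by rw [hF]; fun_prop
  have hGm : Measurable G := by rw [hG]; fun_prop
  calc _ = ∫⁻ p, F p * ∫⁻ q, G q := (lintegral_mul_const _ hFm).symm
    _ = ∫⁻ p, ∫⁻ β, F p * G (p + β) := by
      congr 1; ext p
      rw [← lintegral_add_left_eq_self G p, lintegral_const_mul _ (by fun_prop)]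
    _ = ∫⁻ β, ∫⁻ p, F p * G (p + β) := by
      refine lintegral_lintegral_swap (Measurable.aemeasurable ?_)
      unfold Function.uncurry; fun_prop
    _ = ∫⁻ β, ∫⁻ α, ENNReal.ofReal (1/2) * (F ((α - β) / 2) * G ((α - β) / 2 + β)) := by
      congr 1; ext β
      exact half_shift (fun p => F p * G (p + β)) β
    _ = ∫⁻ α, ∫⁻ β, ENNReal.ofReal (1/2) * (F ((α - β) / 2) * G ((α - β) / 2 + β)) := by
      refine lintegral_lintegral_swap (Measurable.aemeasurable ?_)
      unfold Function.uncurry; fun_prop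
    _ = _ := by
      congr 1; ext α; congr 1; ext β
      simp only [hF, hG]
      rw [← ENNReal.ofReal_mul (by positivity), ← ENNReal.ofReal_mul (by positivity)]
      congr 1
      have hs : ∀ t : ℝ, Real.sinh (t / 2) ^ 2 = (Real.cosh t - 1) / 2 := by
        intro t
        have h1 := Real.cosh_two_mul (t / 2)
        rw [show 2 * (t / 2) = t by ring, Real.cosh_sq] at h1
        linarith
      rw [← mul_inv, ← Real.sqrt_mul (show 0 ≤ w + Real.sinh ((α - β) / 2) ^ 2 by positivity), show (α - β) / 2 + β = (α + β) / 2 by ring,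
        hs, hs, Real.cosh_add, Real.cosh_sub]
      have : (Real.cosh α * Real.cosh β) ^ 2 - (Real.sinh α * Real.sinh β + (1 - 2 * w)) ^ 2 =
        2 ^ 2 * ((w + (Real.cosh α * Real.cosh β - Real.sinh α * Real.sinh β - 1) / 2) *
          (1 - w + (Real.cosh α * Real.cosh β + Real.sinh α * Real.sinh β - 1) / 2)) := by ring
      rw [this, Real.sqrt_mul (show (0:ℝ) ≤ 2 ^ 2 by norm_num), Real.sqrt_sq (by norm_num), mul_inv]
      norm_num

lemma rot (a x : ℝ) (hx : x ^ 2 < 1) :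
    ∫⁻ θ in Ioo (-(π/2)) (π/2), 
      ENNReal.ofReal ((√(1 + a ^ 2 - (a * Real.sin θ + x * Real.cos θ) ^ 2))⁻¹) =
    ∫⁻ θ in Ioo (-(π/2)) (π/2), 
      ENNReal.ofReal ((√(1 + a ^ 2 - (a ^ 2 + x ^ 2) * Real.sin θ ^ 2))⁻¹) := by
  set ρ := √(a ^ 2 + x ^ 2)
  have hρ : ρ ^ 2 = a ^ 2 + x ^ 2 := Real.sq_sqrt (by positivity)
  obtain ⟨δ, hδ1, hδ2⟩ : ∃ δ : ℝ, a = ρ * Real.cos δ ∧ x = ρ * Real.sin δ := by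
    refine ⟨Complex.arg ⟨a, x⟩, ?_, ?_⟩
    · have := Complex.norm_mul_cos_arg ⟨a, x⟩
      rw [Complex.norm_def, Complex.normSq_mk] at this
      simp only [ρ, pow_two]; exact this.symm
    · have := Complex.norm_mul_sin_arg ⟨a, x⟩
      rw [Complex.norm_def, Complex.normSq_mk] at this
      simp only [ρ, pow_two]; exact this.symm
  set f : ℝ → ℝ := fun θ => (√(1 + a ^ 2 - (a ^ 2 + x ^ 2) * Real.sin θ ^ 2))⁻¹ with hf
  have e : ∀ θ : ℝ, (√(1 + a ^ 2 - (a * Real.sin θ + x * Real.cos θ) ^ 2))⁻¹ = f (θ + δ) := by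
    intro θ
    simp only [hf]
    rw [Real.sin_add, ← hρ]
    have : a * Real.sin θ + x * Real.cos θ = 
      ρ * (Real.sin θ * Real.cos δ + Real.cos θ * Real.sin δ) := by
      rw [mul_add]; nth_rewrite 1 [hδ1]; nth_rewrite 1 [hδ2]; ring
    rw [this, mul_pow]
  simp_rw [e]
  have hpos : ∀ θ : ℝ, 0 < 1 + a ^ 2 - (a ^ 2 + x ^ 2) * Real.sin θ ^ 2 := by
    intro θ
    nlinarith [Real.sin_sq_le_one θ, sq_nonneg a, sq_nonneg x]
  have hc : Continuous f := by
    refine Continuous.inv₀ (by fun_prop) fun θ => (Real.sqrt_pos.2 (hpos θ)).ne'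
  have hper : Function.Periodic f π := by
    intro θ; simp only [hf]; rw [Real.sin_add_pi, neg_sq]
  have hnn : ∀ θ, 0 ≤ f θ := by intro θ; simp only [hf]; positivity
  have key : ∀ g : ℝ → ℝ, Continuous g → (∀ θ, 0 ≤ g θ) → 
      ∫⁻ θ in Ioo (-(π/2)) (π/2), ENNReal.ofReal (g θ) = 
      ENNReal.ofReal (∫ θ in (-(π/2))..(π/2), g θ) := by
    intro g hg hg0
    have hpi : -(π/2) ≤ π / 2 := by linarith [Real.pi_pos]
    rw [intervalIntegral.integral_of_le hpi, ofReal_integral_eq_lintegral_ofReal, 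
      setLIntegral_congr (Ioo_ae_eq_Ioc (a := -(π/2)) (b := π/2) (μ := volume))]
    · exact (hg.intervalIntegrable _ _).1
    · filter_upwards with θ using hg0 θ
  rw [key _ (by fun_prop) (fun θ => hnn _), key _ hc hnn]
  congr 1
  rw [intervalIntegral.integral_comp_add_right (fun θ => f θ)]
  have := hper.intervalIntegral_add_eq (-(π/2) + δ) (-(π/2))
  rw [show -(π/2) + δ + π = π/2 + δ by ring, show -(π/2) + π = π / 2 by ring] at this
  exact this

lemma gud (a x : ℝ) :
    ∫⁻ β : ℝ, ENNReal.ofReal ((√((1 + a ^ 2) * Real.cosh β ^ 2 - (a * Real.sinh β + x) ^ 2))⁻¹) =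
    ∫⁻ θ in Ioo (-(π/2)) (π/2), 
      ENNReal.ofReal ((√(1 + a ^ 2 - (a * Real.sin θ + x * Real.cos θ) ^ 2))⁻¹) := by
  rw [← setLIntegral_univ]
  have hcos : ∀ θ ∈ Ioo (-(π/2)) (π/2), 0 < Real.cos θ := fun θ h => Real.cos_pos_of_mem_Ioo h
  have hsq : ∀ θ ∈ Ioo (-(π/2)) (π/2), √(1 + Real.tan θ ^ 2) = (Real.cos θ)⁻¹ := by
    intro θ h
    have := hcos θ h
    rw [← Real.inv_sqrt_one_add_tan_sq this, inv_inv]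
  refine covr (φ := fun θ => Real.arsinh (Real.tan θ)) (φ' := fun θ => (Real.cos θ)⁻¹)
    (ψ := fun β => Real.arctan (Real.sinh β)) measurableSet_Ioo (by simp) ?_ ?_ ?_ ?_ ?_
  · intro β _; exact ⟨Real.neg_pi_div_two_lt_arctan _, Real.arctan_lt_pi_div_two _⟩
  · intro θ h
    simp only [Real.sinh_arsinh]
    exact Real.arctan_tan h.1 h.2
  · intro β _
    simp only [Real.tan_arctan, Real.arsinh_sinh]
  · intro θ h
    have h1 := hcos θ h
    have := (Real.hasDerivAt_arsinh (Real.tan θ)).comp θ (Real.hasDerivAt_tan h1.ne')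
    refine this.congr_deriv ?_
    rw [hsq θ h]
    field_simp
  · intro θ h
    have h1 := hcos θ h
    rw [Real.cosh_arsinh, Real.sinh_arsinh, hsq θ h, Real.tan_eq_sin_div_cos, abs_of_pos (by positivity)]
    have : (1 + a ^ 2) * (Real.cos θ)⁻¹ ^ 2 - (a * (Real.sin θ / Real.cos θ) + x) ^ 2 =
      (Real.cos θ)⁻¹ ^ 2 * (1 + a ^ 2 - (a * Real.sin θ + x * Real.cos θ) ^ 2) := by
      field_simp
    rw [this, Real.sqrt_mul (by positivity), Real.sqrt_sq (by positivity), mul_inv]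
    field_simp

lemma prod2 {w : ℝ} (h0 : 0 < w) (h1 : w < 1) :
    kap w * kap (1 - w) = ∫⁻ α in Ioi (0:ℝ), ∫⁻ θ in Ioo 0 (π/2),
      ENNReal.ofReal ((√(Real.cosh α ^ 2 * Real.cos θ ^ 2 + 4 * w * (1 - w) * Real.sin θ ^ 2))⁻¹) := by
  have h := prod1 h0 h1
  have hx : (1 - 2 * w) ^ 2 < 1 := by nlinarith
  have e : ∀ α : ℝ, ∫⁻ β : ℝ,
      ENNReal.ofReal ((√((Real.cosh α * Real.cosh β) ^ 2 -
        (Real.sinh α * Real.sinh β + (1 - 2 * w)) ^ 2))⁻¹) = 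
      2 * ∫⁻ θ in Ioo 0 (π/2),
      ENNReal.ofReal ((√(Real.cosh α ^ 2 * Real.cos θ ^ 2 + 4 * w * (1 - w) * Real.sin θ ^ 2))⁻¹) := by
    intro α
    rw [← even_lint_Ioo (by intro x; simp)]
    simp_rw [mul_pow, Real.cosh_sq' α]
    rw [gud, rot _ _ hx]
    congr 1; ext θ
    congr 4
    rw [Real.cos_sq']
    ring
  simp_rw [e] at h
  rw [lintegral_const_mul] at h
  · rw [even_lint (by intro x; simp)] at h
    have : (2 * 2 : ℝ≥0∞) * (kap w * kap (1 - w)) = (2 * 2) * (∫⁻ α in Ioi (0:ℝ), ∫⁻ θ in Ioo 0 (π/2),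
      ENNReal.ofReal ((√(Real.cosh α ^ 2 * Real.cos θ ^ 2 + 4 * w * (1 - w) * Real.sin θ ^ 2))⁻¹)) := by
      rw [mul_assoc 2 2 (lintegral _ _), ← h]; ring
    exact (ENNReal.mul_right_inj (by norm_num) (by finiteness)).1 this
  · refine Measurable.lintegral_prod_right' (f := fun p : ℝ × ℝ => 
      ENNReal.ofReal ((√(Real.cosh p.1 ^ 2 * Real.cos p.2 ^ 2 + 4 * w * (1 - w) * Real.sin p.2 ^ 2))⁻¹)) ?_
    fun_prop


lemma Whalf {y : ℝ} (h0 : 0 < y) (h1 : y < 1) : 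
    W (1/2) (1/2) y = ENNReal.ofReal ((√y * √(1 - y))⁻¹) := by
  have h1' : 0 < 1 - y := by linarith
  unfold W
  rw [show (1/2 - 1 : ℝ) = -(1/2) by norm_num, Real.rpow_neg h0.le, Real.rpow_neg h1'.le,
    ← Real.sqrt_eq_rpow, ← Real.sqrt_eq_rpow, mul_inv]

lemma inner_y {m : ℝ} (hm : 0 < m) : 
    ∫⁻ y in Ioo (0:ℝ) 1, W (1/2) (1/2) y * ENNReal.ofReal ((1 - y + m * y) ^ (-(1/2):ℝ)) =
    ∫⁻ θ in Ioo 0 (π/2), ENNReal.ofReal (2 * (√(Real.cos θ ^ 2 + m * Real.sin θ ^ 2))⁻¹) := by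
  have e : ∀ y ∈ Ioo (0:ℝ) 1, W (1/2) (1/2) y * ENNReal.ofReal ((1 - y + m * y) ^ (-(1/2):ℝ)) = 
      ENNReal.ofReal ((√y * √(1 - y))⁻¹ * (√(1 - y + m * y))⁻¹) := by
    rintro y ⟨h0, h1⟩
    have h1' : 0 < 1 - y := by linarith
    rw [Whalf h0 h1, ← ENNReal.ofReal_mul (by positivity), Real.rpow_neg (by positivity), 
      ← Real.sqrt_eq_rpow]
  rw [setLIntegral_congr_fun measurableSet_Ioo e]
  have hsc : ∀ θ ∈ Ioo 0 (π/2), 0 < Real.sin θ ∧ 0 < Real.cos θ := by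
    rintro θ ⟨a, b⟩
    exact ⟨Real.sin_pos_of_pos_of_lt_pi a (by linarith), 
      Real.cos_pos_of_mem_Ioo ⟨by linarith, by linarith⟩⟩
  refine covr (φ := fun θ => Real.sin θ ^ 2) (φ' := fun θ => 2 * Real.sin θ * Real.cos θ)
    (ψ := fun y => Real.arcsin (√y)) measurableSet_Ioo ?_ ?_ ?_ ?_ ?_ ?_
  · intro θ h
    obtain ⟨a, b⟩ := hsc θ h
    have := Real.sin_sq_add_cos_sq θ
    exact ⟨by positivity, by nlinarith⟩
  · rintro y ⟨h0, h1⟩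
    refine ⟨Real.arcsin_pos.2 (Real.sqrt_pos.2 h0), Real.arcsin_lt_pi_div_two.2 ?_⟩
    rw [Real.sqrt_lt' one_pos]; simpa using h1
  · intro θ h
    obtain ⟨a, b⟩ := hsc θ h
    rw [Real.sqrt_sq a.le, Real.arcsin_sin (by linarith [h.1, Real.pi_pos]) h.2.le]
  · rintro y ⟨h0, h1⟩
    have := Real.sqrt_nonneg y
    rw [Real.sin_arcsin (by linarith) (Real.sqrt_le_one.2 h1.le), Real.sq_sqrt h0.le]
  · intro θ _
    simpa using (Real.hasDerivAt_sin θ).fun_pow 2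
  · intro θ h
    obtain ⟨a, b⟩ := hsc θ h
    rw [← Real.cos_sq', Real.sqrt_sq a.le, Real.sqrt_sq b.le, abs_of_pos (by positivity)]
    field_simp

lemma Phi_kap {w : ℝ} (h0 : 0 < w) (h1 : w < 1) : 
    Phi (4 * w * (1 - w)) = 4 * (kap w * kap (1 - w)) := by
  have h1' : 0 < 1 - w := by linarith
  rw [prod2 h0 h1]
  set z := 4 * w * (1 - w) with hz
  have hz0 : 0 < z := by positivity
  have e : ∀ c ∈ Ioo (0:ℝ) 1, ∫⁻ y in Ioo (0:ℝ) 1, 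
      W (1/2) (1/2) c * W (1/2) (1/2) y * ENNReal.ofReal ((1 - y + z * c * y) ^ (-(1/2):ℝ)) = 
      W (1/2) (1/2) c * ∫⁻ θ in Ioo 0 (π/2), 
        ENNReal.ofReal (2 * (√(Real.cos θ ^ 2 + z * c * Real.sin θ ^ 2))⁻¹) := by
    rintro c ⟨a, b⟩
    rw [← inner_y (by positivity), ← lintegral_const_mul _ (by fun_prop)]
    simp_rw [mul_assoc]
  rw [Phi, setLIntegral_congr_fun measurableSet_Ioo e]
  rw [cov (s := Ioi (0:ℝ)) (φ := fun α => (Real.cosh α ^ 2)⁻¹) 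
    (φ' := fun α => -(2 * Real.cosh α * Real.sinh α) / (Real.cosh α ^ 2) ^ 2)
    (ψ := fun c => Real.arsinh (√(c⁻¹ - 1))) measurableSet_Ioi]
  · rw [← lintegral_const_mul]
    · refine setLIntegral_congr_fun measurableSet_Ioi fun α hα => ?_
      have hα : 0 < α := hα
      have hs : 0 < Real.sinh α := Real.sinh_pos_iff.2 hα
      have hc : 0 < Real.cosh α := Real.cosh_pos α
      have hc1 : 1 < Real.cosh α ^ 2 := by rw [Real.cosh_sq]; nlinarith
      have e1 : 1 - (Real.cosh α ^ 2)⁻¹ = (Real.sinh α / Real.cosh α) ^ 2 := by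
        field_simp; rw [Real.cosh_sq]; ring
      rw [Whalf (by positivity) (inv_lt_one_of_one_lt₀ hc1), ← mul_assoc, ← ENNReal.ofReal_mul (by positivity),
        e1, ← lintegral_const_mul _ (by fun_prop), ← lintegral_const_mul _ (by fun_prop)]
      refine setLIntegral_congr_fun measurableSet_Ioo fun θ _ => ?_
      rw [← ENNReal.ofReal_mul (by positivity), show (4:ℝ≥0∞) = ENNReal.ofReal 4 by norm_num,
        ← ENNReal.ofReal_mul (by positivity)]
      congr 1
      have e2 : Real.cos θ ^ 2 + z * (Real.cosh α ^ 2)⁻¹ * Real.sin θ ^ 2 = 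
        (Real.cosh α ^ 2)⁻¹ * (Real.cosh α ^ 2 * Real.cos θ ^ 2 + z * Real.sin θ ^ 2) := by
        field_simp
      rw [e2, Real.sqrt_mul (by positivity), Real.sqrt_inv, Real.sqrt_sq hc.le, Real.sqrt_sq (by positivity),
        neg_div, abs_neg, abs_of_pos (by positivity), mul_inv]
      field_simp
      norm_num
    · refine Measurable.lintegral_prod_right' (f := fun p : ℝ × ℝ => 
        ENNReal.ofReal ((√(Real.cosh p.1 ^ 2 * Real.cos p.2 ^ 2 + z * Real.sin p.2 ^ 2))⁻¹)) ?_
      fun_prop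
  · intro α hα
    have hα : 0 < α := hα
    have hs : 0 < Real.sinh α := Real.sinh_pos_iff.2 hα
    have hc1 : 1 < Real.cosh α ^ 2 := by rw [Real.cosh_sq]; nlinarith
    exact ⟨by positivity, inv_lt_one_of_one_lt₀ hc1⟩
  · rintro c ⟨a, b⟩
    refine Real.arsinh_pos_iff.2 (Real.sqrt_pos.2 ?_)
    have := (one_lt_inv₀ a).2 b
    linarith
  · intro α hα
    have hα : 0 < α := hα
    have hs : 0 < Real.sinh α := Real.sinh_pos_iff.2 hα
    simp only [inv_inv]
    rw [Real.cosh_sq, add_sub_cancel_right, Real.sqrt_sq hs.le, Real.arsinh_sinh]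
  · rintro c ⟨a, b⟩
    have := (one_lt_inv₀ a).2 b
    rw [Real.cosh_sq, Real.sinh_arsinh, Real.sq_sqrt (by linarith)]
    simp
  · intro α _
    have hc : 0 < Real.cosh α := Real.cosh_pos α
    have := ((Real.hasDerivAt_cosh α).fun_pow 2).fun_inv (pow_pos hc 2).ne'
    simpa using this

/-- the basic radius -/
noncomputable def RR (r p : ℝ) : ℝ := √(1 + r ^ 2 + 2 * r * Real.cosh p)

lemma RR_sq {r : ℝ} (hr : 0 < r) (p : ℝ) : RR r p ^ 2 = 1 + r ^ 2 + 2 * r * Real.cosh p := by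
  have := Real.cosh_pos p
  exact Real.sq_sqrt (by positivity)

lemma RR_gt {r p : ℝ} (hr : 0 < r) (hp : 0 < p) : 1 + r < RR r p := by
  have : 1 < Real.cosh p := Real.one_lt_cosh.2 hp.ne'
  refine Real.lt_sqrt_of_sq_lt ?_
  nlinarith

lemma RR_deriv {r p : ℝ} (hr : 0 < r) : 
    HasDerivAt (RR r) (r * Real.sinh p / RR r p) p := by
  have h0 : 0 < 1 + r ^ 2 + 2 * r * Real.cosh p := by have := Real.cosh_pos p; positivity
  have := (((Real.hasDerivAt_cosh p).const_mul (2 * r)).const_add (1 + r ^ 2)).sqrt h0.ne'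
  refine this.congr_deriv ?_
  rw [RR]
  field_simp

lemma b_sqrt {r y R : ℝ} (hr : 0 < r) (hy : r ^ 2 = 1 - y ^ 2) (hR : 1 + r < R) :
    0 < (R - 2 + y ^ 2 / R) / 4 := by
  have : 0 < R := by linarith
  have e : (R - 2 + y ^ 2 / R) / 4 = ((R - 1) ^ 2 - r ^ 2) / (4 * R) := by
    field_simp; rw [hy]; ring
  rw [e]
  have : 0 < (R - 1) ^ 2 - r ^ 2 := by nlinarith
  positivity

lemma kap_R {y r : ℝ} (hr : 0 < r) (hy : r ^ 2 = 1 - y ^ 2) :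
    kap ((1 - y) / 2) = ∫⁻ p in Ioi (0:ℝ), 
      ENNReal.ofReal ((RR r p + y) * √(RR r p) / (2 * RR r p ^ 2)) := by
  have hy1 : y < 1 := by nlinarith
  have hy2 : -1 < y := by nlinarith
  have hr1 : r ≤ 1 := by nlinarith [sq_nonneg y]
  refine covr (φ := fun p => √((RR r p - 2 + y ^ 2 / RR r p) / 4))
    (φ' := fun p => r * Real.sinh p * (RR r p ^ 2 - y ^ 2) / 
      (8 * RR r p ^ 3 * √((RR r p - 2 + y ^ 2 / RR r p) / 4)))
    (ψ := fun b => Real.arsinh (√(((((1 + 2 * b ^ 2) + √((1 + 2 * b ^ 2) ^ 2 - y ^ 2)) ^ 2 - 1 - r ^ 2) / (2 * r)) ^ 2 - 1)))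
    measurableSet_Ioi ?_ ?_ ?_ ?_ ?_ ?_
  · intro p hp
    exact Real.sqrt_pos.2 (b_sqrt hr hy (RR_gt hr hp))
  · intro b hb
    have hb : 0 < b := hb
    refine Real.arsinh_pos_iff.2 (Real.sqrt_pos.2 ?_)
    have h1 : r < √((1 + 2 * b ^ 2) ^ 2 - y ^ 2) := by
      refine Real.lt_sqrt_of_sq_lt ?_
      nlinarith [sq_nonneg (b^2), pow_pos hb 2]
    set S := √((1 + 2 * b ^ 2) ^ 2 - y ^ 2)
    have h2 : 1 + r < 1 + 2 * b ^ 2 + S := by nlinarith [pow_pos hb 2]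
    have h3 : 1 < ((1 + 2 * b ^ 2 + S) ^ 2 - 1 - r ^ 2) / (2 * r) := by
      rw [lt_div_iff₀ (by positivity)]; nlinarith
    nlinarith
  · intro p hp
    have hp : 0 < p := hp
    have hR := RR_gt hr hp
    have hR2 := RR_sq hr p
    have hb := b_sqrt hr hy hR
    simp only [Real.sq_sqrt hb.le]
    set R := RR r p
    have hR0 : 0 < R := by linarith
    have e1 : (1 + 2 * ((R - 2 + y ^ 2 / R) / 4)) ^ 2 - y ^ 2 = ((R - y ^ 2 / R) / 2) ^ 2 := by
      field_simp; ring
    have e2 : 0 ≤ (R - y ^ 2 / R) / 2 := by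
      have : R - y ^ 2 / R = (R ^ 2 - y ^ 2) / R := by field_simp
      rw [this]
      have : 0 ≤ R ^ 2 - y ^ 2 := by nlinarith
      positivity
    rw [e1, Real.sqrt_sq e2]
    have e3 : ((1 + 2 * ((R - 2 + y ^ 2 / R) / 4) + (R - y ^ 2 / R) / 2) ^ 2 - 1 - r ^ 2) / (2 * r) = Real.cosh p := by
      have : 1 + 2 * ((R - 2 + y ^ 2 / R) / 4) + (R - y ^ 2 / R) / 2 = R := by ring
      rw [this, hR2]; field_simp; ring
    rw [e3, Real.cosh_sq, add_sub_cancel_right, Real.sqrt_sq (Real.sinh_pos_iff.2 hp).le, Real.arsinh_sinh]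
  · intro b hb
    have hb : 0 < b := hb
    have h0 : 0 ≤ (1 + 2 * b ^ 2) ^ 2 - y ^ 2 := by nlinarith [sq_nonneg (b^2), pow_pos hb 2]
    have h1 : r < √((1 + 2 * b ^ 2) ^ 2 - y ^ 2) := by
      refine Real.lt_sqrt_of_sq_lt ?_
      nlinarith [sq_nonneg (b^2), pow_pos hb 2]
    have hS := Real.sq_sqrt h0
    set S := √((1 + 2 * b ^ 2) ^ 2 - y ^ 2)
    have h2 : 1 + r < 1 + 2 * b ^ 2 + S := by nlinarith [pow_pos hb 2]
    have h3 : 1 < ((1 + 2 * b ^ 2 + S) ^ 2 - 1 - r ^ 2) / (2 * r) := by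
      rw [lt_div_iff₀ (by positivity)]; nlinarith
    have h4 : RR r (Real.arsinh (√((((1 + 2 * b ^ 2 + S) ^ 2 - 1 - r ^ 2) / (2 * r)) ^ 2 - 1))) = 
        1 + 2 * b ^ 2 + S := by
      rw [RR, Real.cosh_arsinh, Real.sq_sqrt (by nlinarith), add_sub_cancel, Real.sqrt_sq (by linarith)]
      rw [show 1 + r ^ 2 + 2 * r * (((1 + 2 * b ^ 2 + S) ^ 2 - 1 - r ^ 2) / (2 * r)) = (1 + 2 * b ^ 2 + S) ^ 2 by
        field_simp; ring]
      exact Real.sqrt_sq (by linarith)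
    simp only [h4]
    have h5 : (1 + 2 * b ^ 2 + S - 2 + y ^ 2 / (1 + 2 * b ^ 2 + S)) / 4 = b ^ 2 := by
      have : 0 < 1 + 2 * b ^ 2 + S := by linarith
      field_simp
      nlinarith
    rw [h5, Real.sqrt_sq hb.le]
  · intro p hp
    have hp : 0 < p := hp
    have hR := RR_gt hr hp
    have hR0 : 0 < RR r p := by linarith
    have hb := b_sqrt hr hy hR
    have hd := RR_deriv (p := p) hr
    have := (((hd.sub_const 2).fun_add ((hasDerivAt_const p (y ^ 2)).fun_div hd hR0.ne')).div_const 4).sqrt hb.ne'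
    refine this.congr_deriv ?_
    have := Real.sqrt_pos.2 hb
    field_simp
    ring
  · intro p hp
    have hp : 0 < p := hp
    have hR := RR_gt hr hp
    have hR2 := RR_sq hr p
    have hb := b_sqrt hr hy hR
    rw [Real.sq_sqrt hb.le]
    have hs : 0 < Real.sinh p := Real.sinh_pos_iff.2 hp
    have hc := Real.cosh_sq p
    set R := RR r p
    set b2 := (R - 2 + y ^ 2 / R) / 4
    have hR0 : 0 < R := by linarith
    have hRy : 0 < R - y := by linarith
    have hRy2 : 0 < R ^ 2 - y ^ 2 := by nlinarith
    have e1 : (1 - y) / 2 + b2 = (R - y) ^ 2 / (4 * R) := by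
      simp only [b2]; field_simp; ring
    have e2 : b2 * (1 + b2) = (r * Real.sinh p / (2 * R)) ^ 2 := by
      have : b2 * (1 + b2) = ((R ^ 2 + y ^ 2) ^ 2 - 4 * R ^ 2) / (16 * R ^ 2) := by
        simp only [b2]; field_simp; ring
      rw [this]
      have : (R ^ 2 + y ^ 2) ^ 2 - 4 * R ^ 2 = 4 * r ^ 2 * Real.sinh p ^ 2 := by
        rw [hR2, show y ^ 2 = 1 - r ^ 2 by linarith]; 
        linear_combination (4 * r ^ 2) * hc
      rw [this]; field_simp; ring
    have e3 : √b2 * √(1 + b2) = r * Real.sinh p / (2 * R) := by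
      rw [← Real.sqrt_mul hb.le, e2, Real.sqrt_sq (by positivity)]
    have e4 : √((1 + b2) * ((1 - y) / 2 + b2)) = √(1 + b2) * ((R - y) / (2 * √R)) := by
      rw [Real.sqrt_mul (by positivity), e1, Real.sqrt_div (by positivity), Real.sqrt_sq hRy.le,
        Real.sqrt_mul (by norm_num), show (4:ℝ) = 2 ^ 2 by norm_num, Real.sqrt_sq (by norm_num)]
    have hsb := Real.sqrt_pos.2 hb
    have hsR := Real.sqrt_pos.2 hR0
    have hsb1 : 0 < √(1 + b2) := by positivity
    rw [e4, abs_of_pos (by positivity)]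
    have e5 : r * Real.sinh p = √b2 * √(1 + b2) * (2 * R) := by rw [e3]; field_simp
    rw [e5]
    field_simp
    ring

lemma A2_R {x r : ℝ} (hr : 0 < r) (hx : r ^ 2 = 1 - x ^ 2) :
    A2 x = 2 * ∫⁻ p in Ioi (0:ℝ), ENNReal.ofReal ((√(RR r p))⁻¹) := by
  rw [← even_lint (by intro p; simp [RR]), ← setLIntegral_univ, A2]
  have hx2 : x ^ 2 < 1 := by nlinarith
  have e : ∀ τ ∈ Ioo (0:ℝ) 1, W (1/4) (1/4) τ * ENNReal.ofReal ((1 - x^2*τ)^(-(1/4):ℝ)) = 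
    ENNReal.ofReal (τ ^ (-(3/4):ℝ) * (1 - τ) ^ (-(3/4):ℝ) * (1 - x^2*τ)^(-(1/4):ℝ)) := by
    rintro τ ⟨h0, h1⟩
    have : 0 < 1 - τ := by linarith
    rw [W, ← ENNReal.ofReal_mul (by positivity)]
    norm_num
  rw [setLIntegral_congr_fun measurableSet_Ioo e]
  refine covr (φ := fun p => (1 + r * Real.exp p)⁻¹) 
    (φ' := fun p => -(r * Real.exp p) / (1 + r * Real.exp p) ^ 2)
    (ψ := fun τ => Real.log ((τ⁻¹ - 1) / r)) MeasurableSet.univ ?_ ?_ ?_ ?_ ?_ ?_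
  · intro p _
    have := Real.exp_pos p
    exact ⟨by positivity, inv_lt_one_of_one_lt₀ (by nlinarith [mul_pos hr this])⟩
  · simp
  · intro p _
    simp only [inv_inv, add_sub_cancel_left]
    rw [mul_div_cancel_left₀ _ hr.ne', Real.log_exp]
  · rintro τ ⟨a, b⟩
    have := (one_lt_inv₀ a).2 b
    rw [Real.exp_log (div_pos (by linarith) hr), mul_div_cancel₀ _ hr.ne']
    simp
  · intro p _
    have := Real.exp_pos p
    exact (((Real.hasDerivAt_exp p).const_mul r).const_add 1).fun_inv (by positivity)
  · intro p _
    have he := Real.exp_pos p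
    have hR2 := RR_sq hr p
    have hR : 0 < RR r p := by
      have := Real.cosh_pos p
      exact Real.sqrt_pos.2 (by positivity)
    set R := RR r p
    set E := Real.exp p with hE
    have e1 : 1 - (1 + r * E)⁻¹ = r * E / (1 + r * E) := by field_simp; ring
    have e2 : 1 - x ^ 2 * (1 + r * E)⁻¹ = r * (E + r) / (1 + r * E) := by
      rw [show x ^ 2 = 1 - r ^ 2 by linarith]; field_simp; ring
    have e3 : R ^ 2 * E = (1 + r * E) * (E + r) := by
      rw [hR2, Real.cosh_eq, Real.exp_neg, ← hE]; field_simp; ring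
    have e4 : 2 * Real.log R + Real.log E = Real.log (1 + r * E) + Real.log (E + r) := by
      rw [← Real.log_mul (by positivity) (by positivity), ← e3, Real.log_mul (by positivity) (by positivity),
        Real.log_pow]; norm_num
    rw [e1, e2, neg_div, abs_neg, abs_of_pos (by positivity), Real.sqrt_eq_rpow]
    apply eq_of_log (by positivity) (by positivity)
    simp (disch := positivity) only [Real.log_mul, Real.log_div, Real.log_rpow, Real.log_pow, Real.log_inv]
    push_cast
    linear_combination (1/4) * e4

lemma kap_sum {x : ℝ} (h0 : 0 < x) (h1 : x < 1) : 
    2 * (kap ((1 + x) / 2) + kap ((1 - x) / 2)) = A2 x := by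
  have hz : 0 < 1 - x ^ 2 := by nlinarith
  have hr : 0 < √(1 - x ^ 2) := Real.sqrt_pos.2 hz
  have hr2 := Real.sq_sqrt hz.le
  set r := √(1 - x ^ 2)
  have h2 := kap_R (y := -x) hr (by rw [hr2]; ring)
  rw [sub_neg_eq_add] at h2
  rw [h2, kap_R hr hr2, A2_R hr hr2, ← lintegral_add_left]
  · congr 1
    refine setLIntegral_congr_fun measurableSet_Ioi fun p hp => ?_
    have hR := RR_gt hr hp
    have hR0 : 0 < RR r p := by linarith
    have : 0 < RR r p + -x := by linarith
    have : 0 < RR r p + x := by linarith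
    rw [← ENNReal.ofReal_add (by positivity) (by positivity)]
    congr 1
    have h3 := Real.sqrt_pos.2 hR0
    have h4 := Real.sq_sqrt hR0.le
    field_simp
    rw [h4]; ring
  · unfold RR; fun_prop

attribute [fun_prop] kap_meas Phi_meas

lemma fold {f : ℝ → ℝ≥0∞} (hf : Measurable f) :
    ∫⁻ x in Ioo (-1:ℝ) 1, f x = ∫⁻ x in Ioo (0:ℝ) 1, (f x + f (-x)) := by
  have h1 : ∫⁻ x in Ioo (-1:ℝ) 1, f x = ∫⁻ x in Ioo (-1:ℝ) 1, f (-x) := by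
    rw [cov (s := Ioo (-1:ℝ) 1) (t := Ioo (-1:ℝ) 1) (φ := fun x => -x) (φ' := fun _ => -1) (ψ := fun x => -x)
      measurableSet_Ioo]
    · simp
    · rintro x ⟨a, b⟩; constructor <;> linarith
    · rintro x ⟨a, b⟩; constructor <;> linarith
    · intro x _; simp
    · intro x _; simp
    · intro x _; exact (hasDerivAt_id x).neg
  have h2 := even_lint_Ioo (f := fun x => f x + f (-x)) (by intro x; simp [add_comm]) 1
  rw [lintegral_add_left hf, ← h1, ← two_mul] at h2
  exact (ENNReal.mul_right_inj (by norm_num) (by finiteness)).1 h2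

/-- the integrand -/
noncomputable def FF (k : ℝ) : ℝ≥0∞ := kap (k ^ 2) ^ 2 * kap (1 - k ^ 2) * 
  ENNReal.ofReal ((√k * (1 - k ^ 2) ^ ((3:ℝ)/4))⁻¹)

lemma step1 : 4 * ∫⁻ k in Ioo (0:ℝ) 1, FF k = ∫⁻ x in Ioo (-1:ℝ) 1, 
    ENNReal.ofReal (√2 / 2 * (1 - x ^ 2) ^ (-(3/4):ℝ)) * Phi (1 - x ^ 2) * kap ((1 + x) / 2) := by
  rw [cov (s := Ioo (-1:ℝ) 1) (φ := fun x => √((1 + x) / 2)) (φ' := fun x => 1 / 2 / (2 * √((1 + x) / 2)))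
    (ψ := fun k => 2 * k ^ 2 - 1) measurableSet_Ioo]
  · rw [← lintegral_const_mul]
    · refine setLIntegral_congr_fun measurableSet_Ioo ?_
      rintro x ⟨h0, h1⟩
      have ha : 0 < 1 + x := by linarith
      have hb : 0 < 1 - x := by linarith
      have hp := Phi_kap (w := (1 + x) / 2) (by linarith) (by linarith)
      rw [show 4 * ((1 + x) / 2) * (1 - (1 + x) / 2) = 1 - x ^ 2 by ring] at hp
      have e : ENNReal.ofReal (√2 / 2 * (1 - x ^ 2) ^ (-(3/4):ℝ)) = 
          ENNReal.ofReal |1 / 2 / (2 * √((1 + x) / 2))| * 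
          ENNReal.ofReal ((√(√((1 + x) / 2)) * (1 - √((1 + x) / 2) ^ 2) ^ ((3:ℝ)/4))⁻¹) := by
        rw [← ENNReal.ofReal_mul (by positivity), Real.sq_sqrt (by positivity), abs_of_pos (by positivity),
          show 1 - x ^ 2 = (1 + x) * (1 - x) by ring, show 1 - (1 + x) / 2 = (1 - x) / 2 by ring]
        congr 1
        simp only [Real.sqrt_eq_rpow]
        apply eq_of_log (by positivity) (by positivity)
        simp (disch := positivity) only [Real.log_mul, Real.log_div, Real.log_rpow, Real.log_pow, 
          Real.log_inv, Real.log_one]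
        ring
      simp only [FF]
      rw [e, Real.sq_sqrt (by positivity), hp]
      ring
    · unfold FF; fun_prop
  · rintro x ⟨h0, h1⟩
    refine ⟨Real.sqrt_pos.2 (by linarith), ?_⟩
    rw [Real.sqrt_lt' one_pos]; linarith
  · rintro k ⟨h0, h1⟩
    constructor <;> nlinarith
  · rintro x ⟨h0, h1⟩
    simp only [Real.sq_sqrt (show 0 ≤ (1 + x) / 2 by linarith)]
    ring
  · rintro k ⟨h0, h1⟩
    rw [show (1 + (2 * k ^ 2 - 1)) / 2 = k ^ 2 by ring, Real.sqrt_sq h0.le]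
  · rintro x ⟨h0, h1⟩
    exact (((hasDerivAt_id x).const_add 1).div_const 2).sqrt (by simp; linarith)

lemma A2_meas : Measurable A2 := by
  unfold A2
  refine Measurable.lintegral_prod_right' (f := fun p : ℝ × ℝ => 
    W (1/4) (1/4) p.2 * ENNReal.ofReal ((1 - p.1^2*p.2)^(-(1/4):ℝ))) ?_
  fun_prop

attribute [fun_prop] A2_meas

lemma step2 : 8 * ∫⁻ k in Ioo (0:ℝ) 1, FF k = ∫⁻ x in Ioo (0:ℝ) 1, 
    ENNReal.ofReal (√2 / 2 * (1 - x ^ 2) ^ (-(3/4):ℝ)) * Phi (1 - x ^ 2) * A2 x := by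
  rw [show (8:ℝ≥0∞) = 2 * 4 by norm_num, mul_assoc, step1, fold (by fun_prop), ← lintegral_const_mul _ (by fun_prop)]
  refine setLIntegral_congr_fun measurableSet_Ioo ?_
  rintro x ⟨h0, h1⟩
  simp only [← kap_sum h0 h1, neg_sq, ← sub_eq_add_neg]
  ring

lemma step3 : 8 * ∫⁻ k in Ioo (0:ℝ) 1, FF k = ENNReal.ofReal (√2 / 4) * 
    ∫⁻ w in Ioo (0:ℝ) 1, W (1/4) (1/2) w * A2 (√(1-w)) * Phi w := by
  rw [step2, ← lintegral_const_mul _ (by fun_prop)]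
  rw [cov (s := Ioo (0:ℝ) 1) (φ := fun x => √(1 - x)) (φ' := fun x => -1 / (2 * √(1 - x)))
    (ψ := fun k => 1 - k ^ 2) measurableSet_Ioo]
  · refine setLIntegral_congr_fun measurableSet_Ioo ?_
    rintro z ⟨h0, h1⟩
    have hb : 0 < 1 - z := by linarith
    beta_reduce
    rw [Real.sq_sqrt hb.le, _root_.sub_sub_cancel]
    have e : ENNReal.ofReal |-1 / (2 * √(1 - z))| * ENNReal.ofReal (√2 / 2 * z ^ (-(3/4):ℝ)) = 
        ENNReal.ofReal (√2 / 4) * W (1/4) (1/2) z := by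
      rw [W, ← ENNReal.ofReal_mul (by positivity), ← ENNReal.ofReal_mul (by positivity), neg_div, abs_neg, abs_of_pos (by positivity)]
      congr 1
      rw [show (1/4 - 1:ℝ) = -(3/4) by norm_num, show (1/2 - 1:ℝ) = -(1/2) by norm_num,
        Real.rpow_neg hb.le, ← Real.sqrt_eq_rpow]
      field_simp
      norm_num
    calc _ = (ENNReal.ofReal |-1 / (2 * √(1 - z))| * ENNReal.ofReal (√2 / 2 * z ^ (-(3/4):ℝ))) * 
          (Phi z * A2 (√(1 - z))) := by ring
      _ = _ := by rw [e]; ring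
  · rintro x ⟨h0, h1⟩
    refine ⟨Real.sqrt_pos.2 (by linarith), ?_⟩
    rw [Real.sqrt_lt' one_pos]; linarith
  · rintro k ⟨h0, h1⟩
    constructor <;> nlinarith
  · rintro x ⟨h0, h1⟩
    simp only [Real.sq_sqrt (show 0 ≤ 1 - x by linarith)]
    ring
  · rintro k ⟨h0, h1⟩
    rw [_root_.sub_sub_cancel, Real.sqrt_sq h0.le]
  · rintro x ⟨h0, h1⟩
    exact ((hasDerivAt_id x).const_sub 1).sqrt (by simp; linarith)

lemma step4 : (∫⁻ k in Ioo (0:ℝ) 1, FF k).toReal = √2 / 32 * 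
    (ProbabilityTheory.beta (1/2) (1/4) ^ 2 * ProbabilityTheory.beta (1/4) (1/4) ^ 2) := by
  have h := congrArg ENNReal.toReal step3
  have b1 := ProbabilityTheory.beta_pos (α := 1/2) (β := 1/4) (by norm_num) (by norm_num)
  have b2 := ProbabilityTheory.beta_pos (α := 1/4) (β := 1/4) (by norm_num) (by norm_num)
  rw [← aconv Phi_meas, T_eval] at h
  simp only [ENNReal.toReal_mul, ENNReal.toReal_ofReal b1.le, ENNReal.toReal_ofReal b2.le,
    ENNReal.toReal_ofReal (show (0:ℝ) ≤ √2 / 4 by positivity), ENNReal.toReal_ofNat] at h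
  linarith

lemma value : √2 / 32 * 
    (ProbabilityTheory.beta (1/2) (1/4) ^ 2 * ProbabilityTheory.beta (1/4) (1/4) ^ 2) = 
    Real.Gamma (1/4) ^ 8 / (32 * √2 * π ^ 2) := by
  have h := Real.Gamma_mul_Gamma_one_sub (1/4)
  rw [show π * (1/4) = π / 4 by ring, Real.sin_pi_div_four, show (1 - 1/4:ℝ) = 3/4 by norm_num] at h
  have g1 : 0 < Real.Gamma (1/4) := Real.Gamma_pos_of_pos (by norm_num)
  have g3 : 0 < Real.Gamma (3/4) := Real.Gamma_pos_of_pos (by norm_num)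
  have hp := Real.sq_sqrt Real.pi_pos.le
  have hp0 := Real.sqrt_pos.2 Real.pi_pos
  have h2 := Real.sq_sqrt (show (0:ℝ) ≤ 2 by norm_num)
  have h20 := Real.sqrt_pos.2 (show (0:ℝ) < 2 by norm_num)
  have hg : Real.Gamma (3/4) = π * √2 / Real.Gamma (1/4) := by
    field_simp
    rw [mul_comm, h]
    field_simp
    rw [h2]
  unfold ProbabilityTheory.beta
  rw [show (1/2 + 1/4:ℝ) = 3/4 by norm_num, show (1/4 + 1/4:ℝ) = 1/2 by norm_num, Real.Gamma_one_half_eq, hg]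
  field_simp

lemma FF_eq {k : ℝ} (hk : k ∈ Ioo (0:ℝ) 1) : 
    FF k = ENNReal.ofReal ((ellipticK (Real.sqrt (1 - k ^ 2))) ^ 2 * ellipticK k
      / (Real.sqrt k * (1 - k ^ 2) ^ ((3:ℝ)/4))) := by
  obtain ⟨h0, h1⟩ := hk
  have hk2 : 0 < 1 - k ^ 2 := by nlinarith
  have e1 := ellK h0 h1
  have e2 := ellK (k := √(1 - k ^ 2)) (Real.sqrt_pos.2 hk2) (by
    rw [Real.sqrt_lt' one_pos]; nlinarith)
  rw [Real.sq_sqrt hk2.le, _root_.sub_sub_cancel] at e2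
  have n : ∀ k : ℝ, k ^ 2 ≤ 1 → 0 ≤ ellipticK k := by
    intro k hk
    refine intervalIntegral.integral_nonneg (by positivity) fun θ _ => Real.rpow_nonneg ?_ _
    nlinarith [Real.sin_sq_le_one θ, sq_nonneg (Real.sin θ)]
  have n1 := n k (by linarith)
  have n2 := n (√(1 - k ^ 2)) (by rw [Real.sq_sqrt hk2.le]; nlinarith)
  rw [FF, ← e1, ← e2, ← ENNReal.ofReal_pow n2, ← ENNReal.ofReal_mul (by positivity), 
    ← ENNReal.ofReal_mul (by positivity)]
  exact congrArg _ (div_eq_mul_inv _ _).symm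

lemma final : (∫ k in (0:ℝ)..1,
    (ellipticK (Real.sqrt (1 - k ^ 2))) ^ 2 * ellipticK k
      / (Real.sqrt k * (1 - k ^ 2) ^ ((3:ℝ)/4))) =
    Real.Gamma (1/4) ^ 8 / (32 * Real.sqrt 2 * π ^ 2) := by
  rw [← value, ← step4, intervalIntegral.integral_of_le zero_le_one, integral_Ioc_eq_integral_Ioo,
    ← integral_toReal]
  · refine setIntegral_congr_fun measurableSet_Ioo ?_
    intro k hk
    obtain ⟨h0, h1⟩ := id hk
    simp only
    rw [FF_eq hk, ENNReal.toReal_ofReal]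
    have hk2 : 0 < 1 - k ^ 2 := by nlinarith
    have n1 : 0 ≤ ellipticK k := by
      refine intervalIntegral.integral_nonneg (by positivity) fun θ _ => Real.rpow_nonneg ?_ _
      nlinarith [Real.sin_sq_le_one θ, sq_nonneg (Real.sin θ)]
    positivity
  · refine Measurable.aemeasurable ?_
    unfold FF; fun_prop
  · refine (ae_restrict_iff' measurableSet_Ioo).2 ?_
    filter_upwards with k hk
    rw [FF_eq hk]
    exact ENNReal.ofReal_lt_top

end S2

theorem stmt2 :
    (∫ k in (0:ℝ)..1, (ellipticK (Real.sqrt (1 - k ^ 2))) ^ 2 * ellipticK k /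
        (Real.sqrt k * (1 - k ^ 2) ^ ((3:ℝ)/4)))
      = Real.Gamma (1/4) ^ 8 / (32 * Real.sqrt 2 * π ^ 2) := by
  exact S2.final
end
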